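/- Fix p > 3/2 and r > 2p/(2p−3). There exists m*(p,r) > 0 such that the following a priori estimate holds. Suppose g : [0,T]×ℝ³ → [0,∞) satisfies the hypotheses: g ∈ L^r(0,T;L^p(ℝ³)); g ∈ W^{1,∞}(Ω) for each Ω compactly contained in (0,T]×ℝ³; g is a distributional solution of the homogeneous Landau–Coulomb equation; for a.e. t, g(t) is normalized and ∫ g(t) log g(t) dv is nonincreasing; and g(t) → g_in in distributions as t → 0⁺ with g_in ∈ L¹_m(ℝ³), m > m*(p,r), and ∫ g_in |log g_in| dv < ∞. Then there is a constant C, depending only on p, r, m, T, ‖g_in‖_{L¹_m}, the entropy bound, and ‖g‖_{L^r(0,T;L^p)}, such that for every 0 < t < T: sup_{t<τ<T} ‖g(τ)‖_{L^p}^p + ∫_t^T ∫_{ℝ³} ⟨v⟩^{−3} |∇(g^{p/2})|² dv dτ ≤ C t^{−p/r}. -/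

import Mathlib

open MeasureTheory Real Filter Set

noncomputable section

/-- Velocity space ℝ³. -/
abbrev V3 : Type := EuclideanSpace ℝ (Fin 3)

/-- Japanese bracket ⟨v⟩ = (1+|v|²)^{1/2}. -/
def jap (v : V3) : ℝ := Real.sqrt (1 + ‖v‖ ^ 2)

/-- Partial derivative in the i-th coordinate direction. -/
def pd (i : Fin 3) (g : V3 → ℝ) (v : V3) : ℝ :=
  fderiv ℝ g v (EuclideanSpace.single i 1)

/-- Projection matrix Π(z) = Id − z⊗z/|z|². -/
def projPi (z : V3) (i j : Fin 3) : ℝ :=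
  (if i = j then (1 : ℝ) else 0) - z i * z j / ‖z‖ ^ 2

/-- Landau–Coulomb diffusion matrix A[f]. -/
def coeffA (f : V3 → ℝ) (v : V3) (i j : Fin 3) : ℝ :=
  (8 * π)⁻¹ * ∫ w : V3, projPi (v - w) i j / ‖v - w‖ * f w

/-- Newtonian potential a[f] = (−Δ)⁻¹ f. -/
def coeffa (f : V3 → ℝ) (v : V3) : ℝ :=
  (4 * π)⁻¹ * ∫ w : V3, f w / ‖v - w‖

/-- The homogeneous Landau–Coulomb equation
    ∂_t f = ∇·(A[f]∇f − f ∇a[f]), pointwise at (t,v). -/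
def LandauEqAt (f : ℝ → V3 → ℝ) (t : ℝ) (v : V3) : Prop :=
  deriv (fun s => f s v) t =
    ∑ i : Fin 3, pd i
      (fun w => (∑ j : Fin 3, coeffA (f t) w i j * pd j (f t) w)
        - f t w * pd i (coeffa (f t)) w) v

/-- Normalization: unit mass, zero momentum, energy 3. -/
def IsNormalized (f : V3 → ℝ) : Prop :=
  (∫ v : V3, f v) = 1 ∧ (∀ i : Fin 3, (∫ v : V3, f v * v i) = 0) ∧
    (∫ v : V3, f v * ‖v‖ ^ 2) = 3

/-- Schwartz class function. -/
def IsSchwartz (g : V3 → ℝ) : Prop := ∃ h : SchwartzMap V3 ℝ, ⇑h = g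

/-- Distributional (weak) solution of the Landau–Coulomb equation on (0,T). -/
def IsWeakLandauSolution (T : ℝ) (g : ℝ → V3 → ℝ) : Prop :=
  ∀ φ : ℝ × V3 → ℝ, ContDiff ℝ (⊤ : ℕ∞) φ → HasCompactSupport φ →
    (Function.support φ ⊆ Set.Ioo 0 T ×ˢ (Set.univ : Set V3)) →
    (∫ t in Set.Ioo 0 T, ∫ v : V3, φ (t, v) * deriv (fun s => g s v) t) =
      - ∫ t in Set.Ioo 0 T, ∫ v : V3, ∑ i : Fin 3,
          (fderiv ℝ φ (t, v) (0, EuclideanSpace.single i 1)) *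
          ((∑ j : Fin 3, coeffA (g t) v i j * pd j (g t) v)
            - g t v * pd i (coeffa (g t)) v)

/-- Membership in L^r(0,T;L^p(ℝ³)). -/
def MemLrLp (r p T : ℝ) (g : ℝ → V3 → ℝ) : Prop :=
  (∀ᵐ t ∂(volume.restrict (Set.Ioo 0 T)), Integrable (fun v : V3 => |g t v| ^ p)) ∧
  IntegrableOn (fun t => (∫ v : V3, |g t v| ^ p) ^ (r / p)) (Set.Ioo 0 T)

/-- g ∈ W^{1,∞}(Ω) for every Ω compactly contained in (0,T] × ℝ³,
    i.e. g is Lipschitz on every compact subset of (0,T] × ℝ³. -/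
def LocLipschitz (T : ℝ) (g : ℝ → V3 → ℝ) : Prop :=
  ∀ K : Set (ℝ × V3), IsCompact K → K ⊆ Set.Ioc 0 T ×ˢ (Set.univ : Set V3) →
    ∃ L : NNReal, LipschitzOnWith L (fun q : ℝ × V3 => g q.1 q.2) K


end
open MeasureTheory Real Filter Set
local notation "FV" => V3 → ℝ
local notation "eof" => Eventually.of_forall
local notation "icm" => integral_const_mul
local notation "mll" => mul_le_mul_of_nonneg_left
local notation "mlr" => mul_le_mul_of_nonneg_right
local notation "iez" => image_eq_zero_of_notMem_tsupport
local notation "rnn" => Real.norm_of_nonneg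
local notation "oil" => ofReal_integral_eq_lintegral_ofReal
local notation "rna" => Real.norm_eq_abs
local notation "aon" => abs_of_nonneg
local notation "aop" => abs_of_pos
local notation "eor" => ENNReal.ofReal
local notation "arr" => ae_restrict_of_ae_restrict_of_subset
local notation "eoo" => ENNReal.ofReal_le_ofReal
local notation "eon" => ENNReal.ofReal_rpow_of_nonneg
local notation "rrn" => Real.rpow_natCast
local notation "su3" => Fin.sum_univ_three
local notation "msb" => measurableSet_closedBall
local notation "ard" => ae_restrict_mem
local notation "ict" => isCompact_closedBall
local notation "tdc" => tendsto_integral_of_dominated_convergence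
local notation:max "ei" n:max => 1 / ((n : ℝ) + 1)
local notation:max "CDI" x:max => ContDiff ℝ (⊤ : ℕ∞) x
local notation:max "dl" i:max j:max => if i = j then (1 : ℝ) else 0
noncomputable section
section moll
open Topology Metric ContinuousLinearMap Convolution
open scoped ENNReal NNReal ContDiff
variable {E : Type*} [NormedAddCommGroup E] [NormedSpace ℝ E] [FiniteDimensional ℝ E]
  [MeasurableSpace E] [BorelSpace E]
theorem ae_lineDeriv_eq_fderiv {μ : Measure E} [μ.IsAddHaarMeasure] {u : E → ℝ} {C : ℝ≥0}
    (hu : LipschitzWith C u) (v : E) : ∀ᵐ x ∂μ, lineDeriv ℝ u x v = fderiv ℝ u x v := by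
  filter_upwards [hu.ae_differentiableAt] with x hx using hx.lineDeriv_eq_fderiv
theorem moll {μ : Measure E} [μ.IsAddHaarMeasure] {u : E → ℝ} {C : ℝ≥0}
    (hu : LipschitzWith C u) (hc : HasCompactSupport u) {ε : ℝ} (hε : 0 < ε) :
    ∃ U : ℕ → E → ℝ, (∀ n, CDI (U n)) ∧
      (∀ n, tsupport (U n) ⊆ cthickening ε (tsupport u)) ∧
      (∀ n x, ‖fderiv ℝ (U n) x‖ ≤ C) ∧ (∀ x, Tendsto (fun n => U n x) atTop (𝓝 (u x))) ∧
      ∀ v, ∀ᵐ x ∂μ, Tendsto (fun n => fderiv ℝ (U n) x v) atTop (𝓝 (fderiv ℝ u x v)) := by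
  have hpos : ∀ n : ℕ, 0 < ε / (2 * (n + 1)) := fun n => by positivity
  let φ : ℕ → ContDiffBump (0 : E) := fun n =>
    ⟨ε / (2 * (n + 1)) / 2, ε / (2 * (n + 1)), half_pos (hpos n), half_lt_self (hpos n)⟩
  have hφr : Tendsto (fun n => (φ n).rOut) atTop (𝓝 0) := by
    have := (tendsto_one_div_add_atTop_nhds_zero_nat (𝕜 := ℝ)).const_mul (ε / 2)
    simp only [mul_zero] at this
    refine this.congr fun n => ?_
    simp only [φ]; field_simp
  let U : ℕ → E → ℝ := fun n => (φ n).normed μ ⋆[lsmul ℝ ℝ, μ] u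
  have hli : LocallyIntegrable u μ := hu.continuous.locallyIntegrable
  have hsm : ∀ n, CDI (U n) := fun n =>
    (φ n).hasCompactSupport_normed.contDiff_convolution_left _ (φ n).contDiff_normed hli
  have hUe : ∀ n x, U n x = ∫ y, u y * (φ n).normed μ (x - y) ∂μ := fun n x => by
    simp only [U]; rw [convolution_eq_swap]; simp [mul_comm]
  have hint : ∀ n x, Integrable (fun y => (φ n).normed μ (x - y)) μ := fun n x =>
    (φ n).integrable_normed.comp_sub_left x
  have hint2 : ∀ n x, Integrable (fun y => u y * (φ n).normed μ (x - y)) μ := fun n x => by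
    refine (Continuous.integrable_of_hasCompactSupport ?_ ?_)
    · exact hu.continuous.mul ((φ n).continuous_normed.comp (by fun_prop))
    · exact hc.mul_right
  have hshift : ∀ n x w, U n (x + w) = ∫ y, u (y + w) * (φ n).normed μ (x - y) ∂μ := fun n x w => by
    rw [hUe, ← integral_add_right_eq_self _ w]
    congr 1; ext y; congr 2; abel
  have hint3 : ∀ n x w, Integrable (fun y => u (y + w) * (φ n).normed μ (x - y)) μ :=
    fun n x w => by
    have := (hint2 n (x + w)).comp_add_right w
    refine this.congr (.of_forall fun y => ?_)
    simp
  have hlip : ∀ n, LipschitzWith C (U n) := fun n => by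
    refine LipschitzWith.of_dist_le_mul fun x y => ?_
    have h1 : U n x - U n y = ∫ z, (u (z + (x - y)) - u z) * (φ n).normed μ (y - z) ∂μ := by
      have := hshift n y (x - y)
      rw [add_sub_cancel] at this
      rw [this, hUe n y, ← integral_sub (hint3 _ _ _) (hint2 _ _)]
      congr 1; ext z; ring
    rw [Real.dist_eq, h1, ← rna]
    calc _ ≤ ∫ z, C * dist x y * (φ n).normed μ (y - z) ∂μ := by
          refine norm_integral_le_of_norm_le ((hint n y).const_mul _) (.of_forall fun z => ?_)
          rw [norm_mul, rna ((φ n).normed μ (y - z)),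
            aon ((φ n).nonneg_normed _)]
          refine mlr ?_ ((φ n).nonneg_normed _)
          rw [← dist_eq_norm]
          refine (hu.dist_le_mul _ _).trans_eq ?_
          simp [dist_eq_norm]
      _ = _ := by
          rw [icm, integral_sub_left_eq_self (fun z => (φ n).normed μ z) μ y,
            (φ n).integral_normed, mul_one]
  have hder : ∀ n x v, fderiv ℝ (U n) x v =
      ((φ n).normed μ ⋆[lsmul ℝ ℝ, μ] fun y => lineDeriv ℝ u y v) x := fun n x v => by
    have h1 := (((hsm n).differentiable (by simp)) x).hasFDerivAt.hasLineDerivAt v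
    have h2 := hu.integral_inv_smul_sub_mul_tendsto_integral_lineDeriv_mul (hint n x) v
    rw [convolution_eq_swap]
    have h3 : ∫ t, ((lsmul ℝ ℝ) ((φ n).normed μ (x - t))) (lineDeriv ℝ u t v) ∂μ
      = ∫ x_1, lineDeriv ℝ u x_1 v * (φ n).normed μ (x - x_1) ∂μ := by simp [mul_comm]
    rw [h3]
    refine tendsto_nhds_unique h1.tendsto_slope_zero_right (h2.congr fun t => ?_)
    rw [hshift n x (t • v), hUe n x, ← integral_sub (hint3 _ _ _) (hint2 _ _), smul_eq_mul,
      ← icm]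
    congr 1; ext z; simp only [smul_eq_mul]; ring
  refine ⟨U, hsm, fun n => ?_, fun n x => norm_fderiv_le_of_lipschitz ℝ (hlip n),
    fun x => ContDiffBump.convolution_tendsto_right_of_continuous hφr hu.continuous x, fun v => ?_⟩
  · refine closure_minimal ?_ isClosed_cthickening
    refine (support_convolution_subset _).trans ?_
    rw [(φ n).support_normed_eq]
    rintro _ ⟨a, ha, y, hy, rfl⟩
    refine mem_cthickening_of_dist_le _ y _ _ (subset_closure hy) ?_
    rw [mem_ball_zero_iff] at ha
    simp only [dist_add_self_left]
    refine ha.le.trans ?_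
    simp only [φ]
    rw [div_le_iff₀ (by positivity)]
    have : (0:ℝ) ≤ n := n.cast_nonneg
    nlinarith
  · have := ContDiffBump.ae_convolution_tendsto_right_of_locallyIntegrable (K := 2) hφr
      (.of_forall fun n => by simp only [φ]; linarith) (hu.locallyIntegrable_lineDeriv v (μ := μ))
    filter_upwards [this, ae_lineDeriv_eq_fderiv (μ := μ) hu v] with x hx h2
    rw [← h2]
    exact hx.congr fun n => (hder n x v).symm
end moll
end
open MeasureTheory Real Filter Set
noncomputable section
open Topology Metric
open scoped NNReal
abbrev ee (i : Fin 3) : V3 := EuclideanSpace.single i 1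
theorem abs_coord_le (z : V3) (i : Fin 3) : |z i| ≤ ‖z‖ := by
  simpa using EuclideanSpace.norm_eq z ▸ (by
    apply Real.abs_le_sqrt
    simpa using Finset.single_le_sum (f := fun j => ‖z j‖ ^ 2) (fun j _ => sq_nonneg _)
      (Finset.mem_univ i) : |z i| ≤ √(∑ j, ‖z j‖ ^ 2))
theorem norm_ee (i : Fin 3) : ‖ee i‖ = 1 := by simp
theorem LocallyLipschitz.mulR {X : Type*} [PseudoEMetricSpace X] {f h : X → ℝ}
    (hf : LocallyLipschitz f) (hh : LocallyLipschitz h) : LocallyLipschitz fun x => f x * h x :=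
  ((contDiff_mul (𝕜 := ℝ) (𝔸 := ℝ)).locallyLipschitz).comp (hf.prodMk hh)
theorem exists_lip {E : Type*} [NormedAddCommGroup E] [NormedSpace ℝ E] [FiniteDimensional ℝ E]
    {f : E → ℝ} (hf : LocallyLipschitz f) (hc : HasCompactSupport f) :
    ∃ C, LipschitzWith C f := by
  obtain ⟨L, hL⟩ := (hf.locallyLipschitzOn (s := cthickening 1 (tsupport f))
    ).exists_lipschitzOnWith_of_compact hc.isCompact.cthickening
  obtain ⟨S, hS⟩ := hc.exists_bound_of_continuous hf.continuous
  have hS0 : 0 ≤ S := (norm_nonneg _).trans (hS 0)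
  have key : ∀ x ∈ tsupport f, ∀ y, dist (f x) (f y) ≤ (L + S) * dist x y := by
    intro x hx y
    by_cases hy : y ∈ cthickening 1 (tsupport f)
    · have := hL.dist_le_mul x (self_subset_cthickening _ hx) y hy
      nlinarith [dist_nonneg (x := x) (y := y)]
    · have h1 : 1 < dist x y := by
        by_contra h
        exact hy (mem_cthickening_of_dist_le y x _ _ hx (by rw [dist_comm]; linarith))
      have h2 : f y = 0 := iez
        fun h => hy (self_subset_cthickening _ h)
      rw [h2, dist_zero_right]
      nlinarith [hS x, L.coe_nonneg]
  refine ⟨L + ⟨S, hS0⟩, LipschitzWith.of_dist_le_mul fun x y => ?_⟩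
  change _ ≤ ((L:ℝ) + S) * _
  by_cases hx : x ∈ tsupport f
  · exact key x hx y
  · by_cases hy : y ∈ tsupport f
    · rw [dist_comm, dist_comm x]; exact key y hy x
    · rw [iez hx, iez hy]
      simp; positivity
structure LBM (F : FV) : Prop where
  meas : AEStronglyMeasurable F volume
  bdd : ∀ R : ℝ, ∃ C, ∀ x, ‖x‖ ≤ R → |F x| ≤ C
theorem LBM.of_cont {F : FV} (h : Continuous F) : LBM F := by
  refine ⟨h.aestronglyMeasurable, fun R => ?_⟩
  obtain ⟨C, hC⟩ := (ict (0:V3) R).exists_bound_of_continuousOn h.continuousOn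
  exact ⟨C, fun x hx => hC x (by simpa using hx)⟩
theorem LBM.mul {F G : FV} (hF : LBM F) (hG : LBM G) : LBM fun x => F x * G x := by
  refine ⟨hF.meas.mul hG.meas, fun R => ?_⟩
  obtain ⟨C, hC⟩ := hF.bdd R
  obtain ⟨D, hD⟩ := hG.bdd R
  refine ⟨C * D, fun x hx => ?_⟩
  rw [abs_mul]
  exact mul_le_mul (hC x hx) (hD x hx) (abs_nonneg _) ((abs_nonneg _).trans (hC x hx))
theorem LBM.add {F G : FV} (hF : LBM F) (hG : LBM G) : LBM fun x => F x + G x := by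
  refine ⟨hF.meas.add hG.meas, fun R => ?_⟩
  obtain ⟨C, hC⟩ := hF.bdd R
  obtain ⟨D, hD⟩ := hG.bdd R
  exact ⟨C + D, fun x hx => (abs_add_le _ _).trans (add_le_add (hC x hx) (hD x hx))⟩
theorem LBM.neg {F : FV} (hF : LBM F) : LBM fun x => - F x := by
  refine ⟨hF.meas.neg, fun R => ?_⟩
  obtain ⟨C, hC⟩ := hF.bdd R
  exact ⟨C, fun x hx => (abs_neg (F x)).trans_le (hC x hx)⟩
theorem LBM.sub {F G : FV} (hF : LBM F) (hG : LBM G) : LBM fun x => F x - G x := by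
  simpa [sub_eq_add_neg] using hF.add hG.neg
theorem LBM.sum {F : Fin 3 → FV} (hF : ∀ i, LBM (F i)) : LBM fun x => ∑ i, F i x := by
  simp only [su3]
  exact ((hF 0).add (hF 1)).add (hF 2)
theorem fderiv_bdd {f : FV} (hf : LocallyLipschitz f) (R : ℝ) :
    ∃ C, ∀ x, ‖x‖ ≤ R → ‖fderiv ℝ f x‖ ≤ C := by
  obtain ⟨L, hL⟩ := (hf.locallyLipschitzOn (s := closedBall 0 (R + 1))
    ).exists_lipschitzOnWith_of_compact (ict _ _)
  exact ⟨L, fun x hx => norm_fderiv_le_of_lipschitzOn ℝ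
    (closedBall_mem_nhds_of_mem (by simp; linarith)) hL⟩
theorem abs_pd_le (f : FV) (x : V3) (i : Fin 3) : |pd i f x| ≤ ‖fderiv ℝ f x‖ := by
  simpa [norm_ee, pd] using (fderiv ℝ f x).le_opNorm (ee i)
theorem LBM.pd {f : FV} (hf : LocallyLipschitz f) (i : Fin 3) : LBM (pd i f) := by
  refine ⟨(measurable_fderiv_apply_const ℝ f (ee i)).aestronglyMeasurable, fun R => ?_⟩
  obtain ⟨C, hC⟩ := fderiv_bdd hf R
  exact ⟨C, fun x hx => (abs_pd_le f x i).trans (hC x hx)⟩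
theorem cpt_ball {F : FV} (hc : HasCompactSupport F) : ∃ R > 0, ∀ x, R < ‖x‖ → F x = 0 := by
  obtain ⟨R, h0, hR⟩ := hc.isCompact.isBounded.exists_pos_norm_lt
  exact ⟨R, h0, fun x hx => iez fun h => by linarith [hR x h]⟩
theorem LBM.intg {F : FV} (hF : LBM F) (hc : HasCompactSupport F) : Integrable F := by
  obtain ⟨R, _, hR⟩ := cpt_ball hc
  obtain ⟨C, hC⟩ := hF.bdd R
  have h1 : IntegrableOn F (closedBall 0 R) :=
    Measure.integrableOn_of_bounded (M := C) (measure_closedBall_lt_top.ne) hF.meas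
      (ae_restrict_of_forall_mem msb fun x hx => hC x (by simpa using hx))
  refine h1.integrable_of_forall_notMem_eq_zero fun x hx => hR x (by simpa using hx)
theorem ll_ae_diff {f : FV} (hf : LocallyLipschitz f) : ∀ᵐ x, DifferentiableAt ℝ f x := by
  have : ∀ n : ℕ, ∀ᵐ x, x ∈ ball (0:V3) n → DifferentiableAt ℝ f x := fun n => by
    obtain ⟨L, hL⟩ := (hf.locallyLipschitzOn (s := closedBall 0 (n:ℝ))
      ).exists_lipschitzOnWith_of_compact (ict _ _)
    filter_upwards [(hL.mono ball_subset_closedBall).ae_differentiableWithinAt_of_mem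
      (μ := volume)] with x hx h
    exact (hx h).differentiableAt (isOpen_ball.mem_nhds h)
  filter_upwards [ae_all_iff.2 this] with x hx
  obtain ⟨n, hn⟩ := exists_nat_gt ‖x‖
  exact hx n (by simpa using hn)
theorem pd_mul {f h : FV} {x : V3} (hf : DifferentiableAt ℝ f x)
    (hh : DifferentiableAt ℝ h x) (i : Fin 3) :
    pd i (fun y => f y * h y) x = f x * pd i h x + h x * pd i f x := by
  unfold pd
  rw [fderiv_fun_mul hf hh]; simp
theorem cs_pd {f : FV} (hc : HasCompactSupport f) (i : Fin 3) : HasCompactSupport (pd i f) :=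
  hc.fderiv_apply ℝ (ee i)
theorem int_pd_zero {f : FV} (hf : LocallyLipschitz f) (hc : HasCompactSupport f)
    (i : Fin 3) : ∫ x, pd i f x = 0 := by
  obtain ⟨C, hC⟩ := exists_lip hf hc
  have := (LipschitzWith.const (1:ℝ) (α := V3)).integral_lineDeriv_mul_eq (μ := volume) hC hc
    (-(ee i))
  simp only [neg_neg, mul_one] at this
  have h3 : ∫ x, pd i f x = ∫ x, lineDeriv ℝ f x (ee i) :=
    (integral_congr_ae (ae_lineDeriv_eq_fderiv hC (ee i))).symm
  rw [h3, ← this]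
  have h0 : ∀ x, lineDeriv ℝ (fun _ : V3 => (1:ℝ)) x (-(ee i)) = 0 := fun x => by
    simp [lineDeriv]
  simp only [h0, zero_mul, integral_zero]
theorem ibp {φ f : FV} (hφ : LocallyLipschitz φ) (hc : HasCompactSupport φ)
    (hf : LocallyLipschitz f) (i : Fin 3) :
    ∫ x, pd i φ x * f x = - ∫ x, φ x * pd i f x := by
  have h1 := int_pd_zero (hφ.mulR hf) (hc.mul_right) i
  have h2 : ∫ x, pd i (fun y => φ y * f y) x = ∫ x, (φ x * pd i f x + pd i φ x * f x) := by
    refine integral_congr_ae ?_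
    filter_upwards [ll_ae_diff hφ, ll_ae_diff hf] with x hx hx'
    rw [pd_mul hx hx']; ring
  rw [h2, integral_add] at h1
  · linarith
  · exact (((LBM.of_cont hφ.continuous).mul (LBM.pd hf i))).intg hc.mul_right
  · exact ((LBM.pd hφ i).mul (LBM.of_cont hf.continuous)).intg (cs_pd hc i).mul_right
def kd (z : V3) : ℝ := ‖z‖⁻¹ + ‖z‖⁻¹ ^ 2
theorem kd_nonneg (z : V3) : 0 ≤ kd z := by unfold kd; positivity
theorem kd_meas : Measurable kd := by unfold kd; fun_prop
theorem kd_loc : LocallyIntegrable kd := by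
  have hd : Module.finrank ℝ V3 = 3 := by simp
  have h1 : LocallyIntegrable (fun z : V3 => ‖z‖⁻¹) := by
    apply locallyIntegrable_of_norm_le_rpow (α := 1) (C := 1) (by simp [hd]) (by rw [hd]; norm_num)
    · exact eof fun z => by simp [Real.rpow_neg_one]
    · exact (by fun_prop : Measurable fun z : V3 => ‖z‖⁻¹).aestronglyMeasurable
  have h2 : LocallyIntegrable (fun z : V3 => ‖z‖⁻¹ ^ 2) := by
    apply locallyIntegrable_of_norm_le_rpow (α := 2) (C := 1) (by simp [hd]) (by rw [hd]; norm_num)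
    · exact eof fun z => by
        rw [Real.rpow_neg (norm_nonneg _)]; simp
    · exact (by fun_prop : Measurable fun z : V3 => ‖z‖⁻¹ ^ 2).aestronglyMeasurable
  exact h1.add h2
theorem kd_on (R : ℝ) : IntegrableOn kd (closedBall 0 R) :=
  kd_loc.integrableOn_isCompact (ict _ _)
theorem ae_ne_zero : ∀ᵐ z : V3, z ≠ 0 := by
  rw [ae_iff]; simp
theorem LBM.mul_kd {φ F : FV} (hφ : LBM φ) (hc : HasCompactSupport φ) (hF : AEStronglyMeasurable F)
    {C : ℝ} (hb : ∀ z, z ≠ 0 → |F z| ≤ C * kd z) : Integrable (fun z => φ z * F z) := by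
  obtain ⟨R, _, hR⟩ := cpt_ball hc
  obtain ⟨D, hD⟩ := hφ.bdd R
  have h1 : IntegrableOn (fun z => φ z * F z) (closedBall 0 R) := by
    refine Integrable.mono' ((kd_on R).const_mul (D * C)) (hφ.meas.mul hF).restrict
      ?_
    filter_upwards [ard msb, ae_restrict_of_ae ae_ne_zero] with x hx hz
    have := hD x (by simpa using hx)
    rw [norm_mul, mul_assoc]
    exact mul_le_mul this (hb x hz) (abs_nonneg _) ((abs_nonneg _).trans this)
  exact h1.integrable_of_forall_notMem_eq_zero fun x hx => by
    rw [hR x (by simpa using hx), zero_mul]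
theorem lim_int {φ : FV} (hφ : LBM φ) (hc : HasCompactSupport φ) {F : ℕ → FV} {G : FV}
    (hF : ∀ n, Continuous (F n)) {C : ℝ} (hb : ∀ n z, z ≠ 0 → |F n z| ≤ C * kd z)
    (hl : ∀ z, z ≠ 0 → Tendsto (fun n => F n z) atTop (𝓝 (G z))) :
    Tendsto (fun n => ∫ z, φ z * F n z) atTop (𝓝 (∫ z, φ z * G z)) := by
  have hi : Integrable fun z => φ z * (C * kd z) := by
    refine hφ.mul_kd hc (kd_meas.const_mul C).aestronglyMeasurable (C := |C|) fun z _ => ?_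
    rw [abs_mul, aon (kd_nonneg z)]
  refine tdc (fun z => ‖φ z * (C * kd z)‖)
    (fun n => hφ.meas.mul (hF n).aestronglyMeasurable) hi.norm (fun n => ?_) ?_
  · filter_upwards [ae_ne_zero] with z hz
    rw [norm_mul, norm_mul]
    exact mll ((hb n z hz).trans (le_abs_self _)) (norm_nonneg _)
  · filter_upwards [ae_ne_zero] with z hz
    exact (hl z hz).const_mul _
def io (e : ℝ) (z : V3) : ℝ := (√(‖z‖ ^ 2 + e ^ 2))⁻¹
theorem io_pos {e : ℝ} (he : 0 < e) (z : V3) : 0 < io e z := by unfold io; positivity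
theorem io_sq {e : ℝ} (he : 0 < e) (z : V3) : io e z ^ 2 * (‖z‖ ^ 2 + e ^ 2) = 1 := by
  unfold io; rw [inv_pow, Real.sq_sqrt (by positivity)]; field_simp
theorem io_le {e : ℝ} (he : 0 < e) (z : V3) : ‖z‖ * io e z ≤ 1 := by
  have h0 := io_pos he z
  have h := io_sq he z
  have : (‖z‖ * io e z) ^ 2 ≤ 1 := by nlinarith [mul_pos (pow_pos h0 2) (pow_pos he 2)]
  exact (abs_le_one_iff_mul_self_le_one.2 (by nlinarith)) |> (le_abs_self _).trans
theorem io_fd {e : ℝ} (he : 0 < e) (z : V3) : ∃ f' : V3 →L[ℝ] ℝ, HasFDerivAt (io e) f' z ∧ ∀ i, f' (ee i) = - (z i * io e z ^ 3) := by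
  have h1 : HasFDerivAt (fun z : V3 => ‖z‖ ^ 2 + e ^ 2) (2 • innerSL ℝ z) z := by
    exact ((hasStrictFDerivAt_norm_sq z).hasFDerivAt).add_const _
  have hp : 0 < ‖z‖ ^ 2 + e ^ 2 := by positivity
  have h2 := (hasDerivAt_inv (Real.sqrt_pos.2 hp).ne').comp_hasFDerivAt z (h1.sqrt hp.ne')
  refine ⟨_, h2, fun i => ?_⟩
  simp [io, EuclideanSpace.inner_single_right]
  field_simp
theorem io_pd {e : ℝ} (he : 0 < e) (z : V3) (i : Fin 3) : DifferentiableAt ℝ (io e) z ∧ pd i (io e) z = - (z i * io e z ^ 3) := by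
  obtain ⟨f', h, h'⟩ := io_fd he z
  exact ⟨h.differentiableAt, by rw [pd, h.fderiv, h']⟩
theorem io_cd {e : ℝ} (he : 0 < e) : CDI (io e) := by
  unfold io
  have : ∀ z : V3, ‖z‖ ^ 2 + e ^ 2 ≠ 0 := fun z => by positivity
  refine ((contDiff_norm_sq ℝ).add contDiff_const).sqrt this |>.inv fun z => ?_
  exact (Real.sqrt_pos.2 (by positivity)).ne'
theorem pd_pow3 {f : FV} {x : V3} (hf : DifferentiableAt ℝ f x) (i : Fin 3) :
    pd i (fun y => f y ^ 3) x = 3 * f x ^ 2 * pd i f x := by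
  unfold pd
  rw [fderiv_fun_pow 3 hf]; simp
theorem pd_coord (i j : Fin 3) (x : V3) : DifferentiableAt ℝ (fun y : V3 => y j) x ∧
    pd i (fun y : V3 => y j) x = if i = j then 1 else 0 := by
  have := (EuclideanSpace.proj j : V3 →L[ℝ] ℝ).hasFDerivAt (x := x)
  refine ⟨this.differentiableAt, ?_⟩
  unfold pd; erw [this.fderiv]; simp [eq_comm]
theorem io_lim (z : V3) (hz : z ≠ 0) :
    Tendsto (fun n : ℕ => io (ei n) z) atTop (𝓝 ‖z‖⁻¹) := by
  have h1 : Tendsto (fun e : ℝ => io e z) (𝓝 0) (𝓝 (io 0 z)) := by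
    apply ContinuousAt.tendsto
    unfold io
    have : √(‖z‖ ^ 2 + (0:ℝ) ^ 2) ≠ 0 := by
      have := norm_pos_iff.2 hz
      exact (Real.sqrt_pos.2 (by positivity)).ne'
    fun_prop (disch := assumption)
  have h2 : io 0 z = ‖z‖⁻¹ := by simp [io]
  rw [← h2]
  exact h1.comp tendsto_one_div_add_atTop_nhds_zero_nat
theorem ibp_div {φ : FV} (hφ : LocallyLipschitz φ) (hc : HasCompactSupport φ)
    {F : Fin 3 → FV} (hF : ∀ i, ContDiff ℝ 1 (F i)) :
    ∫ x, ∑ i, pd i φ x * F i x = - ∫ x, φ x * ∑ i, pd i (F i) x := by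
  simp only [Finset.mul_sum]
  rw [integral_finsetSum, integral_finsetSum, ← Finset.sum_neg_distrib]
  · exact Finset.sum_congr rfl fun i _ => ibp hφ hc (hF i).locallyLipschitz i
  · exact fun i _ => ((LBM.of_cont hφ.continuous).mul (LBM.pd (hF i).locallyLipschitz i)).intg hc.mul_right
  · exact fun i _ => ((LBM.pd hφ i).mul (LBM.of_cont (hF i).continuous)).intg (cs_pd hc i).mul_right
theorem cd_coord (i : Fin 3) : CDI (fun y : V3 => y i) :=
  (EuclideanSpace.proj i : V3 →L[ℝ] ℝ).contDiff
theorem norm_sq3 (z : V3) : ‖z‖ ^ 2 = z 0 ^ 2 + z 1 ^ 2 + z 2 ^ 2 := by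
  rw [EuclideanSpace.norm_sq_eq]; simp [su3]
theorem KL {φ : FV} (hφ : LocallyLipschitz φ) (hc : HasCompactSupport φ)
    {F : ℕ → Fin 3 → FV} {F' : Fin 3 → FV} {G : ℕ → FV}
    (hF : ∀ n i, ContDiff ℝ 1 (F n i)) (hG : ∀ n z, ∑ i, pd i (F n i) z = G n z)
    (hb : ∀ n i z, z ≠ 0 → |F n i z| ≤ 2 * kd z)
    (hl : ∀ i z, z ≠ 0 → Tendsto (fun n => F n i z) atTop (𝓝 (F' i z))) :
    Tendsto (fun n => ∫ z, φ z * G n z) atTop (𝓝 (- ∑ i, ∫ z, pd i φ z * F' i z)) := by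
  have h1 : ∀ n, ∫ z, φ z * G n z = - ∑ i, ∫ z, pd i φ z * F n i z := fun n => by
    rw [← integral_finsetSum, ibp_div hφ hc (hF n)]
    · simp [hG]
    · exact fun i _ => (LBM.pd hφ i).mul_kd (cs_pd hc i) (hF n i).continuous.aestronglyMeasurable
        (hb n i)
  simp only [h1]
  refine (tendsto_finsetSum _ fun i _ => ?_).neg
  exact lim_int (LBM.pd hφ i) (cs_pd hc i) (fun n => (hF n i).continuous) (fun n => hb n i) (hl i)
theorem en_pos (n : ℕ) : 0 < ei n := by positivity
theorem io_le' {e : ℝ} (he : 0 < e) (z : V3) (hz : z ≠ 0) : io e z ≤ ‖z‖⁻¹ := by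
  rw [le_inv_comm₀ (io_pos he z) (norm_pos_iff.2 hz)]
  have := io_le he z
  rwa [← one_div, le_div_iff₀ (io_pos he z)]
theorem abs_io_le {e : ℝ} (he : 0 < e) (z : V3) {k : ℕ} {c : ℝ} (hc : |c| ≤ ‖z‖ ^ k) (hz : z ≠ 0) (l : ℕ) :
    |c * io e z ^ (k + l)| ≤ ‖z‖⁻¹ ^ l := by
  have h0 := io_pos he z
  rw [abs_mul, aop (by positivity : 0 < io e z ^ (k + l)), pow_add, ← mul_assoc]
  calc _ ≤ (‖z‖ ^ k * io e z ^ k) * io e z ^ l := by gcongr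
    _ ≤ 1 * ‖z‖⁻¹ ^ l := by
      rw [← mul_pow]
      gcongr
      · exact pow_le_one₀ (by positivity) (io_le he z)
      · exact io_le' he z hz
    _ = _ := one_mul _
theorem zero_kd : kd 0 = 0 := by simp [kd]
theorem io3_b {e : ℝ} (he : 0 < e) (z : V3) (i : Fin 3) : |z i * io e z ^ 3| ≤ kd z := by
  by_cases hz : z = 0
  · subst hz; simp [zero_kd]
  · refine (abs_io_le he z (k := 1) (by simpa using abs_coord_le z i) hz 2).trans ?_
    unfold kd; have := norm_pos_iff.2 hz; simp
theorem inv3_b (z : V3) (i : Fin 3) : |z i * ‖z‖⁻¹ ^ 3| ≤ kd z := by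
  by_cases hz : z = 0
  · subst hz; simp [zero_kd]
  · have h := norm_pos_iff.2 hz
    rw [abs_mul, aop (by positivity : 0 < ‖z‖⁻¹ ^ 3)]
    calc _ ≤ ‖z‖ * ‖z‖⁻¹ ^ 3 := by gcongr; exact abs_coord_le z i
      _ ≤ _ := by unfold kd; field_simp; nlinarith
theorem inv3_meas (i : Fin 3) : Measurable fun z : V3 => z i * ‖z‖⁻¹ ^ 3 := by fun_prop
theorem proj_b (z : V3) (i j : Fin 3) : |projPi z i j / ‖z‖| ≤ 2 * ‖z‖⁻¹ := by
  by_cases hz : z = 0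
  · subst hz; simp
  · have h := norm_pos_iff.2 hz
    rw [abs_div, aop h, div_eq_mul_inv]
    gcongr
    unfold projPi
    refine (abs_sub _ _).trans ?_
    have h1 : |z i * z j / ‖z‖ ^ 2| ≤ 1 := by
      rw [abs_div, abs_mul, aop (by positivity : 0 < ‖z‖ ^ 2), div_le_one (by positivity), sq]
      exact mul_le_mul (abs_coord_le z i) (abs_coord_le z j) (abs_nonneg _) h.le
    have h2 : |if i = j then (1:ℝ) else 0| ≤ 1 := by split_ifs <;> simp
    linarith
theorem K1 {φ : FV} (hφ : LocallyLipschitz φ) (hc : HasCompactSupport φ) (i : Fin 3) :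
    ∫ z, pd i φ z * ‖z‖⁻¹ = ∫ z, φ z * (z i * ‖z‖⁻¹ ^ 3) := by
  have h1 := KL hφ hc (F := fun n k z => if k = i then io (ei n) z else 0)
    (F' := fun k z => if k = i then ‖z‖⁻¹ else 0)
    (G := fun n z => - (z i * io (ei n) z ^ 3)) (fun n k => by
      split_ifs
      · exact (io_cd (en_pos n)).of_le (by simp)
      · exact contDiff_const) (fun n z => by
      rw [Finset.sum_eq_single i]
      · simpa using (io_pd (en_pos n) z i).2
      · intro k _ hk; simp [hk, pd]
      · simp) (fun n k z hz => by
      split_ifs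
      · have := io_le' (en_pos n) z hz
        rw [aop (io_pos (en_pos n) z)]
        unfold kd; nlinarith [inv_nonneg.2 (norm_nonneg z)]
      · simpa using kd_nonneg z) (fun k z hz => by
      split_ifs
      · exact io_lim z hz
      · simp)
  have h2 := lim_int (LBM.of_cont hφ.continuous) hc
    (F := fun n z => - (z i * io (ei n) z ^ 3)) (G := fun z => - (z i * ‖z‖⁻¹ ^ 3))
    (fun n => ((cd_coord i).continuous.mul ((io_cd (en_pos n)).continuous.pow 3)).neg) (C := 1)
    (fun n z _ => by rw [abs_neg, one_mul]; exact io3_b (en_pos n) z i)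
    (fun z hz => (((io_lim z hz).pow 3).const_mul _).neg)
  have h3 := tendsto_nhds_unique h1 h2
  simp only [mul_neg, integral_neg] at h3
  rw [Finset.sum_eq_single i] at h3
  · simpa using h3
  · intro k _ hk; simp [hk]
  · simp
theorem K2 {φ : FV} (hφ : LocallyLipschitz φ) (hc : HasCompactSupport φ) (j : Fin 3) :
    ∑ i, ∫ z, pd i φ z * (projPi z i j / ‖z‖) = 2 * ∫ z, φ z * (z j * ‖z‖⁻¹ ^ 3) := by
  have hcd : ∀ i : Fin 3, ContDiff ℝ (⊤ : ℕ∞)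
      (fun z : V3 => ((dl i j) * ‖z‖ ^ 2 - z i * z j)) := fun i =>
    (contDiff_const.mul (contDiff_norm_sq ℝ)).sub ((cd_coord i).mul (cd_coord j))
  have h1 := KL hφ hc (F := fun n i z => ((dl i j) * ‖z‖ ^ 2 - z i * z j) *
      io (ei n) z ^ 3)
    (F' := fun i z => projPi z i j / ‖z‖)
    (G := fun n z => - (2 * (z j * io (ei n) z ^ 3))) (fun n i => by
      exact ((hcd i).mul ((io_cd (en_pos n)).pow 3)).of_le (by simp)) (fun n z => by
      have hd := fun i => (io_pd (en_pos n) z i).1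
      have hp := fun i => (io_pd (en_pos n) z i).2
      have hN : ∀ i : Fin 3, pd i (fun z : V3 => ‖z‖ ^ 2) z = 2 * z i := fun i => by
        unfold pd; rw [(hasStrictFDerivAt_norm_sq z).hasFDerivAt.fderiv]
        simp [EuclideanSpace.inner_single_right]
      have hq : ∀ i : Fin 3, pd i (fun z : V3 => ((dl i j) * ‖z‖ ^ 2 - z i * z j)) z
          = (dl i j) * (2 * z i) - (z i * (dl i j) + z j) := by
        intro i
        have e1 : pd i (fun z : V3 => ((dl i j) * ‖z‖ ^ 2 - z i * z j)) z =
          (dl i j) * pd i (fun z : V3 => ‖z‖ ^ 2) z - pd i (fun z => z i * z j) z := by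
          unfold pd
          have hdn : DifferentiableAt ℝ (fun z : V3 => ‖z‖ ^ 2) z :=
            (hasStrictFDerivAt_norm_sq z).hasFDerivAt.differentiableAt
          rw [fderiv_fun_sub (hdn.const_mul _)
            ((pd_coord i i z).1.fun_mul (pd_coord i j z).1), fderiv_const_mul hdn]
          split_ifs <;> simp
        rw [e1, hN, pd_mul (pd_coord i i z).1 (pd_coord i j z).1, (pd_coord i i z).2,
          (pd_coord i j z).2]
        simp
      have hs : ∀ i : Fin 3, pd i (fun z => ((dl i j) * ‖z‖ ^ 2 - z i * z j) *
          io (ei n) z ^ 3) z = ((dl i j) * ‖z‖ ^ 2 - z i * z j) *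
          (3 * io (ei n) z ^ 2 * (- (z i * io (ei n) z ^ 3))) +
          io (ei n) z ^ 3 *
          ((dl i j) * (2 * z i) - (z i * (dl i j) + z j)) := by
        intro i
        rw [pd_mul ((hcd i).differentiable (by simp) z) ((hd i).fun_pow 3), pd_pow3 (hd i), hp, hq]
      simp only [hs]
      simp only [norm_sq3, su3]
      clear hs hq hcd
      fin_cases j <;> simp <;> ring) (fun n i z hz => by
      rw [sub_mul]
      refine (abs_sub _ _).trans ?_
      have e1 := abs_io_le (en_pos n) z (k := 2) (c := (dl i j) * ‖z‖ ^ 2)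
        (by split_ifs <;> simp) hz 1
      have e2 := abs_io_le (en_pos n) z (k := 2) (c := z i * z j)
        (by rw [abs_mul, sq]; exact mul_le_mul (abs_coord_le z i) (abs_coord_le z j) (abs_nonneg _)
              (norm_nonneg _)) hz 1
      unfold kd; norm_num at e1 e2 ⊢; nlinarith [sq_nonneg (‖z‖⁻¹), (by norm_num : (0:ℝ) ≤ 1), inv_pow ‖z‖ 2])
      (fun i z hz => by
      have h := norm_pos_iff.2 hz
      have e : projPi z i j / ‖z‖ = ((dl i j) * ‖z‖ ^ 2 - z i * z j) * ‖z‖⁻¹ ^ 3 := by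
        unfold projPi; field_simp
      rw [e]
      exact ((io_lim z hz).pow 3).const_mul _)
  have h2 := lim_int (LBM.of_cont hφ.continuous) hc
    (F := fun n z => - (2 * (z j * io (ei n) z ^ 3))) (G := fun z => - (2 * (z j * ‖z‖⁻¹ ^ 3)))
    (fun n => (((cd_coord j).continuous.mul ((io_cd (en_pos n)).continuous.pow 3)).const_mul 2).neg) (C := 2)
    (fun n z _ => by
      rw [abs_neg, abs_mul, abs_two]; exact mll (io3_b (en_pos n) z j) (by norm_num))
    (fun z hz => ((((io_lim z hz).pow 3).const_mul _).const_mul 2).neg)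
  have h3 := tendsto_nhds_unique h1 h2
  simp only [mul_neg, integral_neg, neg_inj] at h3
  rw [h3, ← icm]
  congr 1; ext z; ring
def C0 : ℝ := ∫ y : V3, 3 * io 1 y ^ 5
theorem io5_int : Integrable fun y : V3 => 3 * io 1 y ^ 5 := by
  have := integrable_rpow_neg_one_add_norm_sq (E := V3) (μ := volume) (r := 5) (by simp; norm_num)
  refine (this.const_mul 3).congr (eof fun y => ?_)
  simp only [io]
  have h : (0:ℝ) ≤ 1 + ‖y‖ ^ 2 := by positivity
  rw [one_pow, add_comm (‖y‖ ^ 2), ← rrn _ 5, Real.sqrt_eq_rpow, ← Real.rpow_neg h, ← Real.rpow_mul h]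
  norm_num
theorem C0_pos : 0 < C0 := by
  unfold C0
  rw [integral_pos_iff_support_of_nonneg (fun y => by have := io_pos one_pos y; positivity) io5_int]
  have : Function.support (fun y : V3 => 3 * io 1 y ^ 5) = univ := by
    ext y; simpa using (io_pos one_pos y).ne'
  rw [this]; simp
theorem io_scale {e : ℝ} (he : 0 < e) (y : V3) : io e (e • y) = e⁻¹ * io 1 y := by
  unfold io
  rw [norm_smul, mul_pow, rna, sq_abs, ← mul_inv]
  congr 1
  rw [show e ^ 2 * ‖y‖ ^ 2 + e ^ 2 = e ^ 2 * (‖y‖ ^ 2 + 1 ^ 2) by ring, Real.sqrt_mul (by positivity),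
    Real.sqrt_sq he.le]
theorem K3 {φ : FV} (hφ : LocallyLipschitz φ) (hc : HasCompactSupport φ) :
    ∑ i, ∫ z, pd i φ z * (z i * ‖z‖⁻¹ ^ 3) = - (C0 * φ 0) := by
  have h1 := KL hφ hc (F := fun n i z => z i * io (ei n) z ^ 3)
    (F' := fun i z => z i * ‖z‖⁻¹ ^ 3)
    (G := fun n z => 3 * (ei n) ^ 2 * io (ei n) z ^ 5) (fun n i => by
      exact ((cd_coord i).mul ((io_cd (en_pos n)).pow 3)).of_le (by simp)) (fun n z => by
      have hd := fun i => (io_pd (en_pos n) z i).1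
      have hp := fun i => (io_pd (en_pos n) z i).2
      have hs : ∀ i : Fin 3, pd i (fun z : V3 => z i * io (ei n) z ^ 3) z =
          z i * (3 * io (ei n) z ^ 2 * (- (z i * io (ei n) z ^ 3))) +
          io (ei n) z ^ 3 * 1 := by
        intro i
        rw [pd_mul (pd_coord i i z).1 ((hd i).fun_pow 3), pd_pow3 (hd i), hp, (pd_coord i i z).2]
        simp
      have hq := io_sq (en_pos n) z
      rw [norm_sq3] at hq
      simp only [hs, su3]
      linear_combination (-3 * io (ei n) z ^ 3) * hq) (fun n i z hz => by
      have := io3_b (en_pos n) z i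
      have := kd_nonneg z
      linarith)
      (fun i z hz => ((io_lim z hz).pow 3).const_mul _)
  obtain ⟨S, hS⟩ := hc.exists_bound_of_continuous hφ.continuous
  have h2 : Tendsto (fun n : ℕ => ∫ y, φ ((ei n) • y) * (3 * io 1 y ^ 5)) atTop
      (𝓝 (∫ y, φ 0 * (3 * io 1 y ^ 5))) := by
    refine tdc (fun y => S * (3 * io 1 y ^ 5)) (fun n => ?_)
      (io5_int.const_mul S) (fun n => eof fun y => ?_) (eof fun y => ?_)
    · exact ((hφ.continuous.comp (continuous_const_smul _)).aestronglyMeasurable).mul io5_int.1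
    · have := io_pos one_pos y
      rw [norm_mul, rnn (by positivity : 0 ≤ 3 * io 1 y ^ 5)]
      exact mlr (hS _) (by positivity)
    · refine Tendsto.mul_const _ ?_
      have : Tendsto (fun n : ℕ => (ei n) • y) atTop (𝓝 ((0:ℝ) • y)) :=
        tendsto_one_div_add_atTop_nhds_zero_nat.smul_const y
      rw [zero_smul] at this
      exact (hφ.continuous.tendsto 0).comp this
  have h3 : ∀ n : ℕ, ∫ y, φ ((ei n) • y) * (3 * io 1 y ^ 5) =
      ∫ z, φ z * (3 * (ei n) ^ 2 * io (ei n) z ^ 5) := fun n => by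
    set e := ei n
    have he : 0 < e := en_pos n
    have := Measure.integral_comp_smul (μ := volume) (fun z : V3 => φ z * (3 * e ^ 2 * io e z ^ 5)) e
    simp only [io_scale he] at this
    rw [aop (by positivity)] at this
    simp only [finrank_euclideanSpace, Fintype.card_fin, smul_eq_mul] at this
    rw [eq_comm, inv_mul_eq_iff_eq_mul₀ (by positivity)] at this
    rw [this, ← icm]
    congr 1; ext y; field_simp
  simp only [h3] at h2
  have h4 := tendsto_nhds_unique h1 h2
  rw [icm] at h4
  unfold C0
  linarith
structure Nice (f : FV) : Prop where
  nn : ∀ v, 0 ≤ f v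
  ll : LocallyLipschitz f
  int : Integrable f
def kd1 (z : V3) : ℝ := (closedBall (0:V3) 1).indicator kd z
theorem kd1_int : Integrable kd1 := (integrable_indicator_iff msb).2 (kd_on 1)
theorem kd1_nonneg (z : V3) : 0 ≤ kd1 z := indicator_nonneg (fun _ _ => kd_nonneg _) _
theorem kd_le (z : V3) : kd z ≤ kd1 z + 2 := by
  unfold kd1
  by_cases hz : z ∈ closedBall (0:V3) 1
  · rw [indicator_of_mem hz]; linarith
  · rw [indicator_of_notMem hz]
    have : 1 < ‖z‖ := by simpa using hz
    have h1 := inv_le_one_of_one_le₀ this.le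
    have h0 : 0 ≤ ‖z‖⁻¹ := by positivity
    unfold kd; nlinarith
def cv (K f : FV) (v : V3) : ℝ := ∫ w, K (v - w) * f w
theorem cv_prod {φ K f : FV} (hφ : LBM φ) (hc : HasCompactSupport φ) (hK : Measurable K)
    {C : ℝ} (hb : ∀ z, |K z| ≤ C * kd z) (hf : Integrable f) :
    Integrable (fun q : V3 × V3 => φ q.1 * (K (q.1 - q.2) * f q.2)) (volume.prod volume) := by
  obtain ⟨R, _, hR⟩ := cpt_ball hc
  obtain ⟨D, hD⟩ := hφ.bdd R
  have i1 : Integrable (fun q : V3 × V3 => f q.2 * kd1 (q.1 - q.2)) (volume.prod volume) := by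
    exact hf.convolution_integrand (ContinuousLinearMap.mul ℝ ℝ) kd1_int
  have i2 : Integrable (fun q : V3 × V3 => (closedBall (0:V3) R).indicator (fun _ => (1:ℝ)) q.1 * f q.2)
      (volume.prod volume) :=
    Integrable.mul_prod (((integrable_indicator_iff msb).2
      (integrableOn_const measure_closedBall_lt_top.ne))) hf
  refine Integrable.mono' ((i1.norm.const_mul (|D| * |C|)).add (i2.norm.const_mul (|D| * |C| * 2))) ?_ ?_
  · exact hφ.meas.comp_fst.mul (((hK.comp (measurable_fst.sub measurable_snd)).aestronglyMeasurable).mul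
      hf.1.comp_snd)
  · refine eof fun q => ?_
    simp only [Pi.add_apply, norm_mul, rna, aon (kd1_nonneg _)]
    by_cases hq : ‖q.1‖ ≤ R
    · rw [indicator_of_mem (by simpa using hq), abs_one]
      have e1 : |φ q.1| ≤ |D| := (hD _ hq).trans (le_abs_self _)
      have e2 : |K (q.1 - q.2)| ≤ |C| * (kd1 (q.1 - q.2) + 2) := (hb _).trans
        (mul_le_mul (le_abs_self _) (kd_le _) (kd_nonneg _) (abs_nonneg _))
      calc _ ≤ |D| * (|C| * (kd1 (q.1 - q.2) + 2) * |f q.2|) := by gcongr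
        _ = _ := by ring
    · rw [hR _ (not_le.1 hq)]
      have := kd1_nonneg (q.1 - q.2)
      simp; positivity
theorem cv_meas {K f : FV} (hK : Measurable K) (hf : AEStronglyMeasurable f) :
    AEStronglyMeasurable (cv K f) := by
  have : AEStronglyMeasurable (fun q : V3 × V3 => K (q.1 - q.2) * f q.2) (volume.prod volume) :=
    ((hK.comp (measurable_fst.sub measurable_snd)).aestronglyMeasurable).mul hf.comp_snd
  exact this.integral_prod_right'
theorem cv_fub {φ K f : FV} (hφ : LBM φ) (hc : HasCompactSupport φ) (hK : Measurable K)
    {C : ℝ} (hb : ∀ z, |K z| ≤ C * kd z) (hf : Integrable f) :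
    ∫ v, φ v * cv K f v = ∫ w, (∫ z, φ (z + w) * K z) * f w := by
  have h := cv_prod hφ hc hK hb hf
  calc _ = ∫ v, ∫ w, φ v * (K (v - w) * f w) := by
        simp only [cv, icm]
    _ = ∫ w, ∫ v, φ v * (K (v - w) * f w) := integral_integral_swap h
    _ = _ := by
        congr 1; ext w
        rw [← integral_mul_const, ← integral_add_right_eq_self (fun v => φ v * (K (v - w) * f w)) w]
        simp only [add_sub_cancel_right, mul_assoc]
theorem cv_int {φ K f : FV} (hφ : LBM φ) (hc : HasCompactSupport φ) (hK : Measurable K)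
    {C : ℝ} (hb : ∀ z, |K z| ≤ C * kd z) (hf : Integrable f) :
    Integrable (fun v => φ v * cv K f v) ∧ Integrable (fun w => (∫ z, φ (z + w) * K z) * f w) := by
  have h := cv_prod hφ hc hK hb hf
  constructor
  · simpa only [cv, icm] using h.integral_prod_left
  · have := h.integral_prod_right
    refine this.congr (eof fun w => ?_)
    simp only
    rw [← integral_mul_const, ← integral_add_right_eq_self (fun v => φ v * (K (v - w) * f w)) w]
    simp only [add_sub_cancel_right, mul_assoc]
theorem shift_ll {φ : FV} (hφ : LocallyLipschitz φ) (w : V3) : LocallyLipschitz fun z => φ (z + w) :=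
  hφ.comp ((LipschitzWith.id.add (LipschitzWith.const w)).locallyLipschitz)
theorem shift_cs {φ : FV} (hc : HasCompactSupport φ) (w : V3) : HasCompactSupport fun z => φ (z + w) :=
  hc.comp_homeomorph (Homeomorph.addRight w)
theorem shift_pd (φ : FV) (w z : V3) (i : Fin 3) : pd i (fun z => φ (z + w)) z = pd i φ (z + w) := by
  unfold pd; rw [fderiv_comp_add_right]
theorem nrm_b (z : V3) : |‖z‖⁻¹| ≤ 1 * kd z := by
  rw [aon (by positivity)]; unfold kd; nlinarith [sq_nonneg ‖z‖⁻¹]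
theorem inv3_b1 (i : Fin 3) (z : V3) : |z i * ‖z‖⁻¹ ^ 3| ≤ 1 * kd z := by
  rw [one_mul]; exact inv3_b z i
theorem proj_b2 (i j : Fin 3) (z : V3) : |projPi z i j / ‖z‖| ≤ 2 * kd z := by
  refine (proj_b z i j).trans ?_
  unfold kd; nlinarith [sq_nonneg ‖z‖⁻¹]
theorem proj_meas (i j : Fin 3) : Measurable fun z : V3 => projPi z i j / ‖z‖ := by
  unfold projPi; fun_prop
theorem coeffa_eq (f : FV) (v : V3) : coeffa f v = (4 * π)⁻¹ * cv (fun z => ‖z‖⁻¹) f v := by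
  simp only [coeffa, cv, div_eq_inv_mul]
theorem coeffA_eq (f : FV) (v : V3) (i j : Fin 3) :
    coeffA f v i j = (8 * π)⁻¹ * cv (fun z => projPi z i j / ‖z‖) f v := rfl
def bb (f : FV) (i : Fin 3) (v : V3) : ℝ := - ((4 * π)⁻¹ * cv (fun z => z i * ‖z‖⁻¹ ^ 3) f v)
theorem cvK1 {ψ f : FV} (hψ : LocallyLipschitz ψ) (hc : HasCompactSupport ψ) (hf : Integrable f) (i : Fin 3) :
    ∫ v, pd i ψ v * coeffa f v = - ∫ v, ψ v * bb f i v := by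
  simp only [coeffa_eq, bb, mul_neg, integral_neg, neg_neg, mul_left_comm _ (4 * π)⁻¹, icm]
  congr 1
  rw [cv_fub (LBM.pd hψ i) (cs_pd hc i) (by fun_prop) nrm_b hf,
    cv_fub (LBM.of_cont hψ.continuous) hc (inv3_meas i) (inv3_b1 i) hf]
  congr 1; ext w
  rw [← K1 (shift_ll hψ w) (shift_cs hc w) i]
  simp only [shift_pd]
theorem cvK2 {ψ f : FV} (hψ : LocallyLipschitz ψ) (hc : HasCompactSupport ψ) (hf : Integrable f) (j : Fin 3) :
    ∑ i, ∫ v, pd i ψ v * coeffA f v i j = - ∫ v, ψ v * bb f j v := by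
  simp only [coeffA_eq, bb, mul_neg, integral_neg, neg_neg, mul_left_comm _ (4 * π)⁻¹,
    mul_left_comm _ (8 * π)⁻¹, icm]
  rw [← Finset.mul_sum, cv_fub (LBM.of_cont hψ.continuous) hc (inv3_meas j) (inv3_b1 j) hf]
  have h : ∀ i, ∫ v, pd i ψ v * cv (fun z => projPi z i j / ‖z‖) f v =
      ∫ w, (∫ z, pd i ψ (z + w) * (projPi z i j / ‖z‖)) * f w := fun i =>
    cv_fub (LBM.pd hψ i) (cs_pd hc i) (proj_meas i j) (proj_b2 i j) hf
  simp only [h]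
  rw [← integral_finsetSum _ fun i _ =>
    (cv_int (LBM.pd hψ i) (cs_pd hc i) (proj_meas i j) (proj_b2 i j) hf).2,
    show (8 * π)⁻¹ = (4 * π)⁻¹ * (1 / 2) by field_simp; norm_num, mul_assoc, ← icm]
  congr 2; ext w
  have := K2 (shift_ll hψ w) (shift_cs hc w) j
  simp only [shift_pd] at this
  rw [← Finset.sum_mul, this]; ring
theorem cvK3 {ψ f : FV} (hψ : LocallyLipschitz ψ) (hc : HasCompactSupport ψ) (hf : Integrable f) :
    ∑ i, ∫ v, pd i ψ v * bb f i v = (4 * π)⁻¹ * C0 * ∫ v, ψ v * f v := by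
  simp only [bb, mul_neg, integral_neg, mul_left_comm _ (4 * π)⁻¹, icm]
  have h : ∀ i, ∫ v, pd i ψ v * cv (fun z => z i * ‖z‖⁻¹ ^ 3) f v =
      ∫ w, (∫ z, pd i ψ (z + w) * (z i * ‖z‖⁻¹ ^ 3)) * f w := fun i =>
    cv_fub (LBM.pd hψ i) (cs_pd hc i) (inv3_meas i) (inv3_b1 i) hf
  simp only [h]
  rw [Finset.sum_neg_distrib, ← Finset.mul_sum, ← integral_finsetSum _ fun i _ =>
    (cv_int (LBM.pd hψ i) (cs_pd hc i) (inv3_meas i) (inv3_b1 i) hf).2, ← mul_neg, mul_assoc,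
    ← integral_neg]
  congr 1
  rw [← icm]
  congr 1; ext w
  have := K3 (shift_ll hψ w) (shift_cs hc w)
  simp only [shift_pd] at this
  rw [← Finset.sum_mul, this]; simp; ring
theorem J_bdd {f : FV} (hf : Nice f) (R : ℝ) : ∃ C, ∀ v, ‖v‖ ≤ R →
    Integrable (fun w => kd (v - w) * f w) ∧ ∫ w, kd (v - w) * f w ≤ C := by
  obtain ⟨S, hS⟩ := (LBM.of_cont hf.ll.continuous).bdd (R + 1)
  refine ⟨S * (∫ z, kd1 z) + 2 * ∫ w, f w, fun v hv => ?_⟩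
  have i1 : Integrable (fun w => S * kd1 (v - w)) := (kd1_int.comp_sub_left v).const_mul S
  have i2 := hf.int.const_mul 2
  have hle : ∀ w, kd (v - w) * f w ≤ S * kd1 (v - w) + 2 * f w := fun w => by
    have h0 := kd_le (v - w)
    have h1 := hf.nn w
    have h2 := kd1_nonneg (v - w)
    have h3 : kd1 (v - w) * f w ≤ S * kd1 (v - w) := by
      by_cases hw : v - w ∈ closedBall (0:V3) 1
      · have h4 : ‖v - w‖ ≤ 1 := by simpa using hw
        have h5 : ‖w‖ ≤ R + 1 := by
          have := norm_sub_norm_le w v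
          rw [norm_sub_rev] at this; linarith
        have := hS w h5
        rw [mul_comm]
        exact mlr ((le_abs_self _).trans this) h2
      · unfold kd1; rw [indicator_of_notMem hw]; simp
    nlinarith
  have hi : Integrable (fun w => kd (v - w) * f w) := by
    refine Integrable.mono' (i1.add i2) ((kd_meas.comp (measurable_const.sub measurable_id)).aestronglyMeasurable.mul
      hf.int.1) (eof fun w => ?_)
    rw [rnn (mul_nonneg (kd_nonneg _) (hf.nn w))]
    exact hle w
  refine ⟨hi, (integral_mono hi (i1.add i2) hle).trans_eq ?_⟩
  simp only [Pi.add_apply]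
  rw [integral_add i1 i2, icm, icm, integral_sub_left_eq_self kd1]
theorem cv_sl {K f : FV} (hf : Nice f) (hK : Measurable K) {C : ℝ} (hb : ∀ z, |K z| ≤ C * kd z)
    (v : V3) : Integrable (fun w => K (v - w) * f w) := by
  obtain ⟨D, hD⟩ := J_bdd hf ‖v‖
  refine Integrable.mono' ((hD v le_rfl).1.const_mul C)
    ((hK.comp (measurable_const.sub measurable_id)).aestronglyMeasurable.mul hf.int.1)
    (eof fun w => ?_)
  rw [norm_mul, rnn (hf.nn w), ← mul_assoc]
  exact mlr (hb _) (hf.nn w)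
theorem cv_lbm {K f : FV} (hf : Nice f) (hK : Measurable K) {C : ℝ} (hb : ∀ z, |K z| ≤ C * kd z) :
    LBM (cv K f) := by
  refine ⟨cv_meas hK hf.int.1, fun R => ?_⟩
  obtain ⟨D, hD⟩ := J_bdd hf R
  refine ⟨|C| * D, fun v hv => ?_⟩
  refine (abs_integral_le_integral_abs).trans ?_
  refine (integral_mono (cv_sl hf hK hb v).abs ((hD v hv).1.const_mul |C|) fun w => ?_).trans ?_
  · simp only
    rw [abs_mul, aon (hf.nn w), ← mul_assoc]
    exact mlr ((hb _).trans (mlr (le_abs_self _) (kd_nonneg _)))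
      (hf.nn w)
  · rw [icm]
    exact mll (hD v hv).2 (abs_nonneg _)
theorem LBM.cmul {F : FV} (hF : LBM F) (c : ℝ) : LBM fun x => c * F x :=
  (LBM.of_cont continuous_const).mul hF
theorem A_lbm {f : FV} (hf : Nice f) (i j : Fin 3) : LBM fun v => coeffA f v i j :=
  (cv_lbm hf (proj_meas i j) (proj_b2 i j)).cmul _
theorem b_lbm {f : FV} (hf : Nice f) (i : Fin 3) : LBM (bb f i) :=
  ((cv_lbm hf (inv3_meas i) (inv3_b1 i)).cmul _).neg
theorem a_ll {f : FV} (hf : Nice f) : LocallyLipschitz (coeffa f) := by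
  intro x
  obtain ⟨D, hD⟩ := J_bdd hf (‖x‖ + 1)
  refine ⟨⟨|(4 * π)⁻¹| * |D|, by positivity⟩, ball x 1, ball_mem_nhds _ one_pos, ?_⟩
  refine LipschitzOnWith.of_dist_le_mul fun v hv v' hv' => ?_
  have hn : ∀ y ∈ ball x 1, ‖y‖ ≤ ‖x‖ + 1 := fun y hy => by
    have := norm_sub_norm_le y x
    have : ‖y - x‖ < 1 := by simpa [dist_eq_norm] using hy
    linarith
  have h1 := hD v (hn v hv)
  have h2 := hD v' (hn v' hv')
  change _ ≤ |(4 * π)⁻¹| * |D| * dist v v'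
  rw [dist_eq_norm, dist_eq_norm, coeffa_eq, coeffa_eq, ← mul_sub, norm_mul, mul_assoc, rna]
  refine mll ?_ (abs_nonneg _)
  unfold cv
  rw [← integral_sub (cv_sl hf (by fun_prop) nrm_b v) (cv_sl hf (by fun_prop) nrm_b v')]
  have key : ∀ w, w ≠ v → w ≠ v' → |‖v - w‖⁻¹ * f w - ‖v' - w‖⁻¹ * f w| ≤
      ‖v - v'‖ * (1 / 2) * (kd (v - w) * f w + kd (v' - w) * f w) := fun w hw hw' => by
    have hp : 0 < ‖v - w‖ := norm_pos_iff.2 (sub_ne_zero.2 hw.symm)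
    have hp' : 0 < ‖v' - w‖ := norm_pos_iff.2 (sub_ne_zero.2 hw'.symm)
    have e1 : ‖v - w‖⁻¹ - ‖v' - w‖⁻¹ = (‖v' - w‖ - ‖v - w‖) * (‖v - w‖⁻¹ * ‖v' - w‖⁻¹) := by
      field_simp
    have e2 : |‖v' - w‖ - ‖v - w‖| ≤ ‖v - v'‖ := by
      refine (abs_norm_sub_norm_le _ _).trans_eq ?_
      rw [sub_sub_sub_cancel_right, norm_sub_rev]
    rw [← sub_mul, abs_mul, aon (hf.nn w), e1, abs_mul,
      aop (by positivity : 0 < ‖v - w‖⁻¹ * ‖v' - w‖⁻¹), ← add_mul,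
      ← mul_assoc (‖v - v'‖ * (1 / 2))]
    refine mlr ?_ (hf.nn w)
    rw [mul_assoc _ (1 / 2 : ℝ)]
    refine mul_le_mul e2 ?_ (by positivity) (norm_nonneg _)
    unfold kd
    nlinarith [sq_nonneg (‖v - w‖⁻¹ - ‖v' - w‖⁻¹), inv_pos.2 hp, inv_pos.2 hp']
  have hae : ∀ y : V3, ∀ᵐ w : V3, w ≠ y := fun y => by rw [ae_iff]; simp
  refine (abs_integral_le_integral_abs).trans ?_
  refine (integral_mono_ae (((cv_sl hf (by fun_prop) nrm_b v).sub (cv_sl hf (by fun_prop) nrm_b v')).abs)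
    ((h1.1.add h2.1).const_mul (‖v - v'‖ * (1 / 2))) ?_).trans ?_
  · filter_upwards [hae v, hae v'] with w hw hw'
    exact key w hw hw'
  · simp only [Pi.add_apply]
    rw [icm, integral_add h1.1 h2.1]
    nlinarith [norm_nonneg (v - v'), le_abs_self D, mul_nonneg (norm_nonneg (v - v')) (sub_nonneg.2 (h1.2.trans (le_abs_self D))),
      mul_nonneg (norm_nonneg (v - v')) (sub_nonneg.2 (h2.2.trans (le_abs_self D)))]
theorem LBM.locInt {F : FV} (hF : LBM F) : LocallyIntegrable F := by
  rw [locallyIntegrable_iff]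
  intro K hK
  obtain ⟨R, h0, hR⟩ := hK.isBounded.exists_pos_norm_lt
  obtain ⟨C, hC⟩ := hF.bdd R
  exact Measure.integrableOn_of_bounded (M := C) hK.measure_lt_top.ne hF.meas
      (ae_restrict_of_forall_mem hK.measurableSet fun x hx => hC x (hR x hx).le)
theorem pd_a {f : FV} (hf : Nice f) (i : Fin 3) : ∀ᵐ v, pd i (coeffa f) v = bb f i v := by
  refine ae_eq_of_integral_contDiff_smul_eq (LBM.pd (a_ll hf) i).locInt (b_lbm hf i).locInt fun ψ hψ hc => ?_
  have hl : LocallyLipschitz ψ := (hψ.of_le (by simp) : ContDiff ℝ 1 ψ).locallyLipschitz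
  have h1 := ibp hl hc (a_ll hf) i
  have h2 := cvK1 hl hc hf.int i
  simp only [smul_eq_mul]
  linarith
theorem a_sup {p : ℝ} (hp : 3 / 2 < p) : ∃ Ca, 0 < Ca ∧ ∀ f : FV, (∀ v, 0 ≤ f v) → Integrable f →
    ∫ v, f v = 1 → Integrable (fun v => |f v| ^ p) → ∀ v, Integrable (fun w => ‖v - w‖⁻¹ * f w) ∧
      cv (fun z => ‖z‖⁻¹) f v ≤ Ca * (1 + (∫ v, |f v| ^ p) ^ (1 / p)) := by
  set q : ℝ := p / (p - 1) with hq
  have hpq : q.HolderConjugate p := (Real.HolderConjugate.conjExponent (by linarith : 1 < p)).symm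
  have hq0 : 0 < q := hpq.pos
  have hq3 : q < 3 := by rw [hq, div_lt_iff₀ (by linarith)]; linarith
  set k : FV := (closedBall (0:V3) 1).indicator fun z => ‖z‖⁻¹ with hk
  have hkm : Measurable k := (by fun_prop : Measurable fun z : V3 => ‖z‖⁻¹).indicator msb
  have hk0 : ∀ z, 0 ≤ k z := fun z => indicator_nonneg (fun _ _ => by positivity) _
  have hkq : Integrable fun z => k z ^ q := by
    have h1 : IntegrableOn (fun z : V3 => (‖z‖⁻¹) ^ q) (closedBall 0 1) := by
      refine LocallyIntegrable.integrableOn_isCompact ?_ (ict _ _)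
      refine locallyIntegrable_of_norm_le_rpow (α := q) (C := 1) (by simp) (by simpa using hq3)
        (eof fun z => ?_) (by fun_prop : Measurable _).aestronglyMeasurable
      rw [rnn (by positivity), one_mul, Real.rpow_neg (norm_nonneg _), Real.inv_rpow (norm_nonneg _)]
    refine ((integrable_indicator_iff msb).2 h1).congr (eof fun z => ?_)
    by_cases hz : z ∈ closedBall (0:V3) 1
    · simp [hk, indicator_of_mem hz]
    · simp [hk, indicator_of_notMem hz, hq0.ne']
  have hkp : MemLp k (eor q) := by
    rw [← integrable_norm_rpow_iff hkm.aestronglyMeasurable (by simpa using hq0) (by simp),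
      ENNReal.toReal_ofReal hq0.le]
    simpa only [rnn (hk0 _)] using hkq
  refine ⟨1 + (∫ z, k z ^ q) ^ (1 / q), ?_, fun f hf hi h1 hfp v => ?_⟩
  · exact add_pos_of_pos_of_nonneg one_pos
      (Real.rpow_nonneg (integral_nonneg fun z => Real.rpow_nonneg (hk0 z) _) _)
  have hfm : MemLp f (eor p) := by
    rw [← integrable_norm_rpow_iff hi.1 (by simpa using (by linarith : 0 < p)) (by simp),
      ENNReal.toReal_ofReal (by linarith)]
    simpa using hfp
  have hkv : MemLp (fun w => k (v - w)) (eor q) :=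
    hkp.comp_measurePreserving (Measure.measurePreserving_sub_left volume v)
  have hol := integral_mul_le_Lp_mul_Lq_of_nonneg hpq (eof fun w => hk0 (v - w))
    (eof hf) hkv hfm
  have hint : Integrable fun w => k (v - w) * f w := by
    have : ENNReal.HolderConjugate (eor q) (eor p) := hpq.ennrealOfReal
    exact hkv.integrable_mul hfm
  rw [integral_sub_left_eq_self (fun z => k z ^ q) volume v] at hol
  have hle : ∀ w, ‖v - w‖⁻¹ * f w ≤ k (v - w) * f w + f w := fun w => by
    rw [← add_one_mul]
    refine mlr ?_ (hf w)
    by_cases hz : v - w ∈ closedBall (0:V3) 1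
    · rw [hk, indicator_of_mem hz]; linarith
    · rw [hk, indicator_of_notMem hz, zero_add]
      have : 1 < ‖v - w‖ := by simpa using hz
      exact inv_le_one_of_one_le₀ this.le
  have hI : Integrable (fun w => ‖v - w‖⁻¹ * f w) := by
    refine (hint.add hi).mono' ((by fun_prop : Measurable fun w : V3 => ‖v - w‖⁻¹).aestronglyMeasurable.mul hi.1)
      (eof fun w => ?_)
    rw [rnn (mul_nonneg (by positivity) (hf w))]
    exact hle w
  refine ⟨hI, (integral_mono hI (hint.add hi) hle).trans ?_⟩
  simp only [Pi.add_apply]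
  rw [integral_add hint hi, h1]
  simp only [aon (hf _)]
  have e1 : 0 ≤ (∫ z, k z ^ q) ^ (1 / q) :=
    Real.rpow_nonneg (integral_nonneg fun z => Real.rpow_nonneg (hk0 z) _) _
  have e2 : 0 ≤ (∫ z, f z ^ p) ^ (1 / p) :=
    Real.rpow_nonneg (integral_nonneg fun z => Real.rpow_nonneg (hf z) _) _
  nlinarith
theorem isub {α : Type*} [MeasurableSpace α] {μ : Measure α} {f g : α → ℝ} (hf : Integrable f μ) (hg : Integrable g μ) :
    Integrable (fun x => f x - g x) μ := hf.sub hg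
theorem pd_comp {f : FV} {h : ℝ → ℝ} {h' : ℝ} {x : V3} (hf : DifferentiableAt ℝ f x)
    (hh : HasDerivAt h h' (f x)) (i : Fin 3) : pd i (fun y => h (f y)) x = h' * pd i f x := by
  unfold pd
  have := hh.comp_hasFDerivAt x hf.hasFDerivAt
  erw [this.fderiv]; simp
theorem A_symm (f : FV) (v : V3) (i j : Fin 3) : coeffA f v i j = coeffA f v j i := by
  unfold coeffA projPi
  congr 2; ext w
  simp only [mul_comm ((v - w) i), eq_comm (a := i)]
theorem ll_of_cd {n : WithTop ℕ∞} {E : Type*} [NormedAddCommGroup E] [NormedSpace ℝ E] {f : E → ℝ} (hn : 1 ≤ n) (h : ContDiff ℝ n f) :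
    LocallyLipschitz f := (h.of_le hn).locallyLipschitz
theorem cd_pd {χ : FV} (h : CDI χ) (i : Fin 3) : CDI (pd i χ) := by
  unfold pd
  exact (h.fderiv_right (m := (⊤ : ℕ∞)) (by simp)).clm_apply contDiff_const
structure Ren (B B' B'' : ℝ → ℝ) : Prop where
  d1 : ∀ x, HasDerivAt B (B' x) x
  d2 : ∀ x, HasDerivAt B' (B'' x) x
  c2 : Continuous B''
theorem Ren.cd {B B' B'' : ℝ → ℝ} (h : Ren B B' B'') : ContDiff ℝ 1 B' := by
  have h2 : deriv B' = B'' := funext fun x => (h.d2 x).deriv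
  exact contDiff_one_iff_deriv.2 ⟨fun x => (h.d2 x).differentiableAt, by rw [h2]; exact h.c2⟩
theorem Ren.cd0 {B B' B'' : ℝ → ℝ} (h : Ren B B' B'') : ContDiff ℝ 1 B := by
  have h2 : deriv B = B' := funext fun x => (h.d1 x).deriv
  exact contDiff_one_iff_deriv.2 ⟨fun x => (h.d1 x).differentiableAt, by rw [h2]; exact h.cd.continuous⟩
def Fl (f : FV) (i : Fin 3) (v : V3) : ℝ := (∑ j, coeffA f v i j * pd j f v) - f v * bb f i v
theorem Fl_lbm {f : FV} (hf : Nice f) (i : Fin 3) : LBM (Fl f i) :=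
  (LBM.sum fun j => (A_lbm hf i j).mul (LBM.pd hf.ll j)).sub
    ((LBM.of_cont hf.ll.continuous).mul (b_lbm hf i))
def c0 : ℝ := (4 * π)⁻¹ * C0
theorem c0_pos : 0 < c0 := by have := C0_pos; unfold c0; positivity
theorem spatial {f χ : FV} (hf : Nice f) (hχ : CDI χ) (hc : HasCompactSupport χ)
    {B B' B'' : ℝ → ℝ} (hB : Ren B B' B'') :
    ∫ v, ∑ i, pd i (fun v => χ v * B' (f v)) v * Fl f i v =
      (∫ v, χ v * (B'' (f v) * ∑ i, ∑ j, coeffA f v i j * pd i f v * pd j f v))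
      - c0 * (∫ v, χ v * (f v * B' (f v) - B (f v)) * f v)
      - 2 * (∑ i, ∫ v, pd i χ v * (B (f v) * bb f i v))
      - ∑ i, ∑ j, ∫ v, pd j (pd i χ) v * (B (f v) * coeffA f v i j) := by
  have lχ := ll_of_cd (by simp) hχ
  have lpχ := fun i => ll_of_cd (by simp) (cd_pd hχ i)
  have cpχ := fun i => cs_pd hc i
  have lB : LocallyLipschitz fun v => B (f v) := hB.cd0.locallyLipschitz.comp hf.ll
  have lB' : LocallyLipschitz fun v => B' (f v) := hB.cd.locallyLipschitz.comp hf.ll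
  have mB := LBM.of_cont lB.continuous
  have mB'' : LBM fun v => B'' (f v) := LBM.of_cont (hB.c2.comp hf.ll.continuous)
  have mχ := LBM.of_cont lχ.continuous
  have lγ : LocallyLipschitz fun v => f v * B' (f v) - B (f v) :=
    (((contDiff_id.mul hB.cd).sub hB.cd0).locallyLipschitz).comp hf.ll
  have i1 : Integrable fun v => χ v * (B'' (f v) * ∑ i, ∑ j, coeffA f v i j * pd i f v * pd j f v) :=
    (mχ.mul (mB''.mul (LBM.sum fun i => LBM.sum fun j =>
      ((A_lbm hf i j).mul (LBM.pd hf.ll i)).mul (LBM.pd hf.ll j)))).intg hc.mul_right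
  have i2 : ∀ i j, Integrable fun v => pd j (fun v => pd i χ v * B (f v)) v * coeffA f v j i := fun i j =>
    ((LBM.pd ((lpχ i).mulR lB) j).mul (A_lbm hf j i)).intg (cs_pd (cpχ i).mul_right j).mul_right
  have i3 : ∀ i j, Integrable fun v => pd j (pd i χ) v * (B (f v) * coeffA f v i j) := fun i j =>
    ((LBM.pd (lpχ i) j).mul (mB.mul (A_lbm hf i j))).intg (cs_pd (cpχ i) j).mul_right
  have i4 : ∀ i, Integrable fun v => pd i (fun v => χ v * (f v * B' (f v) - B (f v))) v * bb f i v := fun i =>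
    ((LBM.pd (lχ.mulR lγ) i).mul (b_lbm hf i)).intg (cs_pd hc.mul_right i).mul_right
  have i5 : ∀ i, Integrable fun v => pd i χ v * (B (f v) * bb f i v) := fun i =>
    ((LBM.pd lχ i).mul (mB.mul (b_lbm hf i))).intg (cs_pd hc i).mul_right
  have hae : ∀ᵐ v, ∑ i, pd i (fun v => χ v * B' (f v)) v * Fl f i v =
      χ v * (B'' (f v) * ∑ i, ∑ j, coeffA f v i j * pd i f v * pd j f v) +
      ∑ i, ∑ j, pd j (fun v => pd i χ v * B (f v)) v * coeffA f v j i -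
      ∑ i, ∑ j, pd j (pd i χ) v * (B (f v) * coeffA f v i j) -
      ∑ i, pd i (fun v => χ v * (f v * B' (f v) - B (f v))) v * bb f i v -
      ∑ i, pd i χ v * (B (f v) * bb f i v) := by
    filter_upwards [ll_ae_diff hf.ll] with v hv
    have dχ : DifferentiableAt ℝ χ v := hχ.differentiable (by simp) v
    have dpχ : ∀ i, DifferentiableAt ℝ (pd i χ) v := fun i => (cd_pd hχ i).differentiable (by simp) v
    have dB : DifferentiableAt ℝ (fun v => B (f v)) v := (hB.d1 (f v)).differentiableAt.fun_comp' v hv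
    have dB' : DifferentiableAt ℝ (fun v => B' (f v)) v := (hB.d2 (f v)).differentiableAt.fun_comp' v hv
    have hγ : HasDerivAt (fun x => x * B' x - B x) (f v * B'' (f v)) (f v) := by
      exact (((hasDerivAt_id' (f v)).fun_mul (hB.d2 (f v))).fun_sub (hB.d1 (f v))).congr_deriv (by ring)
    have dγ : DifferentiableAt ℝ (fun v => f v * B' (f v) - B (f v)) v :=
      hγ.differentiableAt.fun_comp' v hv
    have e1 : ∀ i, pd i (fun v => χ v * B' (f v)) v = χ v * (B'' (f v) * pd i f v) + B' (f v) * pd i χ v :=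
      fun i => by rw [pd_mul dχ dB', pd_comp hv (hB.d2 _)]
    have e2 : ∀ i j, pd j (fun v => pd i χ v * B (f v)) v =
        pd i χ v * (B' (f v) * pd j f v) + B (f v) * pd j (pd i χ) v :=
      fun i j => by rw [pd_mul (dpχ i) dB, pd_comp hv (hB.d1 _)]
    have e3 : ∀ i, pd i (fun v => χ v * (f v * B' (f v) - B (f v))) v =
        χ v * (f v * B'' (f v) * pd i f v) + (f v * B' (f v) - B (f v)) * pd i χ v :=
      fun i => by rw [pd_mul dχ dγ, pd_comp hv hγ]
    simp only [e1, e2, e3, Fl, A_symm f v 1 0, A_symm f v 2 0, A_symm f v 2 1, su3]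
    ring
  rw [integral_congr_ae hae]
  have j2 := integrable_finsetSum Finset.univ fun i _ => integrable_finsetSum Finset.univ fun j _ => i2 i j
  have j3 := integrable_finsetSum Finset.univ fun i _ => integrable_finsetSum Finset.univ fun j _ => i3 i j
  have j4 := integrable_finsetSum Finset.univ fun i _ => i4 i
  have j5 := integrable_finsetSum Finset.univ fun i _ => i5 i
  have s1 := i1.fun_add j2
  have s2 := isub s1 j3
  have s3 := isub s2 j4
  rw [integral_sub s3 j5, integral_sub s2 j4, integral_sub s1 j3, integral_add i1 j2, integral_finsetSum _ fun i _ => i4 i,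
    integral_finsetSum _ fun i _ => i5 i]
  rw [cvK3 (lχ.mulR lγ) hc.mul_right hf.int]
  rw [integral_finsetSum _ fun i _ => integrable_finsetSum Finset.univ fun j _ => i2 i j,
    integral_finsetSum _ fun i _ => integrable_finsetSum Finset.univ fun j _ => i3 i j]
  have k2 : ∀ i, ∫ v, ∑ j, pd j (fun v => pd i χ v * B (f v)) v * coeffA f v j i =
      - ∫ v, pd i χ v * (B (f v) * bb f i v) := fun i => by
    rw [integral_finsetSum _ fun j _ => i2 i j, cvK2 ((lpχ i).mulR lB) (cpχ i).mul_right hf.int i]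
    simp only [mul_assoc]
  have k3 : ∀ i, ∫ v, ∑ j, pd j (pd i χ) v * (B (f v) * coeffA f v i j) =
      ∑ j, ∫ v, pd j (pd i χ) v * (B (f v) * coeffA f v i j) := fun i =>
    integral_finsetSum _ fun j _ => i3 i j
  simp only [k2, k3, Finset.sum_neg_distrib, c0]
  ring
structure SolG (a b : ℝ) (G : ℝ → FV) : Prop where
  ll : LocallyLipschitz (fun q : ℝ × V3 => G q.1 q.2)
  nn : ∀ t v, 0 ≤ G t v
  mass : ∀ᵐ t ∂volume.restrict (Ioo a b), Integrable (G t) ∧ ∫ v, G t v = 1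
  w : ∀ φ : ℝ × V3 → ℝ, CDI φ → HasCompactSupport φ →
    tsupport φ ⊆ Ioo a b ×ˢ (univ : Set V3) →
    (∫ t in Ioo a b, ∫ v : V3, φ (t, v) * deriv (fun s => G s v) t) =
      - ∫ t in Ioo a b, ∫ v : V3, ∑ i : Fin 3, (fderiv ℝ φ (t, v) (0, ee i)) * Fl (G t) i v
theorem ll_slice {G : ℝ → FV} (h : LocallyLipschitz (fun q : ℝ × V3 => G q.1 q.2)) (t : ℝ) :
    LocallyLipschitz (G t) :=
  h.comp (LipschitzWith.prodMk_left t).locallyLipschitz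
theorem SolG.nice {a b : ℝ} {G : ℝ → FV} (h : SolG a b G) :
    ∀ᵐ t ∂volume.restrict (Ioo a b), Nice (G t) := by
  filter_upwards [h.mass] with t ht
  exact ⟨h.nn t, ll_slice h.ll t, ht.1⟩
theorem cvj_meas {G : ℝ → FV} (h : Continuous (fun q : ℝ × V3 => G q.1 q.2)) {K : FV}
    (hK : Measurable K) : Measurable fun q : ℝ × V3 => cv K (G q.1) q.2 := by
  refine StronglyMeasurable.measurable ?_
  refine StronglyMeasurable.integral_prod_right (f := fun (q : ℝ × V3) w => K (q.2 - w) * G q.1 w) ?_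
  refine Measurable.stronglyMeasurable ?_
  exact (hK.comp ((measurable_snd.comp measurable_fst).sub measurable_snd)).mul
    (h.measurable.comp ((measurable_fst.comp measurable_fst).prodMk measurable_snd))
theorem pdj_meas {G : ℝ → FV} (h : Continuous (fun q : ℝ × V3 => G q.1 q.2)) (i : Fin 3) :
    Measurable fun q : ℝ × V3 => pd i (G q.1) q.2 :=
  measurable_fderiv_apply_const_with_param ℝ (f := G) h (ee i)
theorem dtj_meas {G : ℝ → FV} (h : Continuous (fun q : ℝ × V3 => G q.1 q.2)) :
    Measurable fun q : ℝ × V3 => deriv (fun s => G s q.2) q.1 := by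
  have h2 : Continuous (Function.uncurry fun (v : V3) (s : ℝ) => G s v) := h.comp continuous_swap
  exact (measurable_deriv_with_param h2).comp measurable_swap
theorem Aj_meas {G : ℝ → FV} (h : Continuous (fun q : ℝ × V3 => G q.1 q.2)) (i j : Fin 3) :
    Measurable fun q : ℝ × V3 => coeffA (G q.1) q.2 i j := by
  simp only [coeffA_eq]
  exact (cvj_meas h (proj_meas i j)).const_mul _
theorem bj_meas {G : ℝ → FV} (h : Continuous (fun q : ℝ × V3 => G q.1 q.2)) (i : Fin 3) :
    Measurable fun q : ℝ × V3 => bb (G q.1) i q.2 :=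
  ((cvj_meas h (inv3_meas i)).const_mul _).neg
theorem Flj_meas {G : ℝ → FV} (h : Continuous (fun q : ℝ × V3 => G q.1 q.2)) (i : Fin 3) :
    Measurable fun q : ℝ × V3 => Fl (G q.1) i q.2 :=
  (Finset.measurable_sum _ fun j _ => (Aj_meas h i j).mul (pdj_meas h j)).sub (h.measurable.mul (bj_meas h i))
abbrev Bx (a b R : ℝ) : Measure (ℝ × V3) := (volume.restrict (Ioo a b)).prod (volume.restrict (closedBall (0:V3) R))
theorem cv_L1 {f : FV} (hn : ∀ v, 0 ≤ f v) (hf : Integrable f) (h1 : ∫ v, f v = 1) (R : ℝ) :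
    ∫ v in closedBall 0 R, cv kd f v ≤ (∫ z, kd1 z) + 2 * (volume (closedBall (0:V3) R)).toReal := by
  set φ : FV := (closedBall (0:V3) R).indicator 1 with hφ
  have ib : Integrable φ := (integrable_indicator_iff msb).2
    (integrableOn_const measure_closedBall_lt_top.ne)
  have hL : LBM φ := ⟨ib.1, fun S => ⟨1, fun x _ => by
    unfold φ; rw [indicator]; split_ifs <;> simp⟩⟩
  have hc : HasCompactSupport φ := HasCompactSupport.intro (ict (0:V3) R)
    fun x hx => indicator_of_notMem hx _
  have hb : ∀ z, |kd z| ≤ 1 * kd z := fun z => by rw [aon (kd_nonneg z), one_mul]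
  have e1 : ∫ v in closedBall 0 R, cv kd f v = ∫ v, φ v * cv kd f v := by
    rw [← integral_indicator msb]
    congr 1; ext v; unfold φ; simp only [indicator]; split_ifs <;> simp
  rw [e1, cv_fub hL hc kd_meas hb hf]
  set S := (∫ z, kd1 z) + 2 * (volume (closedBall (0:V3) R)).toReal
  have e2 : ∀ w, ∫ z, φ (z + w) * kd z ≤ S := fun w => by
    have i2 : Integrable fun z => kd1 z + 2 * φ (z + w) := kd1_int.add ((ib.comp_add_right w).const_mul 2)
    have : ∫ z, kd1 z + 2 * φ (z + w) = S := by
      rw [integral_add kd1_int ((ib.comp_add_right w).const_mul 2), icm,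
        integral_add_right_eq_self φ w]
      unfold φ S; simp [integral_indicator msb, Measure.real]
    rw [← this]
    refine integral_mono_of_nonneg (eof fun z => mul_nonneg
      (indicator_nonneg (fun _ _ => zero_le_one) _) (kd_nonneg z)) i2 (eof fun z => ?_)
    unfold φ; simp only [indicator]
    split_ifs
    · simpa using kd_le z
    · simpa using kd1_nonneg z
  calc _ ≤ ∫ w, S * f w := integral_mono (cv_int hL hc kd_meas hb hf).2 (hf.const_mul S)
        fun w => mlr (e2 w) (hn w)
    _ = S := by rw [icm, h1, mul_one]
theorem cv_abs {K f : FV} (hf : Nice f) {C : ℝ} (hb : ∀ z, |K z| ≤ C * kd z)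
    (v : V3) : |cv K f v| ≤ C * cv kd f v := by
  unfold cv
  rw [← icm]
  have i := cv_sl hf kd_meas (C := 1) (fun z => by rw [aon (kd_nonneg z), one_mul]) v
  refine abs_integral_le_integral_abs.trans (integral_mono_of_nonneg (eof fun w => abs_nonneg _)
    (i.const_mul C) (eof fun w => ?_))
  simp only [abs_mul, aon (hf.nn w), ← mul_assoc]
  exact mlr (hb _) (hf.nn w)
theorem cvj_int {a b : ℝ} {G : ℝ → FV} (h : SolG a b G) {K : FV} (hK : Measurable K) {C : ℝ}
    (hb : ∀ z, |K z| ≤ C * kd z) (R : ℝ) : Integrable (fun q : ℝ × V3 => cv K (G q.1) q.2) (Bx a b R) := by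
  have hm := (cvj_meas h.ll.continuous hK).aestronglyMeasurable (μ := Bx a b R)
  rw [integrable_prod_iff hm]
  have hon : ∀ (K : FV) (C : ℝ), Measurable K → (∀ z, |K z| ≤ C * kd z) → ∀ t, Nice (G t) →
      IntegrableOn (cv K (G t)) (closedBall 0 R) := fun K C hK hb t ht =>
    (cv_lbm ht hK hb).locInt.integrableOn_isCompact (ict _ _)
  constructor
  · filter_upwards [h.nice] with t ht
    exact hon K C hK hb t ht
  · refine Integrable.mono' (integrable_const (|C| * ((∫ z, kd1 z) + 2 * (volume (closedBall (0:V3) R)).toReal)))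
      hm.norm.integral_prod_right' ?_
    filter_upwards [h.nice, h.mass] with t ht hm
    rw [rnn (by positivity)]
    have hb' : ∀ z, |kd z| ≤ 1 * kd z := fun z => by rw [aon (kd_nonneg z), one_mul]
    calc _ ≤ ∫ v in closedBall 0 R, |C| * cv kd (G t) v := by
          refine integral_mono (hon K C hK hb t ht).norm ((hon kd 1 kd_meas hb' t ht).const_mul _) fun v => ?_
          exact cv_abs ht (fun z => (hb z).trans (mlr (le_abs_self C) (kd_nonneg z))) v
      _ ≤ _ := by
          rw [icm]
          exact mll (cv_L1 ht.nn ht.int hm.2 R) (abs_nonneg _)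
theorem ball_ae (a b R : ℝ) {P : ℝ × V3 → Prop} (h : ∀ t ∈ Ioo a b, ∀ v, ‖v‖ ≤ R → P (t, v)) :
    ∀ᵐ q ∂Bx a b R, P q := by
  unfold Bx; rw [Measure.prod_restrict]
  refine ae_restrict_of_forall_mem (measurableSet_Ioo.prod msb) fun q hq => ?_
  exact h q.1 hq.1 q.2 (by simpa using hq.2)
theorem lipbox {G : ℝ → FV} (h : LocallyLipschitz (fun q : ℝ × V3 => G q.1 q.2)) (a b R : ℝ) :
    ∃ L : ℝ≥0, LipschitzOnWith L (fun q : ℝ × V3 => G q.1 q.2) (Icc a b ×ˢ closedBall 0 R) :=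
  h.locallyLipschitzOn.exists_lipschitzOnWith_of_compact (isCompact_Icc.prod (ict _ _))
theorem joint_bd {G : ℝ → FV} (h : LocallyLipschitz (fun q : ℝ × V3 => G q.1 q.2)) (a b R : ℝ) :
    ∃ C : ℝ, ∀ t ∈ Ioo a b, ∀ v, ‖v‖ ≤ R → |G t v| ≤ C ∧ (∀ i, |pd i (G t) v| ≤ C) ∧
      |deriv (fun s => G s v) t| ≤ C := by
  obtain ⟨L, hL⟩ := lipbox h (a - 1) (b + 1) (R + 1)
  obtain ⟨S, hS⟩ := (isCompact_Icc.prod (ict (0:V3) R)).exists_bound_of_continuousOn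
    (s := Icc a b ×ˢ closedBall (0:V3) R) h.continuous.continuousOn
  refine ⟨max S L, fun t ht v hv => ⟨?_, fun i => ?_, ?_⟩⟩
  · exact (hS (t, v) ⟨⟨ht.1.le, ht.2.le⟩, by simpa using hv⟩).trans (le_max_left _ _)
  · refine ((abs_pd_le _ _ i).trans ?_).trans (le_max_right _ _)
    refine norm_fderiv_le_of_lipschitzOn ℝ (s := closedBall 0 (R + 1))
      (closedBall_mem_nhds_of_mem (by simp; linarith)) (LipschitzOnWith.of_dist_le_mul fun x hx y hy => ?_)
    have := hL.dist_le_mul (t, x) ⟨⟨by linarith [ht.1], by linarith [ht.2]⟩, hx⟩ (t, y)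
      ⟨⟨by linarith [ht.1], by linarith [ht.2]⟩, hy⟩
    simpa [Prod.dist_eq] using this
  · refine le_trans ?_ (le_max_right _ _)
    rw [← rna]
    refine norm_deriv_le_of_lipschitzOn (s := Icc (a - 1) (b + 1))
      (Icc_mem_nhds (by linarith [ht.1]) (by linarith [ht.2])) (LipschitzOnWith.of_dist_le_mul fun x hx y hy => ?_)
    have hv' : v ∈ closedBall (0:V3) (R + 1) := by simp; linarith
    have := hL.dist_le_mul (x, v) ⟨hx, hv'⟩ (y, v) ⟨hy, hv'⟩
    simpa [Prod.dist_eq] using this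
theorem Flj_int {a b : ℝ} {G : ℝ → FV} (h : SolG a b G) (R : ℝ) (i : Fin 3) :
    Integrable (fun q : ℝ × V3 => Fl (G q.1) i q.2) (Bx a b R) := by
  obtain ⟨C, hC⟩ := joint_bd h.ll a b R
  refine Integrable.sub (integrable_finsetSum _ fun j _ => ?_) ?_
  · refine Integrable.mul_bdd (c := C) ?_ (pdj_meas h.ll.continuous j).aestronglyMeasurable
      (ball_ae a b R fun t ht v hv => (hC t ht v hv).2.1 j)
    simp only [coeffA_eq]
    exact (cvj_int h (proj_meas i j) (proj_b2 i j) R).const_mul _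
  · refine Integrable.bdd_mul (c := C) ?_ h.ll.continuous.aestronglyMeasurable
      (ball_ae a b R fun t ht v hv => (hC t ht v hv).1)
    exact ((cvj_int h (inv3_meas i) (inv3_b1 i) R).const_mul _).neg
theorem dtj_int {a b : ℝ} {G : ℝ → FV} (h : LocallyLipschitz (fun q : ℝ × V3 => G q.1 q.2)) (R : ℝ) :
    Integrable (fun q : ℝ × V3 => deriv (fun s => G s q.2) q.1) (Bx a b R) := by
  obtain ⟨C, hC⟩ := joint_bd h a b R
  have : IsFiniteMeasure (volume.restrict (closedBall (0:V3) R)) :=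
    isFiniteMeasure_restrict.2 measure_closedBall_lt_top.ne
  refine Integrable.of_bound (dtj_meas h.continuous).aestronglyMeasurable C
      (ball_ae a b R fun t ht v hv => (hC t ht v hv).2.2)
abbrev Zm (a b : ℝ) : Measure (ℝ × V3) := (volume.restrict (Ioo a b)).prod volume
theorem boxint {a b R : ℝ} {F : ℝ × V3 → ℝ} (hF : Integrable F (Bx a b R)) :
    Integrable ((univ ×ˢ closedBall (0:V3) R).indicator F) (Zm a b) := by
  rw [integrable_indicator_iff (MeasurableSet.univ.prod msb), IntegrableOn,
    ← Measure.prod_restrict, Measure.restrict_univ]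
  exact hF
theorem box_mul {a b R C : ℝ} {F ψ : ℝ × V3 → ℝ} (hF : Integrable F (Bx a b R)) 
    (hm : AEStronglyMeasurable (fun q => ψ q * F q) (Zm a b)) (hb : ∀ q, |ψ q| ≤ C) (hs : ∀ q, R < ‖q.2‖ → ψ q = 0) :
    Integrable (fun q => ψ q * F q) (Zm a b) := by
  refine Integrable.mono' ((boxint hF).norm.const_mul C) hm (eof fun q => ?_)
  by_cases hq : ‖q.2‖ ≤ R
  · rw [indicator_of_mem (by simpa using hq), norm_mul]
    exact mlr (hb q) (norm_nonneg _)
  · rw [hs q (not_le.1 hq), zero_mul, norm_zero]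
    have := (abs_nonneg _).trans (hb q)
    positivity
theorem box_lim {a b R C : ℝ} {F ψ : ℝ × V3 → ℝ} {ψn : ℕ → ℝ × V3 → ℝ} (hF : Integrable F (Bx a b R))
    (hm : ∀ n, AEStronglyMeasurable (fun q => ψn n q * F q) (Zm a b)) (hb : ∀ n q, |ψn n q| ≤ C)
    (hs : ∀ n q, R < ‖q.2‖ → ψn n q = 0)
    (hl : ∀ᵐ q ∂(Zm a b), Tendsto (fun n => ψn n q) atTop (𝓝 (ψ q))) :
    Tendsto (fun n => ∫ q, ψn n q * F q ∂(Zm a b)) atTop (𝓝 (∫ q, ψ q * F q ∂(Zm a b))) := by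
  refine tdc _ hm ((boxint hF).norm.const_mul C)
    (fun n => eof fun q => ?_) ?_
  · by_cases hq : ‖q.2‖ ≤ R
    · rw [indicator_of_mem (by simpa using hq), norm_mul]
      exact mlr (hb n q) (norm_nonneg _)
    · rw [hs n q (not_le.1 hq), zero_mul, norm_zero]
      have := (abs_nonneg _).trans (hb n q)
      positivity
  · filter_upwards [hl] with q hq
    exact hq.mul_const _
theorem Zm_ae {a b : ℝ} {P : ℝ × V3 → Prop} (h : ∀ᵐ q, P q) : ∀ᵐ q ∂(Zm a b), P q := by
  have : Zm a b = volume.restrict (Ioo a b ×ˢ univ) := by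
    rw [Measure.volume_eq_prod, ← Measure.prod_restrict, Measure.restrict_univ]
  rw [this]; exact ae_restrict_of_ae h
theorem fd_meas (φ : ℝ × V3 → ℝ) (i : Fin 3) : Measurable fun q => fderiv ℝ φ q (0, ee i) :=
  measurable_fderiv_apply_const ℝ φ _
theorem weakL {a b : ℝ} {G : ℝ → FV} (h : SolG a b G) {φ : ℝ × V3 → ℝ} (hφ : LocallyLipschitz φ)
    (hc : HasCompactSupport φ) (hs : tsupport φ ⊆ Ioo a b ×ˢ (univ : Set V3)) :
    ∫ q, φ q * deriv (fun s => G s q.2) q.1 ∂(Zm a b) =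
      - ∑ i, ∫ q, fderiv ℝ φ q (0, ee i) * Fl (G q.1) i q.2 ∂(Zm a b) := by
  obtain ⟨C, hC⟩ := exists_lip hφ hc
  obtain ⟨ε, hε, hεs⟩ := hc.isCompact.exists_cthickening_subset_open (isOpen_Ioo.prod isOpen_univ) hs
  obtain ⟨U, U1, U2, U3, U4, U5⟩ := moll (μ := (volume : Measure ℝ).prod (volume : Measure V3)) hC hc hε
  obtain ⟨R, R0, hR⟩ := (hc.isCompact.cthickening (r := ε)).isBounded.exists_pos_norm_lt
  have Uc : ∀ n, HasCompactSupport (U n) := fun n =>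
    (hc.isCompact.cthickening (r := ε)).of_isClosed_subset (isClosed_tsupport _) (U2 n)
  have n2 : ∀ q : ℝ × V3, R < ‖q.2‖ → q ∉ cthickening ε (tsupport φ) := fun q hq hq' => by
    have := hR q hq'; have := norm_snd_le q; linarith
  have Uz : ∀ n q, R < ‖q.2‖ → U n q = 0 := fun n q hq =>
    iez fun h => n2 q hq (U2 n h)
  have Uz' : ∀ i n q, R < ‖q.2‖ → fderiv ℝ (U n) q (0, ee i) = 0 := fun i n q hq => by
    rw [image_eq_zero_of_notMem_tsupport (f := fderiv ℝ (U n)) fun h => n2 q hq (U2 n (tsupport_fderiv_subset ℝ h))]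
    simp
  have Ub' : ∀ i n q, |fderiv ℝ (U n) q (0, ee i)| ≤ C := fun i n q => by
    have := (fderiv ℝ (U n) q).le_of_opNorm_le (U3 n q) (0, ee i)
    simpa [Prod.norm_def] using this
  have Ub : ∀ n q, |U n q| ≤ C * (2 * R + 1) := fun n q => by
    by_cases hq : q ∈ cthickening ε (tsupport φ)
    · have hl : LipschitzWith C (U n) := lipschitzWith_of_nnnorm_fderiv_le ((U1 n).differentiable (by simp)) (U3 n)
      have h4 : ‖((R + 1, 0) : ℝ × V3)‖ = R + 1 := by
        rw [Prod.norm_def]; simp [aop (by linarith : 0 < R + 1)]; linarith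
      have h1 := hl.dist_le_mul q (R + 1, 0)
      have h2 : U n (R + 1, 0) = 0 := iez fun h => by
        have := hR _ (U2 n h); linarith
      rw [h2, dist_zero_right] at h1
      refine h1.trans (mll ?_ C.2)
      have h3 : dist q (R + 1, 0) ≤ ‖q‖ + ‖((R + 1, 0) : ℝ × V3)‖ := dist_le_norm_add_norm _ _
      linarith [hR q hq]
    · rw [iez fun h => hq (U2 n h)]; simp; positivity
  have m1 : ∀ n, AEStronglyMeasurable (fun q => U n q * deriv (fun s => G s q.2) q.1) (Zm a b) := fun n =>
    ((U1 n).continuous.measurable.mul (dtj_meas h.ll.continuous)).aestronglyMeasurable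
  have m2 : ∀ i n, AEStronglyMeasurable (fun q => fderiv ℝ (U n) q (0, ee i) * Fl (G q.1) i q.2) (Zm a b) := fun i n =>
    ((fd_meas (U n) i).mul (Flj_meas h.ll.continuous i)).aestronglyMeasurable
  have e : ∀ n, ∫ q, U n q * deriv (fun s => G s q.2) q.1 ∂(Zm a b) =
      - ∑ i, ∫ q, fderiv ℝ (U n) q (0, ee i) * Fl (G q.1) i q.2 ∂(Zm a b) := fun n => by
    have i2 := fun i => box_mul (Flj_int h R i) (m2 i n) (Ub' i n) (Uz' i n)
    rw [integral_prod _ (box_mul (dtj_int h.ll R) (m1 n) (Ub n) (Uz n)),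
      ← integral_finsetSum _ fun i _ => i2 i, integral_prod _ (integrable_finsetSum _ fun i _ => i2 i)]
    exact h.w (U n) (U1 n) (Uc n) ((U2 n).trans hεs)
  have t1 := box_lim (dtj_int h.ll R) m1 Ub Uz (eof U4)
  have t2 := fun i => box_lim (Flj_int h R i) (m2 i) (Ub' i) (Uz' i) (Zm_ae (U5 (0, ee i)))
  refine tendsto_nhds_unique t1 ?_
  simp only [e]
  exact (tendsto_finsetSum _ fun i _ => t2 i).neg
theorem int_fd_zero {E : Type*} [NormedAddCommGroup E] [NormedSpace ℝ E] [FiniteDimensional ℝ E]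
    [MeasurableSpace E] [BorelSpace E] (μ : Measure E) [μ.IsAddHaarMeasure] {f : E → ℝ} (hf : LocallyLipschitz f)
    (hc : HasCompactSupport f) (v : E) : ∫ x, fderiv ℝ f x v ∂μ = 0 := by
  obtain ⟨C, hC⟩ := exists_lip hf hc
  have := (LipschitzWith.const (1:ℝ) (α := E)).integral_lineDeriv_mul_eq (μ := μ) hC hc (-v)
  simp only [neg_neg, mul_one] at this
  rw [← integral_congr_ae (ae_lineDeriv_eq_fderiv hC v), ← this]
  have h0 : ∀ x, lineDeriv ℝ (fun _ : E => (1:ℝ)) x (-v) = 0 := fun x => by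
    simp [lineDeriv]
  simp only [h0, zero_mul, integral_zero]
theorem ll_ae_diffE {E : Type*} [NormedAddCommGroup E] [NormedSpace ℝ E] [FiniteDimensional ℝ E]
    [MeasurableSpace E] [BorelSpace E] (μ : Measure E) [μ.IsAddHaarMeasure] {f : E → ℝ} (hf : LocallyLipschitz f) :
    ∀ᵐ x ∂μ, DifferentiableAt ℝ f x := by
  have : ∀ n : ℕ, ∀ᵐ x ∂μ, x ∈ ball (0:E) n → DifferentiableAt ℝ f x := fun n => by
    obtain ⟨L, hL⟩ := (hf.locallyLipschitzOn (s := closedBall 0 (n:ℝ))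
      ).exists_lipschitzOnWith_of_compact (ict _ _)
    filter_upwards [(hL.mono ball_subset_closedBall).ae_differentiableWithinAt_of_mem
      (μ := μ)] with x hx h
    exact (hx h).differentiableAt (isOpen_ball.mem_nhds h)
  filter_upwards [ae_all_iff.2 this] with x hx
  obtain ⟨n, hn⟩ := exists_nat_gt ‖x‖
  exact hx n (by simpa using hn)
theorem fd_fst {H : ℝ × V3 → ℝ} {q : ℝ × V3} (h : DifferentiableAt ℝ H q) :
    fderiv ℝ H q (1, 0) = deriv (fun s => H (s, q.2)) q.1 := by
  have h2 : HasDerivAt (fun s : ℝ => (s, q.2)) ((1:ℝ), (0:V3)) q.1 :=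
    (hasDerivAt_id' q.1).prodMk (hasDerivAt_const q.1 q.2)
  exact ((h.hasFDerivAt (x := (q.1, q.2))).comp_hasDerivAt q.1 h2).deriv.symm
theorem fd_snd {H : ℝ × V3 → ℝ} {q : ℝ × V3} (h : DifferentiableAt ℝ H q) (i : Fin 3) :
    fderiv ℝ H q (0, ee i) = pd i (fun v => H (q.1, v)) q.2 := by
  have h2 : HasFDerivAt (fun v : V3 => (q.1, v)) (ContinuousLinearMap.inr ℝ ℝ V3) q.2 := hasFDerivAt_prodMk_right _ _
  have := (h.hasFDerivAt (x := (q.1, q.2))).comp q.2 h2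
  unfold pd; erw [this.fderiv]; simp
theorem pd_cmul (c : ℝ) (f : FV) (i : Fin 3) (v : V3) : pd i (fun v => c * f v) v = c * pd i f v := by
  unfold pd
  have : (fun v => c * f v) = c • f := rfl
  rw [this, fderiv_const_smul_field]; simp
theorem Zm_eq (a b : ℝ) : Zm a b = (volume.prod volume).restrict (Ioo a b ×ˢ (univ : Set V3)) := by
  rw [← Measure.prod_restrict, Measure.restrict_univ]
def Qf (χ : FV) (B' : ℝ → ℝ) (f : FV) : ℝ := ∫ v, ∑ i, pd i (fun v => χ v * B' (f v)) v * Fl f i v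
section
variable {a b : ℝ} {G : ℝ → FV} {χ : FV} {B B' B'' : ℝ → ℝ}
theorem evol1 (h : SolG a b G) (hχ : CDI χ) (hc : HasCompactSupport χ)
    (hB : Ren B B' B'') {η : ℝ → ℝ} (hη : CDI η) (hηc : HasCompactSupport η)
    (hηs : tsupport η ⊆ Ioo a b) :
    Integrable (fun t => η t * Qf χ B' (G t)) ∧
    ∫ t, deriv η t * ∫ v, χ v * B (G t v) = ∫ t, η t * Qf χ B' (G t) := by
  have lη := ll_of_cd (by simp) hη
  have lχ := ll_of_cd (by simp) hχ
  have lη1 : LocallyLipschitz fun q : ℝ × V3 => η q.1 := lη.comp LipschitzWith.prod_fst.locallyLipschitz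
  have lχ2 : LocallyLipschitz fun q : ℝ × V3 => χ q.2 := lχ.comp LipschitzWith.prod_snd.locallyLipschitz
  have lB : LocallyLipschitz fun q : ℝ × V3 => B (G q.1 q.2) := hB.cd0.locallyLipschitz.comp h.ll
  have lB' : LocallyLipschitz fun q : ℝ × V3 => B' (G q.1 q.2) := hB.cd.locallyLipschitz.comp h.ll
  set φ : ℝ × V3 → ℝ := fun q => η q.1 * (χ q.2 * B' (G q.1 q.2)) with hφ
  set u : ℝ × V3 → ℝ := fun q => η q.1 * (χ q.2 * B (G q.1 q.2)) with hu
  have lφ : LocallyLipschitz φ := lη1.mulR (lχ2.mulR lB')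
  have lu : LocallyLipschitz u := lη1.mulR (lχ2.mulR lB)
  have hK : IsCompact (tsupport η ×ˢ tsupport χ) := hηc.isCompact.prod hc.isCompact
  have sub : ∀ (A : ℝ × V3 → ℝ), tsupport (fun q : ℝ × V3 => η q.1 * (χ q.2 * A q)) ⊆ tsupport η ×ˢ tsupport χ := by
    intro A
    refine closure_minimal (fun q hq => ?_) hK.isClosed
    simp only [Function.mem_support, ne_eq, mul_eq_zero, not_or] at hq
    exact ⟨subset_tsupport _ hq.1, subset_tsupport _ hq.2.1⟩
  have cφ : HasCompactSupport φ := hK.of_isClosed_subset (isClosed_tsupport _) (sub _)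
  have cu : HasCompactSupport u := hK.of_isClosed_subset (isClosed_tsupport _) (sub _)
  obtain ⟨R, R0, hR⟩ := cpt_ball hc
  obtain ⟨D, hD⟩ := exists_lip lφ cφ
  obtain ⟨S, hS⟩ := cφ.exists_bound_of_continuous lφ.continuous
  have zsupp : ∀ q : ℝ × V3, R + 1 < ‖q.2‖ → ∀ᶠ q' in 𝓝 q, φ q' = 0 := fun q hq => by
    filter_upwards [(isOpen_lt continuous_const (continuous_norm.comp continuous_snd)).mem_nhds
      (show R < ‖q.2‖ by linarith)] with q' hq'
    simp only [hφ, hR _ hq']; simp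
  have W := weakL h lφ cφ ((sub _).trans (prod_mono hηs (subset_univ _)))
  have b1 : ∀ i q, |fderiv ℝ φ q (0, ee i)| ≤ D := fun i q => by
    have := (fderiv ℝ φ q).le_of_opNorm_le (norm_fderiv_le_of_lipschitz ℝ hD) (0, ee i)
    simpa [Prod.norm_def] using this
  have z1 : ∀ i q, R + 1 < ‖q.2‖ → fderiv ℝ φ q (0, ee i) = 0 := fun i q hq => by
    rw [(show φ =ᶠ[𝓝 q] fun _ => 0 from zsupp q hq).fderiv_eq]; simp
  have i1 : ∀ i, Integrable (fun q => fderiv ℝ φ q (0, ee i) * Fl (G q.1) i q.2) (Zm a b) := fun i =>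
    box_mul (Flj_int h (R + 1) i) ((fd_meas φ i).mul (Flj_meas h.ll.continuous i)).aestronglyMeasurable
      (b1 i) (z1 i)
  have i1s := integrable_finsetSum Finset.univ fun i _ => i1 i
  have e1 : ∀ᵐ q ∂(Zm a b), ∑ i, fderiv ℝ φ q (0, ee i) * Fl (G q.1) i q.2 =
      η q.1 * ∑ i, pd i (fun v => χ v * B' (G q.1 v)) q.2 * Fl (G q.1) i q.2 := by
    filter_upwards [Zm_ae (ll_ae_diffE (volume.prod volume) lφ)] with q hq
    rw [Finset.mul_sum]
    refine Finset.sum_congr rfl fun i _ => ?_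
    rw [fd_snd hq i]; simp only [hφ]; rw [pd_cmul, mul_assoc]
  have i2 := i1s.congr e1
  have e2 : ∑ i, ∫ q, fderiv ℝ φ q (0, ee i) * Fl (G q.1) i q.2 ∂(Zm a b) =
      ∫ t in Ioo a b, η t * Qf χ B' (G t) := by
    rw [← integral_finsetSum _ fun i _ => i1 i, integral_congr_ae e1, integral_prod _ i2]
    simp only [icm]; rfl
  have hz : ∀ t, t ∉ Ioo a b → η t = 0 := fun t ht => iez fun h => ht (hηs h)
  have hz' : ∀ t, t ∉ Ioo a b → deriv η t = 0 := fun t ht =>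
    image_eq_zero_of_notMem_tsupport (f := deriv η) fun h => ht (hηs (tsupport_deriv_subset h))
  have iQ : Integrable (fun t => η t * Qf χ B' (G t)) := by
    have : IntegrableOn (fun t => η t * Qf χ B' (G t)) (Ioo a b) := by
      have := i2.integral_prod_left
      simp only [icm] at this; exact this
    exact this.integrable_of_forall_notMem_eq_zero fun t ht => by rw [hz t ht, zero_mul]
  refine ⟨iQ, ?_⟩
  rw [setIntegral_eq_integral_of_forall_compl_eq_zero (fun t ht => by rw [hz t ht, zero_mul])] at e2
  rw [← e2]
  have W0 := int_fd_zero (volume.prod volume) lu cu (1, 0)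
  have e3 : ∀ᵐ q ∂((volume : Measure ℝ).prod (volume : Measure V3)), fderiv ℝ u q (1, 0) =
      deriv η q.1 * (χ q.2 * B (G q.1 q.2)) + φ q * deriv (fun s => G s q.2) q.1 := by
    filter_upwards [ll_ae_diffE (volume.prod volume) h.ll] with q hq
    have dη : DifferentiableAt ℝ (fun q : ℝ × V3 => η q.1) q :=
      (hη.differentiable (by simp) q.1).comp q differentiableAt_fst
    have dχ : DifferentiableAt ℝ (fun q : ℝ × V3 => χ q.2) q :=
      (hχ.differentiable (by simp) q.2).comp q differentiableAt_snd
    have dB : DifferentiableAt ℝ (fun q : ℝ × V3 => B (G q.1 q.2)) q :=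
      (hB.d1 _).differentiableAt.fun_comp' q hq
    rw [fd_fst (show DifferentiableAt ℝ u q from dη.mul (dχ.mul dB))]
    have hG : HasDerivAt (fun s => G s q.2) (deriv (fun s => G s q.2) q.1) q.1 := by
      have h2 : DifferentiableAt ℝ (fun s : ℝ => (s, q.2)) q.1 := differentiableAt_id.prodMk (differentiableAt_const _)
      exact (DifferentiableAt.comp (g := fun q : ℝ × V3 => G q.1 q.2) q.1 hq h2).hasDerivAt
    have := ((hη.differentiable (by simp) q.1).hasDerivAt).fun_mul
      (((hB.d1 (G q.1 q.2)).comp q.1 hG).const_mul (χ q.2))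
    refine (this.congr_deriv ?_).deriv
    simp only [hφ, Function.comp]; ring
  rw [integral_congr_ae e3] at W0
  have c3 : Continuous fun q : ℝ × V3 => deriv η q.1 * (χ q.2 * B (G q.1 q.2)) :=
    ((hη.continuous_deriv (by simp)).comp continuous_fst).mul (lχ2.continuous.mul lB.continuous)
  have i4 : Integrable (fun q : ℝ × V3 => deriv η q.1 * (χ q.2 * B (G q.1 q.2))) (volume.prod volume) := by
    refine c3.integrable_of_hasCompactSupport (HasCompactSupport.intro hK fun q hq => ?_)
    rw [mem_prod, not_and_or] at hq
    rcases hq with hq | hq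
    · rw [image_eq_zero_of_notMem_tsupport (f := deriv η) fun h => hq (tsupport_deriv_subset h)]; simp
    · rw [iez hq]; simp
  have i5' : Integrable (fun q => φ q * deriv (fun s => G s q.2) q.1) (Zm a b) :=
    box_mul (dtj_int h.ll (R + 1)) (lφ.continuous.measurable.mul (dtj_meas h.ll.continuous)).aestronglyMeasurable
      hS (fun q hq => (zsupp q hq).self_of_nhds)
  have hz5 : ∀ q : ℝ × V3, q ∉ Ioo a b ×ˢ (univ : Set V3) → φ q * deriv (fun s => G s q.2) q.1 = 0 := fun q hq => by
    have : q.1 ∉ Ioo a b := fun h => hq ⟨h, trivial⟩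
    simp only [hφ, hz _ this, zero_mul]
  rw [Zm_eq] at i5'
  have i5 := IntegrableOn.integrable_of_forall_notMem_eq_zero i5' hz5
  rw [integral_add i4 i5, integral_prod _ i4] at W0
  rw [Zm_eq, setIntegral_eq_integral_of_forall_compl_eq_zero hz5, ← Zm_eq] at W
  simp only [icm] at W0
  linarith
theorem F_ll (h : LocallyLipschitz (fun q : ℝ × V3 => G q.1 q.2)) (hχ : Continuous χ) (hc : HasCompactSupport χ)
    (hB : ContDiff ℝ 1 B) : LocallyLipschitz fun t => ∫ v, χ v * B (G t v) := by
  intro x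
  obtain ⟨R, R0, hR⟩ := cpt_ball hc
  obtain ⟨L, hL⟩ := lipbox (G := fun t v => B (G t v)) (hB.locallyLipschitz.comp h) (x - 1) (x + 1) R
  have iχ := hχ.integrable_of_hasCompactSupport (μ := volume) hc
  refine ⟨⟨∫ v, |χ v| * L, by positivity⟩, Icc (x - 1) (x + 1), Icc_mem_nhds (by linarith) (by linarith),
    LipschitzOnWith.of_dist_le_mul fun s hs t ht => ?_⟩
  have ii : ∀ t, Integrable fun v => χ v * B (G t v) := fun t =>
    ((LBM.of_cont hχ).mul (LBM.of_cont (hB.continuous.comp (ll_slice h t).continuous))).intg hc.mul_right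
  rw [Real.dist_eq, ← integral_sub (ii s) (ii t)]
  change _ ≤ (∫ v, |χ v| * L) * dist s t
  rw [← integral_mul_const]
  refine abs_integral_le_integral_abs.trans (integral_mono ((ii s).sub (ii t)).abs
    ((iχ.abs.mul_const _).mul_const _) fun v => ?_)
  simp only
  rw [← mul_sub, abs_mul, mul_assoc]
  by_cases hv : ‖v‖ ≤ R
  · refine mll ?_ (abs_nonneg _)
    have := hL.dist_le_mul (s, v) ⟨hs, by simpa using hv⟩ (t, v) ⟨ht, by simpa using hv⟩
    simpa [Prod.dist_eq, Real.dist_eq] using this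
  · simp [hR v (not_le.1 hv)]
theorem evol (h : SolG a b G) (hχ : CDI χ) (hc : HasCompactSupport χ)
    (hB : Ren B B' B'') :
    LocallyIntegrableOn (fun t => Qf χ B' (G t)) (Ioo a b) ∧ ∀ s t, a < s → s ≤ t → t < b →
    (∫ v, χ v * B (G t v)) - ∫ v, χ v * B (G s v) = - ∫ τ in s..t, Qf χ B' (G τ) := by
  set F : ℝ → ℝ := fun t => ∫ v, χ v * B (G t v) with hF
  set Q : ℝ → ℝ := fun t => Qf χ B' (G t) with hQ
  have lF : LocallyLipschitz F := F_ll h.ll hχ.continuous hc hB.cd0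
  have key := fun η hη hηc hηs => evol1 h hχ hc hB (η := η) hη hηc hηs
  have lQ : LocallyIntegrableOn Q (Ioo a b) := by
    intro x hx
    obtain ⟨r, hr, hrs⟩ := Metric.isOpen_iff.1 isOpen_Ioo x hx
    let f : ContDiffBump x := ⟨r / 4, r / 2, by positivity, by linarith⟩
    have k := (key f f.contDiff f.hasCompactSupport (by
      rw [f.tsupport_eq]; exact (closedBall_subset_ball (show r / 2 < r by linarith)).trans hrs)).1
    refine ⟨closedBall x (r / 4), mem_nhdsWithin_of_mem_nhds (closedBall_mem_nhds x (by positivity)), ?_⟩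
    refine (k.integrableOn (s := closedBall x (r / 4))).congr_fun (fun y hy => ?_) msb
    simp only [f.one_of_mem_closedBall hy, one_mul]; rfl
  have lD : LocallyIntegrable (deriv F) := by
    intro x
    obtain ⟨L, U, hU, hL⟩ := lF x
    obtain ⟨r, hr, hrs⟩ := Metric.mem_nhds_iff.1 hU
    refine ⟨ball x r, ball_mem_nhds x hr, Measure.integrableOn_of_bounded (M := L) measure_ball_lt_top.ne
      (measurable_deriv F).aestronglyMeasurable (ae_restrict_of_forall_mem measurableSet_ball fun y hy => ?_)⟩
    exact norm_deriv_le_of_lipschitzOn (isOpen_ball.mem_nhds hy) (hL.mono hrs)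
  have zero : ∀ᵐ x, x ∈ Ioo a b → deriv F x + Q x = 0 := by
    refine isOpen_Ioo.ae_eq_zero_of_integral_contDiff_smul_eq_zero
      ((lD.locallyIntegrableOn _).add lQ) fun η hη hηc hηs => ?_
    have lη := ll_of_cd (by simp) hη
    obtain ⟨k1, k2⟩ := key η hη hηc hηs
    have z := int_fd_zero volume (lη.mulR lF) hηc.mul_right (1:ℝ)
    have cF := lF.continuous
    have i1 : Integrable fun x => deriv η x * F x :=
      ((hη.continuous_deriv (by simp)).mul cF).integrable_of_hasCompactSupport hηc.deriv.mul_right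
    have i2 : Integrable fun x => η x * deriv F x := lD.integrable_smul_left_of_hasCompactSupport hη.continuous hηc
    have e : ∫ x, fderiv ℝ (fun x => η x * F x) x 1 = ∫ x, deriv η x * F x + η x * deriv F x := by
      refine integral_congr_ae ?_
      filter_upwards [ll_ae_diffE volume lF] with x hx
      rw [fderiv_apply_one_eq_deriv]
      exact deriv_fun_mul (hη.differentiable (by simp) x) hx
    rw [e, integral_add i1 i2] at z
    simp only [smul_eq_mul, mul_add]
    rw [integral_add i2 k1]
    linarith
  refine ⟨lQ, fun s t hs hst ht => ?_⟩
  obtain ⟨L, hL⟩ := (lF.locallyLipschitzOn (s := uIcc s t)).exists_lipschitzOnWith_of_compact isCompact_uIcc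
  have := hL.absolutelyContinuousOnInterval.integral_deriv_eq_sub
  rw [← this, ← intervalIntegral.integral_neg]
  refine intervalIntegral.integral_congr_ae ?_
  filter_upwards [zero] with x hx hx'
  rw [uIoc_of_le hst] at hx'
  have := hx ⟨by linarith [hx'.1], by linarith [hx'.2]⟩
  linarith
end
structure Sol (T : ℝ) (g : ℝ → FV) : Prop where
  nn : ∀ t v, 0 ≤ g t v
  ll : LocLipschitz T g
  w : IsWeakLandauSolution T g
  mass : ∀ᵐ t ∂volume.restrict (Ioo 0 T), Integrable (g t) ∧ ∫ v, g t v = 1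
def clp (a b t : ℝ) : ℝ := max a (min t b)
theorem clp_eq {a b t : ℝ} (h : t ∈ Ioo a b) : clp a b t = t := by
  unfold clp; rw [min_eq_left h.2.le, max_eq_right h.1.le]
theorem Sol.solG {T : ℝ} {g : ℝ → FV} (h : Sol T g) {a b : ℝ} (ha : 0 < a) (hab : a < b) (hb : b < T) :
    SolG a b fun t => g (clp a b t) := by
  have lc : LipschitzWith 1 (clp a b) := (LipschitzWith.id.min_const b).const_max a
  have ll : LocallyLipschitz (fun q : ℝ × V3 => g (clp a b q.1) q.2) := by
    intro q
    obtain ⟨L, hL⟩ := h.ll (Icc a b ×ˢ closedBall q.2 1) (isCompact_Icc.prod (ict _ _))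
      (fun p hp => ⟨⟨ha.trans_le hp.1.1, hp.1.2.trans hb.le⟩, trivial⟩)
    have l2 : LipschitzWith 1 (fun q : ℝ × V3 => (clp a b q.1, q.2)) := by
      have := (lc.comp LipschitzWith.prod_fst).prodMk (LipschitzWith.prod_snd (α := ℝ) (β := V3))
      simpa using this
    refine ⟨L * 1, univ ×ˢ closedBall q.2 1, prod_mem_nhds univ_mem (closedBall_mem_nhds _ one_pos), ?_⟩
    exact hL.comp l2.lipschitzOnWith fun p hp => ⟨⟨le_max_left _ _, max_le hab.le (min_le_right _ _)⟩, hp.2⟩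
  have hsub : Ioo a b ⊆ Ioo 0 T := Ioo_subset_Ioo ha.le hb.le
  have mass : ∀ᵐ t ∂volume.restrict (Ioo a b), Integrable (g (clp a b t)) ∧ ∫ v, g (clp a b t) v = 1 := by
    filter_upwards [arr hsub h.mass, ard measurableSet_Ioo] with t ht h2
    rw [clp_eq h2]; exact ht
  refine ⟨ll, fun t v => h.nn _ v, mass, fun φ hφ hc hs => ?_⟩
  have hz : ∀ t, t ∉ Ioo a b → ∀ v, (t, v) ∉ tsupport φ := fun t ht v hv => ht (hs hv).1
  have hz' : ∀ t, t ∉ Ioo a b → ∀ v, fderiv ℝ φ (t, v) = 0 := fun t ht v =>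
    iez fun hv => hz t ht v (tsupport_fderiv_subset ℝ hv)
  have W := h.w φ hφ hc ((subset_tsupport φ).trans (hs.trans (prod_mono hsub subset_rfl)))
  rw [setIntegral_eq_of_subset_of_forall_sdiff_eq_zero measurableSet_Ioo hsub
    (fun t ht => by simp [iez (hz t ht.2 _)]),
    setIntegral_eq_of_subset_of_forall_sdiff_eq_zero (s := Ioo a b) (t := Ioo 0 T) measurableSet_Ioo hsub
    (fun t ht => by simp [hz' t ht.2])] at W
  have e1 : ∀ t ∈ Ioo a b, ∀ v, deriv (fun s => g (clp a b s) v) t = deriv (fun s => g s v) t := fun t ht v => by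
    refine EventuallyEq.deriv_eq ?_
    filter_upwards [isOpen_Ioo.mem_nhds ht] with s hs
    rw [clp_eq hs]
  rw [setIntegral_congr_fun measurableSet_Ioo (g := fun t => ∫ v : V3, φ (t, v) * deriv (fun s => g s v) t)
    (fun t ht => by simp only [e1 t ht]), W]
  congr 1
  refine integral_congr_ae ?_
  filter_upwards [mass, ard measurableSet_Ioo] with t ht h2
  rw [clp_eq h2] at ht ⊢
  have hn : Nice (g t) := ⟨h.nn t, by simpa [clp_eq h2] using ll_slice (G := fun τ => g (clp a b τ)) ll t, ht.1⟩
  refine integral_congr_ae ?_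
  filter_upwards [ae_all_iff.2 fun i => pd_a hn i] with v hv
  simp only [hv, Fl]
theorem Sol.nice {T : ℝ} {g : ℝ → FV} (h : Sol T g) : ∀ᵐ t ∂volume.restrict (Ioo 0 T), Nice (g t) := by
  filter_upwards [h.mass, ard measurableSet_Ioo] with t ht h2
  have := ll_slice (G := fun τ => g (clp (t / 2) ((t + T) / 2) τ)) (h.solG (a := t / 2) (b := (t + T) / 2) (by linarith [h2.1]) (by linarith [h2.1, h2.2])
    (by linarith [h2.2])).ll t
  rw [clp_eq ⟨by linarith [h2.1], by linarith [h2.2]⟩] at this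
  exact ⟨h.nn t, this, ht.1⟩
theorem Sol.evol {T : ℝ} {g : ℝ → FV} (h : Sol T g) {χ : FV} {B B' B'' : ℝ → ℝ} (hχ : CDI χ)
    (hc : HasCompactSupport χ) (hB : Ren B B' B'') {s t : ℝ} (hs : 0 < s) (hst : s ≤ t) (ht : t < T) :
    IntegrableOn (fun τ => Qf χ B' (g τ)) (Icc s t) ∧
    (∫ v, χ v * B (g t v)) - ∫ v, χ v * B (g s v) = - ∫ τ in s..t, Qf χ B' (g τ) := by
  have hG := h.solG (a := s / 2) (b := (t + T) / 2) (by linarith) (by linarith) (by linarith)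
  obtain ⟨h1, h2⟩ := _root_.evol hG hχ hc hB
  have e : ∀ τ ∈ Icc s t, g (clp (s / 2) ((t + T) / 2) τ) = g τ := fun τ hτ => by
    rw [clp_eq ⟨by linarith [hτ.1], by linarith [hτ.2]⟩]
  constructor
  · refine (h1.integrableOn_compact_subset (t := Icc s t) (fun τ hτ => ⟨by linarith [hτ.1], by linarith [hτ.2]⟩)
      isCompact_Icc).congr_fun (fun τ hτ => ?_) measurableSet_Icc
    simp only [e τ hτ]
  · have := h2 s t (by linarith) hst (by linarith)
    rw [e s ⟨le_rfl, hst⟩, e t ⟨hst, le_rfl⟩] at this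
    rw [this]
    congr 1
    refine intervalIntegral.integral_congr fun τ hτ => ?_
    rw [uIcc_of_le hst] at hτ
    simp only [e τ hτ]
theorem ren_id : Ren (fun x => x) (fun _ => 1) (fun _ => 0) :=
  ⟨fun x => hasDerivAt_id' x, fun x => hasDerivAt_const x 1, continuous_const⟩
def jj (v : V3) : ℝ := 1 + ‖v‖ ^ 2
theorem jj_one (v : V3) : 1 ≤ jj v := by unfold jj; nlinarith [sq_nonneg ‖v‖]
theorem jj_pos (v : V3) : 0 < jj v := by linarith [jj_one v]
theorem jj_cont : Continuous jj := by unfold jj; fun_prop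
theorem opn_le (L : V3 →L[ℝ] ℝ) {c : ℝ} (h : ∀ i, |L (ee i)| ≤ c) : ‖L‖ ≤ 3 * c := by
  have hc : 0 ≤ c := (abs_nonneg _).trans (h 0)
  refine L.opNorm_le_bound (by positivity) fun z => ?_
  have e : z = ∑ i, z i • ee i := by
    ext j; fin_cases j <;> simp [su3, ee]
  have : L z = ∑ i, z i * L (ee i) := by
    conv_lhs => rw [e]
    simp
  rw [this, rna]
  have k : ∀ i, |z i * L (ee i)| ≤ ‖z‖ * c := fun i => by
    rw [abs_mul]; exact mul_le_mul (abs_coord_le z i) (h i) (abs_nonneg _) (norm_nonneg _)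
  refine (Finset.abs_sum_le_sum_abs _ _).trans ?_
  rw [su3]; linarith [k 0, k 1, k 2]
theorem pd_diff_bd {ψ : FV} (hψ : CDI ψ) {k : ℕ} {D : ℝ}
    (hD : ∀ i j u, |pd j (pd i ψ) u| ≤ D * jj u ^ k) (i : Fin 3) (v w : V3) :
    |pd i ψ v - pd i ψ w| ≤ 3 * D * (jj v ^ k + jj w ^ k) * ‖v - w‖ := by
  have D0 : 0 ≤ D := by
    have := (abs_nonneg _).trans (hD 0 0 0); simpa [jj] using this
  set m := max ‖v‖ ‖w‖ with hm
  have hmk : (1 + m ^ 2) ^ k ≤ jj v ^ k + jj w ^ k := by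
    have h1 := pow_pos (jj_pos v) k
    have h2 := pow_pos (jj_pos w) k
    rcases max_choice ‖v‖ ‖w‖ with h | h <;> rw [hm, h] <;> unfold jj at * <;> linarith
  have hb : ∀ u ∈ closedBall (0:V3) m, ‖fderiv ℝ (pd i ψ) u‖ ≤ 3 * D * (jj v ^ k + jj w ^ k) := fun u hu => by
    have hu' : ‖u‖ ≤ m := by simpa using hu
    refine (opn_le _ (c := D * (1 + m ^ 2) ^ k) fun j => (hD i j u).trans ?_).trans ?_
    · unfold jj; gcongr
    · rw [← mul_assoc]; gcongr
  have := (convex_closedBall (0:V3) m).norm_image_sub_le_of_norm_fderiv_le (𝕜 := ℝ) (f := pd i ψ) (x := w) (y := v)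
    (fun u _ => (cd_pd hψ i).differentiable (by simp) u) hb (by simp [hm]) (by simp [hm])
  simpa using this
theorem sym_bd {f ψ : FV} (hf : Nice f) (hψ : CDI ψ) (hc : HasCompactSupport ψ) {k : ℕ} {D S : ℝ}
    (hD : ∀ i j u, |pd j (pd i ψ) u| ≤ D * jj u ^ k) (hS : ∀ v, cv (fun z => ‖z‖⁻¹) f v ≤ S)
    (hi : Integrable fun v => jj v ^ k * f v) (i : Fin 3) :
    |∫ v, pd i ψ v * (f v * bb f i v)| ≤ 3 * D * S * ∫ v, jj v ^ k * f v := by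
  have D0 : 0 ≤ D := by
    have := (abs_nonneg _).trans (hD 0 0 0); simpa [jj] using this
  set K : FV := fun z => z i * ‖z‖⁻¹ ^ 3 with hK
  set φ : FV := fun v => pd i ψ v * f v with hφ
  have hφL : LBM φ := (LBM.of_cont (cd_pd hψ i).continuous).mul (LBM.of_cont hf.ll.continuous)
  have hφc : HasCompactSupport φ := (cs_pd hc i).mul_right
  have hp := cv_prod hφL hφc (inv3_meas i) (inv3_b1 i) hf.int
  have e0 : ∫ v, pd i ψ v * (f v * bb f i v) = - ((4 * π)⁻¹ * ∫ v, φ v * cv K f v) := by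
    rw [← icm, ← integral_neg]; congr 1; ext v; simp only [bb, hφ, hK]; ring
  have e1 : ∫ v, φ v * cv K f v = ∫ q : V3 × V3, φ q.1 * (K (q.1 - q.2) * f q.2) ∂(volume.prod volume) := by
    rw [integral_prod _ hp]; simp only [cv, icm, hK]
  have e2 : ∫ q : V3 × V3, φ q.1 * (K (q.1 - q.2) * f q.2) ∂(volume.prod volume) =
      ∫ q : V3 × V3, φ q.2 * (K (q.2 - q.1) * f q.1) ∂(volume.prod volume) :=
    (integral_prod_swap (μ := volume) (ν := volume) (fun q : V3 × V3 => φ q.1 * (K (q.1 - q.2) * f q.2))).symm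
  have hp2 : Integrable (fun q : V3 × V3 => φ q.2 * (K (q.2 - q.1) * f q.1)) (volume.prod volume) := hp.swap
  have hodd : ∀ z, K (-z) = - K z := fun z => by simp [hK]
  have m1 : Integrable (fun q : V3 × V3 => (jj q.1 ^ k * f q.1) * (‖q.1 - q.2‖⁻¹ * f q.2)) (volume.prod volume) := by
    rw [integrable_prod_iff]
    · refine ⟨eof fun v => by simpa using (cv_sl hf (by fun_prop) nrm_b v).const_mul (jj v ^ k * f v), ?_⟩
      refine Integrable.mono' (hi.mul_const S) ?_ (eof fun v => ?_)
      · refine AEStronglyMeasurable.integral_prod_right' (f := fun q : V3 × V3 => ‖(jj q.1 ^ k * f q.1) * (‖q.1 - q.2‖⁻¹ * f q.2)‖) ?_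
        have := hf.ll.continuous; have := jj_cont
        exact Measurable.aestronglyMeasurable (by fun_prop)
      · rw [rnn (by positivity)]
        have : ∀ w, ‖(jj v ^ k * f v) * (‖v - w‖⁻¹ * f w)‖ = (jj v ^ k * f v) * (‖v - w‖⁻¹ * f w) := fun w =>
          rnn (mul_nonneg (mul_nonneg (pow_nonneg (jj_pos v).le k) (hf.nn v)) (mul_nonneg (by positivity) (hf.nn w)))
        simp only [this, icm]
        exact mll (hS v) (mul_nonneg (pow_nonneg (jj_pos v).le k) (hf.nn v))
    · have := hf.ll.continuous; have := jj_cont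
      exact Measurable.aestronglyMeasurable (by fun_prop)
  have m1v : ∫ q : V3 × V3, (jj q.1 ^ k * f q.1) * (‖q.1 - q.2‖⁻¹ * f q.2) ∂(volume.prod volume) ≤ S * ∫ v, jj v ^ k * f v := by
    rw [integral_prod _ m1, ← icm]
    refine integral_mono m1.integral_prod_left (hi.const_mul S) fun v => ?_
    simp only [icm]
    rw [mul_comm S]
    exact mll (hS v) (mul_nonneg (pow_nonneg (jj_pos v).le k) (hf.nn v))
  have m2 : Integrable (fun q : V3 × V3 => (jj q.2 ^ k * f q.2) * (‖q.2 - q.1‖⁻¹ * f q.1)) (volume.prod volume) := m1.swap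
  have m2v : ∫ q : V3 × V3, (jj q.2 ^ k * f q.2) * (‖q.2 - q.1‖⁻¹ * f q.1) ∂(volume.prod volume) =
      ∫ q : V3 × V3, (jj q.1 ^ k * f q.1) * (‖q.1 - q.2‖⁻¹ * f q.2) ∂(volume.prod volume) :=
    integral_prod_swap (μ := volume) (ν := volume) (fun q : V3 × V3 => (jj q.1 ^ k * f q.1) * (‖q.1 - q.2‖⁻¹ * f q.2))
  have main : |2 * ∫ v, φ v * cv K f v| ≤ 3 * D * (2 * (S * ∫ v, jj v ^ k * f v)) := by
    have : 2 * ∫ v, φ v * cv K f v = ∫ q : V3 × V3, (φ q.1 * (K (q.1 - q.2) * f q.2) + φ q.2 * (K (q.2 - q.1) * f q.1)) ∂(volume.prod volume) := by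
      rw [integral_add hp hp2, ← e2, ← e1]; ring
    rw [this]
    refine abs_integral_le_integral_abs.trans ?_
    calc _ ≤ ∫ q : V3 × V3, 3 * D * ((jj q.1 ^ k * f q.1) * (‖q.1 - q.2‖⁻¹ * f q.2) + (jj q.2 ^ k * f q.2) * (‖q.2 - q.1‖⁻¹ * f q.1)) ∂(volume.prod volume) := by
          refine integral_mono (hp.add hp2).abs ((m1.add m2).const_mul _) fun q => ?_
          have h1 : φ q.1 * (K (q.1 - q.2) * f q.2) + φ q.2 * (K (q.2 - q.1) * f q.1) =
              (pd i ψ q.1 - pd i ψ q.2) * K (q.1 - q.2) * (f q.1 * f q.2) := by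
            rw [← neg_sub q.1 q.2, hodd]; simp only [hφ]; ring
          simp only [h1, abs_mul, norm_sub_rev q.2 q.1]
          have h2 := pd_diff_bd hψ hD i q.1 q.2
          have h3 : ‖q.1 - q.2‖ * |K (q.1 - q.2)| ≤ ‖q.1 - q.2‖⁻¹ := by
            set z := q.1 - q.2
            rcases eq_or_ne z 0 with h | h
            · simp [h]
            · have hz : 0 < ‖z‖ := norm_pos_iff.2 h
              simp only [hK, abs_mul, abs_pow, abs_inv, abs_norm]
              calc _ ≤ ‖z‖ * (‖z‖ * ‖z‖⁻¹ ^ 3) := by gcongr; exact abs_coord_le z i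
                _ = _ := by field_simp
          have n1 := hf.nn q.1
          have n2 := hf.nn q.2
          rw [aon n1, aon n2]
          have j1 := pow_pos (jj_pos q.1) k
          have j2 := pow_pos (jj_pos q.2) k
          calc _ ≤ 3 * D * (jj q.1 ^ k + jj q.2 ^ k) * ‖q.1 - q.2‖ * |K (q.1 - q.2)| * (f q.1 * f q.2) := by gcongr
            _ = 3 * D * (jj q.1 ^ k + jj q.2 ^ k) * (f q.1 * f q.2) * (‖q.1 - q.2‖ * |K (q.1 - q.2)|) := by ring
            _ ≤ 3 * D * (jj q.1 ^ k + jj q.2 ^ k) * (f q.1 * f q.2) * ‖q.1 - q.2‖⁻¹ := by gcongr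
            _ = _ := by ring
      _ ≤ _ := by
          rw [icm, integral_add m1 m2, m2v]
          have : 0 ≤ 3 * D := by positivity
          nlinarith
  have pi4 : (4 * π)⁻¹ ≤ 1 := inv_le_one_of_one_le₀ (by linarith [pi_gt_three])
  have pi0 : 0 < (4 * π)⁻¹ := by positivity
  rw [e0, abs_neg, abs_mul, aop pi0]
  rw [abs_mul, abs_two] at main
  nlinarith [abs_nonneg (∫ v, φ v * cv K f v)]
theorem A_bd {f : FV} (hf : Nice f) {S : ℝ} (hS : ∀ v, cv (fun z => ‖z‖⁻¹) f v ≤ S) (v : V3) (i j : Fin 3) :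
    |coeffA f v i j| ≤ S := by
  have k : |cv (fun z => projPi z i j / ‖z‖) f v| ≤ 2 * S := by
    unfold cv
    have ii := (cv_sl hf (by fun_prop) nrm_b v).const_mul 2
    refine abs_integral_le_integral_abs.trans ((integral_mono_of_nonneg (eof fun w => abs_nonneg _) ii
      (eof fun w => ?_)).trans (by rw [icm]; linarith [hS v, show cv (fun z => ‖z‖⁻¹) f v = ∫ a, ‖v - a‖⁻¹ * f a from rfl]))
    simp only [abs_mul, aon (hf.nn w), ← mul_assoc]
    exact mlr (proj_b _ i j) (hf.nn w)
  have p8 : (8 * π)⁻¹ ≤ 1 / 2 := by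
    rw [inv_le_comm₀ (by positivity) (by norm_num)]; linarith [pi_gt_three]
  have p0 : 0 < (8 * π)⁻¹ := by positivity
  rw [coeffA_eq, abs_mul, aop p0]
  nlinarith [abs_nonneg (cv (fun z => projPi z i j / ‖z‖) f v)]
theorem lin_bd {f ψ : FV} (hf : Nice f) (hψ : CDI ψ) (hc : HasCompactSupport ψ) {k : ℕ} {D S : ℝ}
    (hD : ∀ i j u, |pd j (pd i ψ) u| ≤ D * jj u ^ k) (hS : ∀ v, cv (fun z => ‖z‖⁻¹) f v ≤ S)
    (hi : Integrable fun v => jj v ^ k * f v) : |Qf ψ (fun _ => 1) f| ≤ 27 * D * S * ∫ v, jj v ^ k * f v := by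
  unfold Qf
  rw [spatial hf hψ hc ren_id]
  simp only [zero_mul, mul_zero, mul_one, sub_self, integral_zero, zero_sub]
  have S0 : 0 ≤ S := (abs_nonneg _).trans (A_bd hf hS 0 0 0)
  have h1 := fun i => sym_bd hf hψ hc hD hS hi i
  have h2 : ∀ i j, |∫ v, pd j (pd i ψ) v * (f v * coeffA f v i j)| ≤ D * S * ∫ v, jj v ^ k * f v := fun i j => by
    rw [← icm]
    refine abs_integral_le_integral_abs.trans (integral_mono_of_nonneg (eof fun w => abs_nonneg _)
      (hi.const_mul _) (eof fun v => ?_))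
    simp only [abs_mul, aon (hf.nn v)]
    have := hf.nn v
    calc _ ≤ D * jj v ^ k * (f v * S) := by
          gcongr
          · exact (abs_nonneg _).trans (hD i j v)
          · exact hD i j v
          · exact A_bd hf hS v i j
      _ = _ := by ring
  set X := ∫ v, jj v ^ k * f v
  have a1 := abs_le.1 (h1 0); have a2 := abs_le.1 (h1 1); have a3 := abs_le.1 (h1 2)
  have b00 := abs_le.1 (h2 0 0); have b01 := abs_le.1 (h2 0 1); have b02 := abs_le.1 (h2 0 2)
  have b10 := abs_le.1 (h2 1 0); have b11 := abs_le.1 (h2 1 1); have b12 := abs_le.1 (h2 1 2)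
  have b20 := abs_le.1 (h2 2 0); have b21 := abs_le.1 (h2 2 1); have b22 := abs_le.1 (h2 2 2)
  simp only [su3]
  rw [abs_le]; constructor <;> linarith
theorem ae_mono {T s t : ℝ} {P : ℝ → Prop} (hs : 0 ≤ s) (ht : t ≤ T) (h : ∀ᵐ τ ∂volume.restrict (Ioo 0 T), P τ) :
    ∀ᵐ τ ∂volume.restrict (Ioo s t), P τ := arr (Ioo_subset_Ioo hs ht) h
structure Hyp (T : ℝ) (g : ℝ → FV) (gi : FV) (S : ℝ → ℝ) : Prop extends Sol T g where
  hS : ∀ᵐ t ∂volume.restrict (Ioo 0 T), ∀ v, cv (fun z => ‖z‖⁻¹) (g t) v ≤ S t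
  S0 : ∀ t, 0 ≤ S t
  Si : IntegrableOn S (Ioo 0 T)
  tend : ∀ φ : FV, CDI φ → HasCompactSupport φ →
            Filter.Tendsto (fun t => ∫ v : V3, g t v * φ v)
              (nhdsWithin 0 (Set.Ioi 0)) (nhds (∫ v : V3, gi v * φ v))
theorem Hyp.lin {T : ℝ} {g : ℝ → FV} {gi : FV} {S : ℝ → ℝ} (h : Hyp T g gi S) {ψ : FV}
    (hψ : CDI ψ) (hc : HasCompactSupport ψ) {k : ℕ} {D Mk : ℝ}
    (hD : ∀ i j u, |pd j (pd i ψ) u| ≤ D * jj u ^ k)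
    (hM : ∀ᵐ t ∂volume.restrict (Ioo 0 T), (Integrable fun v => jj v ^ k * g t v) ∧ ∫ v, jj v ^ k * g t v ≤ Mk)
    {t : ℝ} (h0 : 0 < t) (hT : t < T) :
    |(∫ v, g t v * ψ v) - ∫ v, gi v * ψ v| ≤ 27 * D * Mk * ∫ τ in Ioo 0 t, S τ := by
  have D0 : 0 ≤ D := by
    have := (abs_nonneg _).trans (hD 0 0 0); simpa [jj] using this
  have key : ∀ s ∈ Ioo 0 t, |(∫ v, g t v * ψ v) - ∫ v, g s v * ψ v| ≤ 27 * D * Mk * ∫ τ in Ioo 0 t, S τ := fun s hs => by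
    obtain ⟨e1, e2⟩ := h.toSol.evol hψ hc ren_id hs.1 hs.2.le hT
    simp only [mul_comm _ (ψ _)]
    rw [e2, abs_neg, intervalIntegral.integral_of_le hs.2.le, integral_Ioc_eq_integral_Ioo]
    have SI : IntegrableOn S (Ioo 0 t) := h.Si.mono_set (Ioo_subset_Ioo le_rfl hT.le)
    have SI' : IntegrableOn S (Ioo s t) := h.Si.mono_set (Ioo_subset_Ioo hs.1.le hT.le)
    have al := ae_mono hs.1.le hT.le (hM.and (h.hS.and h.toSol.nice))
    have M0 : ∀ᵐ τ ∂volume.restrict (Ioo s t), |Qf ψ (fun _ => 1) (g τ)| ≤ 27 * D * Mk * S τ := by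
      filter_upwards [al] with τ ⟨a, b, c⟩
      refine (lin_bd c hψ hc hD b a.1).trans ?_
      have := h.S0 τ
      calc _ ≤ 27 * D * S τ * Mk := by gcongr; exact a.2
        _ = _ := by ring
    have Mk0 : 0 ≤ Mk := by
      have : (volume.restrict (Ioo s t)) ≠ 0 := by
        simp [Measure.restrict_eq_zero, hs.2]
      have := (ae_neBot.2 this)
      obtain ⟨τ, a, b, c⟩ := al.exists
      exact (integral_nonneg fun v => mul_nonneg (pow_nonneg (jj_pos v).le k) (h.nn τ v)).trans a.2
    calc _ ≤ ∫ τ in Ioo s t, 27 * D * Mk * S τ :=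
          abs_integral_le_integral_abs.trans (integral_mono_of_nonneg (eof fun _ => abs_nonneg _)
            (SI'.const_mul _) M0)
      _ ≤ _ := by
          rw [icm]
          exact mll (setIntegral_mono_set SI (eof h.S0)
            (LE.le.eventuallyLE (Ioo_subset_Ioo hs.1.le le_rfl))) (by positivity)
  have l := ((h.tend ψ hψ hc).const_sub (∫ v, g t v * ψ v)).abs
  refine le_of_tendsto l ?_
  filter_upwards [Ioo_mem_nhdsGT h0] with s hs using key s hs
/-! cutoffs -/
def zt (x : ℝ) : ℝ := Real.smoothTransition (2 - x)
theorem zt_cd : CDI zt := Real.smoothTransition.contDiff.comp (contDiff_const.sub contDiff_id)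
theorem zt_one {x : ℝ} (h : x ≤ 1) : zt x = 1 := Real.smoothTransition.one_of_one_le (by linarith)
theorem zt_zero {x : ℝ} (h : 2 ≤ x) : zt x = 0 := Real.smoothTransition.zero_of_nonpos (by linarith)
theorem zt_nn (x : ℝ) : 0 ≤ zt x := Real.smoothTransition.nonneg _
theorem zt_le (x : ℝ) : zt x ≤ 1 := Real.smoothTransition.le_one _
theorem zt_d : ∃ C : ℝ, 0 < C ∧ ∀ x, 0 ≤ x → |deriv zt x| ≤ C ∧ |deriv (deriv zt) x| ≤ C ∧
    |x * deriv zt x| ≤ C ∧ |x ^ 2 * deriv (deriv zt) x| ≤ C := by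
  have c1 : CDI (deriv zt) := (contDiff_infty_iff_deriv.1 zt_cd).2
  have c2 : CDI (deriv (deriv zt)) := (contDiff_infty_iff_deriv.1 c1).2
  have z1 : ∀ x, 2 < x → deriv zt x = 0 := fun x hx => by
    have : zt =ᶠ[𝓝 x] fun _ => 0 := by filter_upwards [lt_mem_nhds hx] with y hy using zt_zero hy.le
    rw [this.deriv_eq]; simp
  have z2 : ∀ x, 2 < x → deriv (deriv zt) x = 0 := fun x hx => by
    have : deriv zt =ᶠ[𝓝 x] fun _ => 0 := by filter_upwards [lt_mem_nhds hx] with y hy using z1 y hy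
    rw [this.deriv_eq]; simp
  obtain ⟨C1, h1⟩ := (isCompact_Icc (a := (0:ℝ)) (b := 2)).exists_bound_of_continuousOn c1.continuous.continuousOn
  obtain ⟨C2, h2⟩ := (isCompact_Icc (a := (0:ℝ)) (b := 2)).exists_bound_of_continuousOn c2.continuous.continuousOn
  have p1 : 0 ≤ C1 := (norm_nonneg _).trans (h1 0 (by simp))
  have p2 : 0 ≤ C2 := (norm_nonneg _).trans (h2 0 (by simp))
  refine ⟨4 * (C1 + C2) + 1, by positivity, fun x hx => ?_⟩
  rcases le_or_gt x 2 with h | h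
  · have a := h1 x ⟨hx, h⟩
    have b := h2 x ⟨hx, h⟩
    rw [rna] at a b
    rw [abs_mul, abs_mul, abs_pow, aon hx]
    refine ⟨by linarith, by linarith, ?_, ?_⟩
    · nlinarith [abs_nonneg (deriv zt x)]
    · have : x ^ 2 ≤ 4 := by nlinarith
      nlinarith [abs_nonneg (deriv (deriv zt) x)]
  · rw [z1 x h, z2 x h]; simp; positivity
theorem jj_hd (v : V3) : HasFDerivAt jj (2 • innerSL ℝ v) v := by
  unfold jj; simpa using (hasStrictFDerivAt_norm_sq v).hasFDerivAt.const_add 1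
theorem jj_cd : CDI jj := by unfold jj; exact contDiff_const.add (contDiff_norm_sq ℝ)
theorem pd_rad {P P' : ℝ → ℝ} (h : ∀ y, HasDerivAt P (P' y) y) (i : Fin 3) (v : V3) :
    pd i (fun v => P (jj v)) v = P' (jj v) * (2 * v i) := by
  have := (h (jj v)).comp_hasFDerivAt v (jj_hd v)
  unfold pd
  rw [HasFDerivAt.fderiv (f := fun v => P (jj v)) this]
  simp [EuclideanSpace.inner_single_right, two_mul]
  try ring
theorem pd_lin (i j : Fin 3) (v : V3) : pd j (fun v : V3 => 2 * v i) v = if i = j then 2 else 0 := by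
  have : HasFDerivAt (fun v : V3 => 2 * v i) ((2:ℝ) • (EuclideanSpace.proj i : V3 →L[ℝ] ℝ)) v :=
    ((2:ℝ) • (EuclideanSpace.proj i : V3 →L[ℝ] ℝ)).hasFDerivAt
  unfold pd; rw [this.fderiv]; simp
theorem vv_le (v : V3) (i j : Fin 3) : |v i * v j| ≤ jj v := by
  rw [abs_mul]; unfold jj; nlinarith [abs_coord_le v i, abs_coord_le v j, abs_nonneg (v i), abs_nonneg (v j), norm_nonneg v]
theorem pd2_rad {P P' P'' : ℝ → ℝ} (h : ∀ y, HasDerivAt P (P' y) y) (h' : ∀ y, HasDerivAt P' (P'' y) y) (i j : Fin 3) (v : V3) :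
    |pd j (pd i (fun v => P (jj v))) v| ≤ 4 * (jj v * |P'' (jj v)|) + 2 * |P' (jj v)| := by
  have e : pd i (fun v => P (jj v)) = fun v => P' (jj v) * (2 * v i) := funext fun v => pd_rad h i v
  rw [e, pd_mul (f := fun v => P' (jj v)) (h := fun v : V3 => 2 * v i)
    ((h' _).differentiableAt.comp v (jj_hd v).differentiableAt) (by fun_prop), pd_rad h', pd_lin]
  have a := vv_le v i j
  refine (abs_add_le _ _).trans ?_
  rw [abs_mul (P' _)]
  have b : |(if i = j then (2:ℝ) else 0)| ≤ 2 := by split_ifs <;> simp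
  have c := abs_nonneg (P' (jj v))
  have : |2 * v i * (P'' (jj v) * (2 * v j))| = 4 * (|v i * v j| * |P'' (jj v)|) := by
    rw [show 2 * v i * (P'' (jj v) * (2 * v j)) = 4 * ((v i * v j) * P'' (jj v)) by ring, abs_mul, abs_mul]; simp
  rw [this]
  have := mlr a (abs_nonneg (P'' (jj v)))
  nlinarith
def ps (J : ℕ) (R : ℝ) (v : V3) : ℝ := jj v ^ J * zt (jj v / R)
theorem ps_cd (J : ℕ) (R : ℝ) : CDI (ps J R) :=
  (jj_cd.pow J).mul (zt_cd.comp (jj_cd.div_const R))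
theorem ps_cs (J : ℕ) {R : ℝ} (hR : 0 < R) : HasCompactSupport (ps J R) := by
  refine HasCompactSupport.intro (ict (0:V3) (2 * R + 1)) fun v hv => ?_
  have h : 2 * R + 1 < ‖v‖ := by simpa using hv
  unfold ps; rw [zt_zero, mul_zero]
  rw [le_div_iff₀ hR]; unfold jj; nlinarith
theorem ps_nn (J : ℕ) (R : ℝ) (v : V3) : 0 ≤ ps J R v := mul_nonneg (pow_nonneg (jj_pos v).le J) (zt_nn _)
theorem ps_le (J : ℕ) (R : ℝ) (v : V3) : ps J R v ≤ jj v ^ J :=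
  mul_le_of_le_one_right (pow_nonneg (jj_pos v).le J) (zt_le _)
theorem zt_hd (x : ℝ) : HasDerivAt zt (deriv zt x) x := (zt_cd.differentiable (by simp) x).hasDerivAt
theorem zt_hd2 (x : ℝ) : HasDerivAt (deriv zt) (deriv (deriv zt) x) x :=
  ((contDiff_infty_iff_deriv.1 zt_cd).2.differentiable (by simp) x).hasDerivAt
theorem zt_R (R y : ℝ) : HasDerivAt (fun y => zt (y / R)) (deriv zt (y / R) * (1 / R)) y :=
  HasDerivAt.comp (h₂ := zt) (h := fun y => y / R) y (zt_hd (y / R)) ((hasDerivAt_id' y).div_const R)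
theorem zt_R2 (R y : ℝ) : HasDerivAt (fun y => deriv zt (y / R)) (deriv (deriv zt) (y / R) * (1 / R)) y :=
  HasDerivAt.comp (h₂ := deriv zt) (h := fun y => y / R) y (zt_hd2 (y / R)) ((hasDerivAt_id' y).div_const R)
theorem ps_d2 (k : ℕ) : ∃ D : ℝ, 0 < D ∧ ∀ R : ℝ, 1 ≤ R → ∀ i j v, |pd j (pd i (ps (k + 1) R)) v| ≤ D * jj v ^ k := by
  obtain ⟨C, C0, hC⟩ := zt_d
  set K : ℝ := (k : ℝ)
  have K0 : 0 ≤ K := Nat.cast_nonneg k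
  refine ⟨4 * ((K + 1) * K + 2 * (K + 1) * C + C) + 2 * ((K + 1) + C), by positivity, fun R hR i j v => ?_⟩
  have R0 : 0 < R := by linarith
  have h1 : ∀ y, HasDerivAt (fun y => y ^ (k + 1) * zt (y / R))
      ((K + 1) * y ^ k * zt (y / R) + y ^ (k + 1) * (deriv zt (y / R) * (1 / R))) y := fun y => by
    have := (hasDerivAt_pow (k + 1) y).fun_mul (zt_R R y)
    simpa [K] using this
  have h2 : ∀ y, HasDerivAt (fun y => (K + 1) * y ^ k * zt (y / R) + y ^ (k + 1) * (deriv zt (y / R) * (1 / R)))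
      (((K + 1) * (K * y ^ (k - 1)) * zt (y / R) + (K + 1) * y ^ k * (deriv zt (y / R) * (1 / R))) +
        ((K + 1) * y ^ k * (deriv zt (y / R) * (1 / R)) + y ^ (k + 1) * (deriv (deriv zt) (y / R) * (1 / R) * (1 / R)))) y := fun y => by
    have a := ((hasDerivAt_pow k y).const_mul (K + 1)).fun_mul (zt_R R y)
    have b := (hasDerivAt_pow (k + 1) y).fun_mul ((zt_R2 R y).mul_const (1 / R))
    simpa [K] using a.fun_add b
  refine (pd2_rad h1 h2 i j v).trans ?_
  set y := jj v
  have y1 : 1 ≤ y := jj_one v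
  have y0 : 0 < y := by linarith
  obtain ⟨-, -, b1, b2⟩ := hC (y / R) (by positivity)
  set x := y / R with hx
  have z0 := zt_nn x
  have z1 := zt_le x
  have q1 : (K + 1) * y ^ k * zt x + y ^ (k + 1) * (deriv zt x * (1 / R)) = y ^ k * ((K + 1) * zt x + x * deriv zt x) := by
    rw [hx, pow_succ]; field_simp
  have q2 : y * |((K + 1) * (K * y ^ (k - 1)) * zt x + (K + 1) * y ^ k * (deriv zt x * (1 / R))) +
        ((K + 1) * y ^ k * (deriv zt x * (1 / R)) + y ^ (k + 1) * (deriv (deriv zt) x * (1 / R) * (1 / R)))| =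
      y ^ k * |(K + 1) * K * zt x + 2 * (K + 1) * (x * deriv zt x) + x ^ 2 * deriv (deriv zt) x| := by
    rw [← aop y0, ← abs_mul, aop y0, ← aop (pow_pos y0 k), ← abs_mul, aop (pow_pos y0 k)]
    congr 1
    have : K * y ^ (k - 1) * y = K * y ^ k := by
      rcases Nat.eq_zero_or_pos k with h | h
      · simp [K, h]
      · rw [mul_assoc, ← pow_succ, Nat.sub_add_cancel h]
    have e : y * (1 / R) = x := by rw [hx]; ring
    have e' : y ^ 2 * ((1 / R) * (1 / R)) = x ^ 2 := by rw [← e]; ring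
    rw [pow_succ]
    linear_combination (K + 1) * zt x * this + 2 * (K + 1) * y ^ k * deriv zt x * e + y ^ k * deriv (deriv zt) x * e'
  rw [q2, q1, abs_mul, aop (pow_pos y0 k)]
  have i1 : |(K + 1) * zt x + x * deriv zt x| ≤ (K + 1) + C := by
    refine (abs_add_le _ _).trans (add_le_add ?_ b1)
    rw [aon (by positivity)]; nlinarith
  have i2 : |(K + 1) * K * zt x + 2 * (K + 1) * (x * deriv zt x) + x ^ 2 * deriv (deriv zt) x| ≤ (K + 1) * K + 2 * (K + 1) * C + C := by
    refine (abs_add_le _ _).trans (add_le_add ((abs_add_le _ _).trans (add_le_add ?_ ?_)) b2)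
    · rw [aon (by positivity)]; exact mul_le_of_le_one_right (by positivity) z1
    · rw [abs_mul, aon (by positivity : 0 ≤ 2 * (K + 1))]; gcongr
  have := pow_pos y0 k
  calc _ ≤ 4 * (y ^ k * ((K + 1) * K + 2 * (K + 1) * C + C)) + 2 * (y ^ k * ((K + 1) + C)) := by gcongr
    _ = _ := by ring
theorem ps0_d : ∃ D : ℝ, 0 < D ∧ ∀ R : ℝ, 1 ≤ R → ∀ i j v, |pd j (pd i (ps 0 R)) v| ≤ D / R ∧ |pd i (ps 0 R) v| ^ 2 ≤ D / R := by
  obtain ⟨C, C0, hC⟩ := zt_d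
  refine ⟨6 * C + 4 * C ^ 2, by positivity, fun R hR i j v => ?_⟩
  have R0 : 0 < R := by linarith
  have h1 : ∀ y, HasDerivAt (fun y => y ^ 0 * zt (y / R)) (deriv zt (y / R) * (1 / R)) y := fun y => by
    simp only [pow_zero, one_mul]
    exact zt_R R y
  have h2 : ∀ y, HasDerivAt (fun y => deriv zt (y / R) * (1 / R)) (deriv (deriv zt) (y / R) * (1 / R) * (1 / R)) y := fun y =>
    (zt_R2 R y).mul_const (1 / R)
  set y := jj v with hy
  have y1 : 1 ≤ y := jj_one v
  have y0 : 0 < y := by linarith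
  have iR : 0 < 1 / R := by positivity
  have hy' : y = y / R * R := by field_simp
  obtain ⟨a1, a2, b1, b2⟩ := hC (y / R) (by positivity)
  have zz : |(y / R) * deriv (deriv zt) (y / R)| ≤ C := by
    rcases le_total (y / R) 1 with h | h
    · rw [abs_mul, aop (by positivity : 0 < y / R)]; nlinarith [abs_nonneg (deriv (deriv zt) (y / R))]
    · refine le_trans ?_ b2
      rw [abs_mul, abs_mul]; refine mlr ?_ (abs_nonneg _)
      rw [aop (by positivity : 0 < y / R), aop (by positivity : 0 < (y / R) ^ 2)]; nlinarith
  constructor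
  · refine (pd2_rad h1 h2 i j v).trans ?_
    rw [← hy]
    have e : y * |deriv (deriv zt) (y / R) * (1 / R) * (1 / R)| = |(y / R) * deriv (deriv zt) (y / R)| * (1 / R) := by
      simp only [abs_mul, aop iR, aop (by positivity : 0 < y / R)]; ring
    rw [e, abs_mul (deriv zt (y / R)), aop iR]
    calc _ ≤ 4 * (C * (1 / R)) + 2 * (C * (1 / R)) := by gcongr
      _ ≤ _ := by rw [div_eq_mul_one_div (_ + _) R]; nlinarith [sq_nonneg C]
  · have e : pd i (ps 0 R) v = deriv zt (y / R) * (1 / R) * (2 * v i) := pd_rad h1 i v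
    rw [e]
    have vi : |v i| ^ 2 ≤ y := by have := vv_le v i i; rwa [abs_mul, ← sq] at this
    have : |deriv zt (y / R) * (1 / R) * (2 * v i)| ^ 2 = 4 * (|deriv zt (y / R)| ^ 2 * (1 / R) ^ 2 * |v i| ^ 2) := by
      simp only [abs_mul, aop iR, abs_two]; ring
    rw [this]
    calc _ ≤ 4 * (|deriv zt (y / R)| ^ 2 * (1 / R) ^ 2 * y) := by gcongr
      _ = 4 * (|deriv zt (y / R)| * |y / R * deriv zt (y / R)|) * (1 / R) := by
        rw [abs_mul, aop (by positivity : 0 < y / R)]; ring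
      _ ≤ 4 * (C * C) * (1 / R) := by gcongr
      _ ≤ _ := by rw [div_eq_mul_one_div (_ + _) R]; nlinarith [mul_pos C0 iR]
theorem zt_lim {y : ℝ} : ∀ᶠ n : ℕ in atTop, zt (y / (n + 1)) = 1 := by
  filter_upwards [eventually_ge_atTop ⌈y⌉₊] with n hn
  apply zt_one
  rw [div_le_one (by positivity)]
  linarith [Nat.le_ceil y, (Nat.cast_le (α := ℝ)).2 hn]
theorem ps_mono {f : FV} (hf : Continuous f) (f0 : ∀ v, 0 ≤ f v) (J : ℕ) {c : ℝ}
    (h : ∀ R : ℝ, 1 ≤ R → ∫ v, f v * ps J R v ≤ c) : (Integrable fun v => jj v ^ J * f v) ∧ ∫ v, jj v ^ J * f v ≤ c := by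
  have c0 : 0 ≤ c := (integral_nonneg fun v => mul_nonneg (f0 v) (ps_nn J 1 v)).trans (h 1 le_rfl)
  have nn : ∀ v, 0 ≤ jj v ^ J * f v := fun v => mul_nonneg (pow_nonneg (jj_pos v).le J) (f0 v)
  have ct : Continuous fun v => jj v ^ J * f v := (jj_cont.pow J).mul hf
  have key : ∫⁻ v, eor (jj v ^ J * f v) ≤ eor c := by
    have lim : ∀ v, eor (jj v ^ J * f v) = liminf (fun n : ℕ => eor (f v * ps J (n + 1) v)) atTop := fun v => by
      refine (Tendsto.liminf_eq (tendsto_const_nhds.congr' ?_)).symm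
      filter_upwards [zt_lim (y := jj v)] with n hn
      simp only [ps, hn, mul_one]; rw [mul_comm]
    simp_rw [lim]
    refine (lintegral_liminf_le fun n => ?_).trans ?_
    · exact (hf.mul (ps_cd J (n + 1)).continuous).measurable.ennreal_ofReal
    · refine liminf_le_of_le (by isBoundedDefault) fun b hb => ?_
      obtain ⟨n, hn⟩ := hb.exists
      refine hn.trans ?_
      rw [← oil]
      · exact eoo (h _ (by linarith [(Nat.cast_nonneg n : (0:ℝ) ≤ n)]))
      · exact (hf.mul (ps_cd J _).continuous).integrable_of_hasCompactSupport ((ps_cs J (by positivity)).mul_left)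
      · exact eof fun v => mul_nonneg (f0 v) (ps_nn _ _ v)
  have ii : Integrable fun v => jj v ^ J * f v := by
    refine ⟨ct.aestronglyMeasurable, ?_⟩
    rw [hasFiniteIntegral_iff_ofReal (eof nn)]
    exact key.trans_lt ENNReal.ofReal_lt_top
  refine ⟨ii, ?_⟩
  rw [← oil ii (eof nn)] at key
  exact (ENNReal.ofReal_le_ofReal_iff c0).1 key
theorem Sol.cont {T : ℝ} {g : ℝ → FV} (h : Sol T g) {t : ℝ} (ht : t ∈ Ioo 0 T) : Continuous (g t) := by
  have := ll_slice (G := fun τ => g (clp (t / 2) ((t + T) / 2) τ)) (h.solG (a := t / 2) (b := (t + T) / 2) (by linarith [ht.1]) (by linarith [ht.1, ht.2])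
    (by linarith [ht.2])).ll t
  have e := clp_eq (a := t / 2) (b := (t + T) / 2) (t := t) ⟨by linarith [ht.1], by linarith [ht.2]⟩
  simp only [e] at this
  exact this.continuous
theorem moments (J : ℕ) (M Sb : ℝ) : ∃ C : ℝ, 0 < C ∧ ∀ T g gi S, Hyp T g gi S → (∫ t in Ioo 0 T, S t) ≤ Sb → (∀ v, 0 ≤ gi v) →
    (Integrable fun v => jj v ^ J * gi v) → (∫ v, jj v ^ J * gi v) ≤ M →
    ∀ᵐ t ∂volume.restrict (Ioo 0 T), (Integrable fun v => jj v ^ J * g t v) ∧ ∫ v, jj v ^ J * g t v ≤ C := by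
  have low : ∀ (gi : FV) (a b : ℕ), a ≤ b → (∀ v, 0 ≤ gi v) → (Integrable fun v => jj v ^ b * gi v) →
      (Integrable fun v => jj v ^ a * gi v) ∧ (∫ v, jj v ^ a * gi v) ≤ ∫ v, jj v ^ b * gi v := fun gi a b hab h0 hi => by
    have le : ∀ v, jj v ^ a * gi v ≤ jj v ^ b * gi v := fun v => mlr (pow_le_pow_right₀ (jj_one v) hab) (h0 v)
    have e : (fun v => jj v ^ a * gi v) = fun v => (jj v ^ (b - a))⁻¹ * (jj v ^ b * gi v) := by
      ext v; rw [← mul_assoc]; congr 1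
      have := pow_pos (jj_pos v) (b - a)
      rw [eq_inv_mul_iff_mul_eq₀ this.ne', ← pow_add, Nat.sub_add_cancel hab]
    have i1 : Integrable fun v => jj v ^ a * gi v := by
      refine hi.mono' ?_ (eof fun v => ?_)
      · rw [e]
        refine AEStronglyMeasurable.mul ?_ hi.1
        exact Continuous.aestronglyMeasurable ((jj_cont.pow _).inv₀ fun v => (pow_pos (jj_pos v) _).ne')
      · rw [rnn (mul_nonneg (pow_nonneg (jj_pos v).le a) (h0 v))]; exact le v
    exact ⟨i1, integral_mono i1 hi le⟩
  induction J with
  | zero =>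
    refine ⟨1, one_pos, fun T g gi S h hSb g0 hi hm => ?_⟩
    filter_upwards [h.mass] with τ hτ; simpa using ⟨hτ.1, hτ.2.le⟩
  | succ k ih =>
    obtain ⟨Ck, Ck0, hk⟩ := ih
    obtain ⟨D, D0, hD⟩ := ps_d2 k
    refine ⟨|M| + 27 * D * Ck * |Sb| + 1, by positivity, fun T g gi S h hSb g0 hi hm => ?_⟩
    obtain ⟨l1, l2⟩ := low gi k (k + 1) (by omega) g0 hi
    have ihk := hk T g gi S h hSb g0 l1 (l2.trans hm)
    filter_upwards [ard measurableSet_Ioo] with t ht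
    refine ps_mono (h.toSol.cont ht) (h.nn t) (k + 1) fun R hR => ?_
    have l := h.lin (ps_cd (k + 1) R) (ps_cs (k + 1) (by linarith)) (hD R hR) ihk ht.1 ht.2
    have a : ∫ v, gi v * ps (k + 1) R v ≤ M := by
      refine le_trans (integral_mono_of_nonneg (eof fun v => mul_nonneg (g0 v) (ps_nn _ _ _)) hi (eof fun v => ?_)) hm
      simp only; rw [mul_comm]; exact mlr (ps_le (k + 1) R v) (g0 v)
    have b : ∫ τ in Ioo 0 t, S τ ≤ |Sb| :=
      (setIntegral_mono_set h.Si (eof h.S0) (LE.le.eventuallyLE (Ioo_subset_Ioo le_rfl ht.2.le))).trans (hSb.trans (le_abs_self _))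
    have c := mll b (by positivity : 0 ≤ 27 * D * Ck)
    have := (abs_le.1 l).2
    linarith [le_abs_self M]
def slab (R δ c : ℝ) (e : V3) : Set V3 := {w | ‖w‖ ≤ R ∧ |inner ℝ e w - c| ≤ δ}
theorem slab_meas (R δ c : ℝ) (e : V3) : MeasurableSet (slab R δ c e) :=
  ((isClosed_le (f := fun w : V3 => ‖w‖) (g := fun _ => R) (by fun_prop) (by fun_prop)).inter
    (isClosed_le (f := fun w : V3 => |inner ℝ e w - c|) (g := fun _ => δ) (by fun_prop) (by fun_prop))).measurableSet
theorem slab_vol {R ε : ℝ} (hR : 0 < R) (hε : 0 < ε) : ∃ δ : ℝ, 0 < δ ∧ ∀ (e : V3) (c : ℝ), ‖e‖ = 1 →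
    volume.real (slab R δ c e) ≤ ε := by
  obtain ⟨N, hN⟩ := exists_nat_gt (volume.real (closedBall (0:V3) (2 * R)) / ε)
  have N0 : (0:ℝ) < N := lt_of_le_of_lt (by positivity) hN
  refine ⟨R / (3 * N), by positivity, fun e c he => ?_⟩
  set δ := R / (3 * N) with hδ
  have δ0 : 0 < δ := by positivity
  have ee : inner ℝ e e = (1:ℝ) := by rw [real_inner_self_eq_norm_sq, he]; norm_num
  set Tj : Fin N → Set V3 := fun j => (fun w => w - (3 * δ * (j : ℝ)) • e) ⁻¹' slab R δ c e with hT
  have vj : ∀ j, volume.real (Tj j) = volume.real (slab R δ c e) := fun j => by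
    simp only [hT, Measure.real]; simp only [sub_eq_add_neg]; rw [measure_preimage_add_right]
  have mj : ∀ j, MeasurableSet (Tj j) := fun j => (slab_meas R δ c e).preimage (by fun_prop)
  have ip : ∀ (w : V3) (a : ℝ), inner ℝ e (w - a • e) = inner ℝ e w - a := fun w a => by
    rw [inner_sub_right, inner_smul_right, ee, mul_one]
  have dj : Pairwise (Function.onFun Disjoint Tj) := by
    intro i j hij
    rw [Function.onFun, Set.disjoint_left]
    rintro w ⟨-, h1⟩ ⟨-, h2⟩
    simp only [ip] at h1 h2
    have h1 := abs_le.1 h1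
    have h2 := abs_le.1 h2
    rcases lt_or_gt_of_ne (Fin.val_ne_of_ne hij) with h | h
    · have : ((i : ℕ) : ℝ) + 1 ≤ j := by exact_mod_cast h
      nlinarith
    · have : ((j : ℕ) : ℝ) + 1 ≤ i := by exact_mod_cast h
      nlinarith
  have sub : (⋃ j, Tj j) ⊆ closedBall 0 (2 * R) := by
    refine iUnion_subset fun j w hw => ?_
    have h1 : ‖w - (3 * δ * (j : ℝ)) • e‖ ≤ R := hw.1
    have h2 : ‖(3 * δ * (j : ℝ)) • e‖ ≤ R := by
      rw [norm_smul, he, mul_one, rnn (by positivity)]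
      have : ((j : ℕ) : ℝ) ≤ N := by exact_mod_cast j.2.le
      calc _ ≤ 3 * δ * N := by gcongr
        _ = R := by rw [hδ]; field_simp
    have := norm_le_norm_sub_add w ((3 * δ * (j : ℝ)) • e)
    simp; linarith
  have : N * volume.real (slab R δ c e) ≤ volume.real (closedBall (0:V3) (2 * R)) := by
    calc _ = ∑ j : Fin N, volume.real (Tj j) := by simp [vj]
      _ = volume.real (⋃ j, Tj j) := by
        rw [measureReal_iUnion_fintype dj mj fun j => ?_]
        exact ((measure_mono ((subset_iUnion Tj j).trans sub)).trans_lt measure_closedBall_lt_top).ne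
      _ ≤ _ := measureReal_mono sub measure_closedBall_lt_top.ne
  rw [div_lt_iff₀ hε] at hN
  nlinarith
def cu : FV := ps 0 8
theorem cu_nn (v : V3) : 0 ≤ cu v := ps_nn _ _ _
theorem cu_le (v : V3) : cu v ≤ 1 := (ps_le 0 8 v).trans (by simp)
theorem cu_cd : CDI cu := ps_cd _ _
theorem cu_cs : HasCompactSupport cu := ps_cs 0 (by norm_num)
theorem cu_zero {v : V3} (h : 4 < ‖v‖) : cu v = 0 := by
  unfold cu ps; rw [zt_zero, mul_zero]
  rw [le_div_iff₀ (by norm_num)]; unfold jj; nlinarith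
theorem cu_one (v : V3) : 1 - jj v / 8 ≤ cu v := by
  rcases le_or_gt (jj v) 8 with h | h
  · unfold cu ps; rw [zt_one (by linarith)]; simp; linarith [jj_pos v]
  · linarith [cu_nn v]
theorem cu_int {f : FV} (hf : Integrable f) {ψ : FV} (hψ : Continuous ψ) : Integrable fun w => f w * (cu w * ψ w) := by
  have c : Continuous fun w => cu w * ψ w := cu_cd.continuous.mul hψ
  obtain ⟨C, hC⟩ := (cu_cs.mul_right (f' := ψ)).exists_bound_of_continuous c
  exact hf.mul_bdd (c := C) c.aestronglyMeasurable (eof hC)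
theorem nonconc (L : ℝ) : ∃ κ : ℝ, 0 < κ ∧ ∀ f : FV, (∀ v, 0 ≤ f v) → Integrable f → (Integrable fun v => f v * |Real.log (f v)|) →
    (∫ v, f v * |Real.log (f v)|) ≤ L → 1 / 4 ≤ ∫ v, f v * cu v → ∀ (e : V3) (c : ℝ), ‖e‖ = 1 →
    κ ≤ ∫ w, f w * (cu w * (inner ℝ e w - c) ^ 2) := by
  set K : ℝ := Real.exp (16 * (|L| + 1)) with hK
  have K0 : 0 < K := Real.exp_pos _
  have lK : Real.log K = 16 * (|L| + 1) := Real.log_exp _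
  have lK0 : 0 < Real.log K := by rw [lK]; positivity
  obtain ⟨δ, δ0, hδ⟩ := slab_vol (R := 4) (ε := 1 / (16 * K)) (by norm_num) (by positivity)
  refine ⟨δ ^ 2 / 8, by positivity, fun f f0 hf hl hL hc e c he => ?_⟩
  have i1 : Integrable fun w => f w * (cu w * (inner ℝ e w - c) ^ 2) := cu_int hf (by fun_prop)
  have i0 : Integrable fun w => f w * cu w := by simpa using cu_int hf (ψ := fun _ => 1) continuous_const
  have fin : volume (slab 4 δ c e) ≠ ⊤ :=
    ((measure_mono (fun w hw => by simpa using hw.1 : slab 4 δ c e ⊆ closedBall 0 4)).trans_lt measure_closedBall_lt_top).ne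
  have i2 : Integrable ((slab 4 δ c e).indicator fun _ => K) :=
    (integrable_indicator_iff (slab_meas _ _ _ _)).2 (integrableOn_const fin)
  have pt : ∀ w, f w * cu w ≤ (δ ^ 2)⁻¹ * (f w * (cu w * (inner ℝ e w - c) ^ 2)) +
      ((Real.log K)⁻¹ * (f w * |Real.log (f w)|) + (slab 4 δ c e).indicator (fun _ => K) w) := fun w => by
    have a1 := f0 w
    have a2 := cu_nn w
    have a3 := cu_le w
    by_cases hw : w ∈ slab 4 δ c e
    · rw [indicator_of_mem hw]
      have : f w * cu w ≤ (Real.log K)⁻¹ * (f w * |Real.log (f w)|) + K := by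
        refine (mul_le_of_le_one_right a1 a3).trans ?_
        rcases le_or_gt (f w) K with h | h
        · have : 0 ≤ (Real.log K)⁻¹ * (f w * |Real.log (f w)|) := by positivity
          linarith
        · have : Real.log K ≤ |Real.log (f w)| := (Real.log_le_log K0 h.le).trans (le_abs_self _)
          have : f w ≤ (Real.log K)⁻¹ * (f w * |Real.log (f w)|) := by
            rw [le_inv_mul_iff₀ lK0, mul_comm]; gcongr
          linarith
      have : 0 ≤ (δ ^ 2)⁻¹ * (f w * (cu w * (inner ℝ e w - c) ^ 2)) := by positivity
      linarith
    · rw [indicator_of_notMem hw]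
      have b : 0 ≤ (Real.log K)⁻¹ * (f w * |Real.log (f w)|) := by positivity
      rcases le_or_gt ‖w‖ 4 with h | h
      · have : δ < |inner ℝ e w - c| := by
          by_contra! h'; exact hw ⟨h, h'⟩
        have : δ ^ 2 ≤ (inner ℝ e w - c) ^ 2 := by rw [← sq_abs (inner ℝ e w - c)]; gcongr
        have : f w * cu w ≤ (δ ^ 2)⁻¹ * (f w * (cu w * (inner ℝ e w - c) ^ 2)) := by
          rw [le_inv_mul_iff₀ (by positivity)]
          nlinarith [mul_nonneg a1 a2]
        linarith
      · rw [cu_zero h]; simp; linarith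
  have I := integral_mono i0 ((i1.const_mul (δ ^ 2)⁻¹).fun_add ((hl.const_mul (Real.log K)⁻¹).fun_add i2)) pt
  rw [integral_add (i1.const_mul _) ((hl.const_mul (Real.log K)⁻¹).fun_add i2), integral_add (hl.const_mul _) i2, icm,
    icm, integral_indicator (slab_meas _ _ _ _), setIntegral_const, smul_eq_mul] at I
  have v1 := mlr (hδ e c he) K0.le
  have v2 : 1 / (16 * K) * K = 1 / 16 := by field_simp
  have v3 : (Real.log K)⁻¹ * ∫ v, f v * |Real.log (f v)| ≤ 1 / 16 := by
    rw [inv_mul_le_iff₀ lK0, lK]; linarith [le_abs_self L]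
  set X := ∫ w, f w * (cu w * (inner ℝ e w - c) ^ 2)
  have : 1 / 8 ≤ (δ ^ 2)⁻¹ * X := by linarith
  rw [le_inv_mul_iff₀ (by positivity)] at this
  linarith
theorem jap_sq (v : V3) : jap v ^ 2 = jj v := by
  unfold jap; rw [Real.sq_sqrt (by positivity)]; rfl
theorem jap_one (v : V3) : 1 ≤ jap v := by
  unfold jap; rw [Real.one_le_sqrt]; nlinarith [sq_nonneg ‖v‖]
theorem jap_pos (v : V3) : 0 < jap v := by linarith [jap_one v]
theorem nrm_le_jap (v : V3) : ‖v‖ ≤ jap v := by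
  unfold jap; exact Real.le_sqrt_of_sq_le (by linarith)
def wt (v : V3) : ℝ := (jap v)⁻¹ ^ 3
theorem wt_pos (v : V3) : 0 < wt v := by have := jap_pos v; unfold wt; positivity
theorem ex_perp (ξ : V3) : ∃ e : V3, ‖e‖ = 1 ∧ inner ℝ e ξ = (0:ℝ) := by
  have : 0 < Module.finrank ℝ (ℝ ∙ ξ)ᗮ := by
    have h1 := Submodule.finrank_add_finrank_orthogonal (ℝ ∙ ξ)
    have h2 : Module.finrank ℝ (ℝ ∙ ξ) ≤ 1 := by simpa using finrank_span_le_card (R := ℝ) ({ξ} : Set V3)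
    have h3 : Module.finrank ℝ V3 = 3 := by simp
    omega
  have := Module.finrank_pos_iff.1 this
  obtain ⟨⟨x, hx⟩, h0⟩ := exists_ne (0 : (ℝ ∙ ξ)ᗮ)
  have hx0 : x ≠ 0 := fun h => h0 (by simp [h])
  rw [Submodule.mem_orthogonal_singleton_iff_inner_left] at hx
  refine ⟨‖x‖⁻¹ • x, by rw [norm_smul, norm_inv, norm_norm, inv_mul_cancel₀ (norm_ne_zero_iff.2 hx0)], ?_⟩
  rw [inner_smul_left, hx, mul_zero]
theorem bessel {e ξ : V3} (he : ‖e‖ = 1) (h : inner ℝ e ξ = (0:ℝ)) (z : V3) :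
    ‖ξ‖ ^ 2 * (inner ℝ e z) ^ 2 ≤ ‖ξ‖ ^ 2 * ‖z‖ ^ 2 - (inner ℝ ξ z) ^ 2 := by
  rcases eq_or_ne ξ 0 with h0 | h0
  · simp [h0]
  have n0 : 0 < ‖ξ‖ ^ 2 := by positivity
  set a := inner ℝ e z with ha
  set b := inner ℝ ξ z with hb
  set y := b • ξ + (‖ξ‖ ^ 2 * a) • e with hy
  have yz : inner ℝ y z = b ^ 2 + ‖ξ‖ ^ 2 * a ^ 2 := by
    rw [hy, inner_add_left, real_inner_smul_left, real_inner_smul_left, ← ha, ← hb]; ring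
  have yy : ‖y‖ ^ 2 = ‖ξ‖ ^ 2 * (b ^ 2 + ‖ξ‖ ^ 2 * a ^ 2) := by
    rw [hy, norm_add_sq_real, norm_smul, norm_smul, real_inner_smul_left, real_inner_smul_right, real_inner_comm, h, he]
    simp only [rna, mul_pow, sq_abs, mul_one]; ring
  have cs : (inner ℝ y z) ^ 2 ≤ ‖y‖ ^ 2 * ‖z‖ ^ 2 := by
    rw [← mul_pow]; exact sq_le_sq' (by linarith [neg_le_of_abs_le (abs_real_inner_le_norm y z)]) (real_inner_le_norm y z)
  rw [yz, yy] at cs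
  set X := b ^ 2 + ‖ξ‖ ^ 2 * a ^ 2 with hX
  have X0 : 0 ≤ X := by positivity
  rcases X0.eq_or_lt with h | h
  · have : 0 ≤ ‖ξ‖ ^ 2 * ‖z‖ ^ 2 := by positivity
    linarith
  · have : X ≤ ‖ξ‖ ^ 2 * ‖z‖ ^ 2 := by
      by_contra! h'; nlinarith
    linarith
theorem inn (x y : V3) : inner ℝ x y = ∑ i, x i * y i := by
  simp [PiLp.inner_apply, mul_comm]
theorem nsq (x : V3) : ‖x‖ ^ 2 = ∑ i, x i ^ 2 := by rw [EuclideanSpace.real_norm_sq_eq]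
def cell : ℝ := (8 * π)⁻¹ * 5⁻¹ ^ 3
theorem cell_pos : 0 < cell := by unfold cell; positivity
theorem elliptic {f : FV} (hf : Nice f) {κ : ℝ} (hκ : ∀ (e : V3) (c : ℝ), ‖e‖ = 1 → κ ≤ ∫ w, f w * (cu w * (inner ℝ e w - c) ^ 2))
    (v : V3) (x : Fin 3 → ℝ) : cell * κ * (wt v * ∑ i, x i ^ 2) ≤ ∑ i, ∑ j, coeffA f v i j * x i * x j := by
  set ξ : V3 := WithLp.toLp 2 x with hξ
  obtain ⟨e, he, hp⟩ := ex_perp ξ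
  have sl : ∀ i j, Integrable fun w => projPi (v - w) i j / ‖v - w‖ * f w := fun i j => cv_sl hf (proj_meas i j) (proj_b2 i j) v
  have e1 : ∑ i, ∑ j, coeffA f v i j * x i * x j = (8 * π)⁻¹ * ∫ w, ∑ i, ∑ j, (projPi (v - w) i j / ‖v - w‖ * f w) * (x i * x j) := by
    rw [integral_finsetSum _ fun i _ => integrable_finsetSum _ fun j _ => (sl i j).mul_const _, Finset.mul_sum]
    refine Finset.sum_congr rfl fun i _ => ?_
    rw [integral_finsetSum _ fun j _ => (sl i j).mul_const _, Finset.mul_sum]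
    refine Finset.sum_congr rfl fun j _ => ?_
    rw [integral_mul_const, coeffA]; ring
  have n2 : ∑ i, x i ^ 2 = ‖ξ‖ ^ 2 := by rw [nsq]
  have pt : ∀ w, (5⁻¹ ^ 3 * wt v * ‖ξ‖ ^ 2) * (f w * (cu w * (inner ℝ e w - inner ℝ e v) ^ 2)) ≤
      ∑ i, ∑ j, (projPi (v - w) i j / ‖v - w‖ * f w) * (x i * x j) := fun w => by
    set z := v - w with hz
    have hj := jap_pos v
    have fw := hf.nn w
    have ez : (inner ℝ e w - inner ℝ e v) ^ 2 = (inner ℝ e z) ^ 2 := by rw [hz, inner_sub_right]; ring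
    have B := bessel he hp z
    rw [ez]
    rcases eq_or_ne z 0 with h0 | h0
    · simp [h0]
    have z0 : 0 < ‖z‖ := norm_pos_iff.2 h0
    have q : ∑ i, ∑ j, (projPi z i j / ‖z‖ * f w) * (x i * x j) = (‖ξ‖ ^ 2 * ‖z‖ ^ 2 - (inner ℝ ξ z) ^ 2) * ‖z‖⁻¹ ^ 3 * f w := by
      have : (‖ξ‖ ^ 2 * ‖z‖ ^ 2 - (inner ℝ ξ z) ^ 2) * ‖z‖⁻¹ ^ 3 * f w = (‖ξ‖ ^ 2 - (inner ℝ ξ z) ^ 2 / ‖z‖ ^ 2) / ‖z‖ * f w := by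
        field_simp
      rw [this, ← n2, inn]
      simp only [projPi, su3]
      simp [hξ]
      ring
    rw [q]
    rcases le_or_gt ‖w‖ 4 with h | h
    · have zl : ‖z‖ ≤ 5 * jap v := by
        have := norm_sub_le v w; linarith [nrm_le_jap v, jap_one v]
      have il : (5:ℝ)⁻¹ ^ 3 * wt v ≤ ‖z‖⁻¹ ^ 3 := by
        unfold wt; rw [← mul_pow, ← mul_inv]; gcongr
      calc _ = (5⁻¹ ^ 3 * wt v) * (‖ξ‖ ^ 2 * (inner ℝ e z) ^ 2) * f w * cu w := by ring
        _ ≤ (5⁻¹ ^ 3 * wt v) * (‖ξ‖ ^ 2 * (inner ℝ e z) ^ 2) * f w * 1 := by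
          have := wt_pos v; gcongr; exact cu_le w
        _ ≤ ‖z‖⁻¹ ^ 3 * (‖ξ‖ ^ 2 * ‖z‖ ^ 2 - (inner ℝ ξ z) ^ 2) * f w * 1 := by gcongr
        _ = _ := by ring
    · rw [cu_zero h]
      simp only [zero_mul, mul_zero]
      have : 0 ≤ ‖ξ‖ ^ 2 * ‖z‖ ^ 2 - (inner ℝ ξ z) ^ 2 := le_trans (by positivity) B
      positivity
  have I := integral_mono ((cu_int hf.int (by fun_prop : Continuous fun w : V3 => (inner ℝ e w - inner ℝ e v) ^ 2)).const_mul _)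
    (integrable_finsetSum _ fun i _ => integrable_finsetSum _ fun j _ => (sl i j).mul_const _) pt
  rw [icm] at I
  rw [e1, n2]
  have := wt_pos v
  calc _ = (8 * π)⁻¹ * ((5⁻¹ ^ 3 * wt v * ‖ξ‖ ^ 2) * κ) := by unfold cell; ring
    _ ≤ _ := by
      gcongr
      exact le_trans (by gcongr; exact hκ e _ he) I
theorem lin0 {ψ : FV} (hψ : CDI ψ) (hc : HasCompactSupport ψ) : ∃ D : ℝ, 0 < D ∧
    ∀ T g gi S, Hyp T g gi S → ∀ t ∈ Ioo 0 T, |(∫ v, g t v * ψ v) - ∫ v, gi v * ψ v| ≤ D * ∫ τ in Ioo 0 t, S τ := by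
  have ex : ∀ i j, ∃ C, ∀ u, |pd j (pd i ψ) u| ≤ C := fun i j =>
    (cs_pd (cs_pd hc i) j).exists_bound_of_continuous (cd_pd (cd_pd hψ i) j).continuous
  choose C hC using ex
  have C0 : ∀ i j, 0 ≤ C i j := fun i j => (abs_nonneg _).trans (hC i j 0)
  set D := ∑ i, ∑ j, C i j with hD
  have D0 : 0 ≤ D := Finset.sum_nonneg fun i _ => Finset.sum_nonneg fun j _ => C0 i j
  refine ⟨27 * D + 1, by positivity, fun T g gi S h t ht => ?_⟩
  have l := h.lin hψ hc (k := 0) (D := D) (Mk := 1) (fun i j u => by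
    simp only [pow_zero, mul_one]
    refine (hC i j u).trans ?_
    refine (Finset.single_le_sum (f := fun j => C i j) (fun j _ => C0 i j) (Finset.mem_univ j)).trans ?_
    exact Finset.single_le_sum (f := fun i => ∑ j, C i j) (fun i _ => Finset.sum_nonneg fun j _ => C0 i j) (Finset.mem_univ i))
    (by filter_upwards [h.mass] with τ hτ; simpa using ⟨hτ.1, hτ.2.le⟩) ht.1 ht.2
  have : 0 ≤ ∫ τ in Ioo 0 t, S τ := integral_nonneg h.S0
  linarith
def Wf : Option (Fin 3) → FV
  | none, _ => 1
  | some i, w => w i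
theorem Wf_cd (a) : CDI (Wf a) := by
  cases a with
  | none => exact contDiff_const
  | some i => exact (EuclideanSpace.proj i : V3 →L[ℝ] ℝ).contDiff
def Ec (e : V3) (c : ℝ) : Option (Fin 3) → ℝ
  | none => -c
  | some i => e i
theorem quad_exp {f : FV} (hf : Integrable f) (e : V3) (c : ℝ) :
    ∫ w, f w * (cu w * (inner ℝ e w - c) ^ 2) = ∑ a, ∑ b, Ec e c a * Ec e c b * ∫ w, f w * (cu w * (Wf a w * Wf b w)) := by
  have ii : ∀ a b, Integrable fun w => f w * (cu w * (Wf a w * Wf b w)) := fun a b =>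
    cu_int hf ((Wf_cd a).continuous.mul (Wf_cd b).continuous)
  have pt : ∀ w, f w * (cu w * (inner ℝ e w - c) ^ 2) = ∑ a, ∑ b, Ec e c a * Ec e c b * (f w * (cu w * (Wf a w * Wf b w))) := fun w => by
    have : inner ℝ e w - c = ∑ a, Ec e c a * Wf a w := by
      rw [inn, Fintype.sum_option]; simp [Ec, Wf]; ring
    rw [this, sq, Finset.sum_mul_sum, Finset.mul_sum, Finset.mul_sum]
    refine Finset.sum_congr rfl fun a _ => ?_
    rw [Finset.mul_sum, Finset.mul_sum]
    exact Finset.sum_congr rfl fun b _ => by ring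
  simp_rw [pt]
  rw [integral_finsetSum _ fun a _ => integrable_finsetSum _ fun b _ => (ii a b).const_mul _]
  refine Finset.sum_congr rfl fun a _ => ?_
  rw [integral_finsetSum _ fun b _ => (ii a b).const_mul _]
  exact Finset.sum_congr rfl fun b _ => icm _ _
theorem quad_wc : ∃ D : ℝ, 0 < D ∧ ∀ T g gi S, Hyp T g gi S → Integrable gi → ∀ t ∈ Ioo 0 T, Integrable (g t) →
    ∀ (e : V3) (c : ℝ), ‖e‖ = 1 → |c| ≤ 8 →
    |(∫ w, g t w * (cu w * (inner ℝ e w - c) ^ 2)) - ∫ w, gi w * (cu w * (inner ℝ e w - c) ^ 2)| ≤ D * ∫ τ in Ioo 0 t, S τ := by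
  choose D D0 hD using fun a b => lin0 (cu_cd.mul ((Wf_cd a).mul (Wf_cd b))) (cu_cs.mul_right (f' := fun w => Wf a w * Wf b w))
  refine ⟨∑ a, ∑ b, 64 * D a b, Finset.sum_pos (fun a _ => Finset.sum_pos (fun b _ => by have := D0 a b; positivity) ⟨none, by simp⟩) ⟨none, by simp⟩,
    fun T g gi S h hgi t ht hg e c he hc => ?_⟩
  rw [quad_exp hg, quad_exp hgi, ← Finset.sum_sub_distrib, Finset.sum_mul]
  have E8 : ∀ a, |Ec e c a| ≤ 8 := fun a => by
    cases a with
    | none => simpa [Ec] using hc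
    | some i => exact (abs_coord_le e i).trans (by rw [he]; norm_num)
  refine (Finset.abs_sum_le_sum_abs _ _).trans (Finset.sum_le_sum fun a _ => ?_)
  rw [← Finset.sum_sub_distrib, Finset.sum_mul]
  refine (Finset.abs_sum_le_sum_abs _ _).trans (Finset.sum_le_sum fun b _ => ?_)
  rw [← mul_sub, abs_mul, abs_mul, mul_assoc 64]
  refine mul_le_mul ?_ (hD a b T g gi S h t ht) (abs_nonneg _) (by norm_num)
  nlinarith [E8 a, E8 b, abs_nonneg (Ec e c a), abs_nonneg (Ec e c b)]
/-! entropy -/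
theorem xlogx_neg {x y : ℝ} (hx : 0 ≤ x) (hy : 1 ≤ y) : -(x * Real.log x) ≤ 4 * (y * x) + 2 * (y⁻¹) ^ 2 := by
  have y0 : 0 < y := by linarith
  rcases hx.eq_or_lt with h | h
  · rw [← h]; simp; positivity
  rcases le_or_gt (y⁻¹ ^ 4) x with h1 | h1
  · have : Real.log (y⁻¹ ^ 4) ≤ Real.log x := Real.log_le_log (by positivity) h1
    rw [Real.log_pow, Real.log_inv] at this
    have l := Real.log_le_sub_one_of_pos y0
    push_cast at this
    have : -Real.log x ≤ 4 * y := by linarith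
    have : 0 ≤ 2 * (y⁻¹) ^ 2 := by positivity
    nlinarith
  · have s0 : 0 < √x := Real.sqrt_pos.2 h
    have s1 : √x ≤ y⁻¹ ^ 2 := by
      rw [show y⁻¹ ^ 2 = √(y⁻¹ ^ 4) by rw [show y⁻¹ ^ 4 = (y⁻¹ ^ 2) ^ 2 by ring, Real.sqrt_sq (by positivity)]]
      exact Real.sqrt_le_sqrt h1.le
    have l := Real.one_sub_inv_le_log_of_pos s0
    have e : Real.log x = 2 * Real.log √x := by rw [Real.log_sqrt h.le]; ring
    have xx : x = √x * √x := (Real.mul_self_sqrt h.le).symm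
    have : -(x * Real.log x) ≤ 2 * √x := by
      rw [e]
      have : x * (√x)⁻¹ = √x := by rw [xx]; field_simp; simp
      nlinarith
    have : 0 ≤ 4 * (y * x) := by positivity
    linarith
theorem jj_int : Integrable fun v : V3 => (jj v)⁻¹ ^ 2 := by
  have := integrable_rpow_neg_one_add_norm_sq (E := V3) (r := 4) (μ := volume) (by simp; norm_num)
  refine this.congr (eof fun v => ?_)
  simp only [jj]
  rw [show (-4:ℝ) / 2 = -((2:ℕ):ℝ) by norm_num, Real.rpow_neg (by positivity), rrn, inv_pow]
theorem ent {p : ℝ} (hp : 1 < p) {f : FV} (f0 : ∀ v, 0 ≤ f v) (hc : Continuous f) (hj : Integrable fun v => jj v * f v)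
    (h4 : ∫ v, jj v * f v ≤ 4) (hi : Integrable fun v => |f v| ^ p) :
    (Integrable fun v => f v * |Real.log (f v)|) ∧ (∫ v, f v * Real.log (f v)) ≤ (p - 1)⁻¹ * ∫ v, |f v| ^ p ∧
    ∫ v, f v * |Real.log (f v)| ≤ (∫ v, f v * Real.log (f v)) + (32 + 4 * ∫ v : V3, (jj v)⁻¹ ^ 2) := by
  have p1 : 0 < p - 1 := by linarith
  have up : ∀ v, f v * Real.log (f v) ≤ (p - 1)⁻¹ * |f v| ^ p := fun v => by
    have := Real.log_le_rpow_div (f0 v) p1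
    rcases (f0 v).eq_or_lt with h | h
    · rw [← h]; simp; positivity
    · calc _ ≤ f v * (f v ^ (p - 1) / (p - 1)) := by gcongr
        _ = _ := by rw [aop h, Real.rpow_sub_one h.ne']; field_simp
  have lo := fun v => xlogx_neg (f0 v) (jj_one v)
  have jp : ∀ v, 0 ≤ 4 * (jj v * f v) + 2 * (jj v)⁻¹ ^ 2 := fun v => by
    have := jj_pos v; have := f0 v; positivity
  have up0 : ∀ v, 0 ≤ (p - 1)⁻¹ * |f v| ^ p := fun v => by positivity
  have ij : Integrable fun v => 4 * (jj v * f v) + 2 * (jj v)⁻¹ ^ 2 := (hj.const_mul 4).fun_add (jj_int.const_mul 2)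
  have i1 : Integrable fun v => f v * |Real.log (f v)| := by
    refine ((hi.const_mul (p - 1)⁻¹).fun_add ij).mono' (Measurable.aestronglyMeasurable ?_) (eof fun v => ?_)
    · have := Real.measurable_log; have := hc.measurable; fun_prop
    · rw [rnn (mul_nonneg (f0 v) (abs_nonneg _))]
      have := lo v; have := up v; have := jp v; have := up0 v
      rcases abs_cases (Real.log (f v)) with ⟨h, _⟩ | ⟨h, _⟩ <;> rw [h] <;> linarith
  have i2 : Integrable fun v => f v * Real.log (f v) := by
    refine i1.mono' (Measurable.aestronglyMeasurable ?_) (eof fun v => ?_)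
    · have := Real.measurable_log; have := hc.measurable; fun_prop
    · rw [norm_mul, rnn (f0 v), rna]
  refine ⟨i1, ?_, ?_⟩
  · rw [← icm]; exact integral_mono i2 (hi.const_mul _) up
  · have := integral_mono i1 (i2.fun_add (ij.const_mul 2)) fun v => by
      have := lo v; have := jp v
      change f v * |Real.log (f v)| ≤ f v * Real.log (f v) + 2 * (4 * (jj v * f v) + 2 * (jj v)⁻¹ ^ 2)
      rcases abs_cases (Real.log (f v)) with ⟨h, _⟩ | ⟨h, _⟩ <;> rw [h] <;> linarith
    rw [integral_add i2 (ij.const_mul 2), icm, integral_add (hj.const_mul 4) (jj_int.const_mul 2), icm, icm] at this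
    linarith
structure PS (p r T M : ℝ) (J : ℕ) (g : ℝ → FV) (gi : FV) : Prop where
  hp : 3 / 2 < p
  hr : 2 * p / (2 * p - 3) < r
  nn : ∀ t v, 0 ≤ g t v
  mem : MemLrLp r p T g
  hM : (∫ t in Set.Ioo (0 : ℝ) T, (∫ v : V3, |g t v| ^ p) ^ (r / p)) ≤ M
  ll : LocLipschitz T g
  w : IsWeakLandauSolution T g
  nrm : ∀ᵐ t ∂(volume.restrict (Set.Ioo 0 T)), IsNormalized (g t)
  ant : AntitoneOn (fun t => ∫ v : V3, g t v * Real.log (g t v)) (Set.Ioc 0 T)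
  gi0 : ∀ v, 0 ≤ gi v
  gii : Integrable gi
  gij : Integrable fun v => jj v ^ J * gi v
  gijM : (∫ v, jj v ^ J * gi v) ≤ M
  ge : Integrable (fun v : V3 => gi v * |Real.log (gi v)|)
  geM : (∫ v : V3, gi v * |Real.log (gi v)|) ≤ M
  tend : ∀ φ : FV, CDI φ → HasCompactSupport φ →
            Filter.Tendsto (fun t => ∫ v : V3, g t v * φ v)
              (nhdsWithin 0 (Set.Ioi 0)) (nhds (∫ v : V3, gi v * φ v))
def Xp (p : ℝ) (g : ℝ → FV) (t : ℝ) : ℝ := ∫ v : V3, |g t v| ^ p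
theorem Xp_nn (p g t) : 0 ≤ Xp p g t := integral_nonneg fun v => by positivity
def Ca (p : ℝ) : ℝ := if h : 3 / 2 < p then Classical.choose (a_sup h) else 1
theorem Ca_pos (p : ℝ) : 0 < Ca p := by
  unfold Ca; split_ifs with h
  · exact (Classical.choose_spec (a_sup h)).1
  · exact one_pos
def Sf (p : ℝ) (g : ℝ → FV) (t : ℝ) : ℝ := Ca p * (1 + Xp p g t ^ (1 / p))
theorem r_gt {p r : ℝ} (hp : 3 / 2 < p) (hr : 2 * p / (2 * p - 3) < r) : 1 < r := by
  refine lt_trans ?_ hr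
  rw [lt_div_iff₀ (by linarith)]; linarith
theorem xpow_le {x l p r : ℝ} (hx : 0 ≤ x) (_ : 0 < p) (hr : 1 < r) (hl : 1 ≤ l) : x ^ (1 / p) ≤ l + l ^ (1 - r) * x ^ (r / p) := by
  have l0 : 0 < l := by linarith
  have h1 : 0 ≤ x ^ (1 / p) := by positivity
  have e : x ^ (r / p) = (x ^ (1 / p)) ^ r := by rw [← Real.rpow_mul hx]; congr 1; ring
  rw [e]
  set y := x ^ (1 / p)
  rcases le_or_gt y l with h | h
  · have : 0 ≤ l ^ (1 - r) * y ^ r := by positivity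
    linarith
  · have y0 : 0 < y := by linarith
    have : y = y ^ (1 - r) * y ^ r := by rw [← Real.rpow_add y0]; simp
    have : y ^ (1 - r) ≤ l ^ (1 - r) := Real.rpow_le_rpow_of_nonpos l0 h.le (by linarith)
    have : y ≤ l ^ (1 - r) * y ^ r := by
      calc y = y ^ (1 - r) * y ^ r := by assumption
        _ ≤ _ := by gcongr
    linarith
section PSs
variable {p r T M : ℝ} {J : ℕ} {g : ℝ → FV} {gi : FV}
theorem PS.meas (h : PS p r T M J g gi) : AEStronglyMeasurable (fun t => Xp p g t ^ (1 / p)) (volume.restrict (Ioo 0 T)) := by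
  have p0 : 0 < p := by linarith [h.hp]
  have r1 := r_gt h.hp h.hr
  have e : (fun t => Xp p g t ^ (1 / p)) = fun t => (Xp p g t ^ (r / p)) ^ (1 / r) := by
    ext t; rw [← Real.rpow_mul (Xp_nn _ _ _)]; congr 1; field_simp
  rw [e]
  exact (h.mem.2.1.aemeasurable.pow_const _).aestronglyMeasurable
theorem PS.mass (h : PS p r T M J g gi) : ∀ᵐ t ∂volume.restrict (Ioo 0 T), Integrable (g t) ∧ ∫ v, g t v = 1 := by
  filter_upwards [h.nrm] with t ht
  refine ⟨?_, ht.1⟩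
  by_contra hc
  have := ht.1
  rw [integral_undef hc] at this; norm_num at this
theorem PS.energy (h : PS p r T M J g gi) : ∀ᵐ t ∂volume.restrict (Ioo 0 T), (Integrable fun v => jj v * g t v) ∧ ∫ v, jj v * g t v = 4 := by
  filter_upwards [h.nrm, h.mass] with t ht hm
  have : Integrable fun v => g t v * ‖v‖ ^ 2 := by
    by_contra hc
    have := ht.2.2
    rw [integral_undef hc] at this; norm_num at this
  have e : (fun v => jj v * g t v) = fun v => g t v + g t v * ‖v‖ ^ 2 := by ext v; unfold jj; ring
  rw [e]
  refine ⟨hm.1.add this, ?_⟩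
  rw [integral_add hm.1 this, ht.2.2, hm.2]; norm_num
theorem PS.hyp (h : PS p r T M J g gi) : Hyp T g gi (Sf p g) := by
  have p0 : 0 < p := by linarith [h.hp]
  have r1 := r_gt h.hp h.hr
  have C0 := Ca_pos p
  refine ⟨⟨h.nn, h.ll, h.w, h.mass⟩, ?_, fun t => ?_, ?_, h.tend⟩
  · filter_upwards [h.mass, h.mem.1] with t ht h2 v
    have := ((Classical.choose_spec (a_sup h.hp)).2 (g t) (h.nn t) ht.1 ht.2 h2 v).2
    simpa only [Sf, Ca, Xp, h.hp, dite_true] using this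
  · have := Xp_nn p g t; unfold Sf; positivity
  · refine Integrable.const_mul ?_ _
    refine ((integrable_const (1:ℝ)).fun_add ((integrable_const (1:ℝ)).fun_add h.mem.2)).mono' (aestronglyMeasurable_const.add h.meas) (eof fun t => ?_)
    have := Xp_nn p g t
    rw [rnn (by positivity)]
    have := xpow_le this p0 r1 (le_refl (1:ℝ))
    simp only [Real.one_rpow, one_mul] at this
    simp only [Xp] at this ⊢; linarith
theorem PS.Sint (h : PS p r T M J g gi) {l t : ℝ} (hl : 1 ≤ l) (h0 : 0 ≤ t) (ht : t ≤ T) :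
    ∫ τ in Ioo 0 t, Sf p g τ ≤ Ca p * ((1 + l) * t + l ^ (1 - r) * M) := by
  have p0 : 0 < p := by linarith [h.hp]
  have r1 := r_gt h.hp h.hr
  have l0 : 0 < l := by linarith
  have sub : Ioo 0 t ⊆ Ioo 0 T := Ioo_subset_Ioo le_rfl ht
  have i2 : IntegrableOn (fun τ => Xp p g τ ^ (r / p)) (Ioo 0 t) := h.mem.2.mono_set sub
  have i1 : Integrable (fun τ => Ca p * ((1 + l) + l ^ (1 - r) * Xp p g τ ^ (r / p))) (volume.restrict (Ioo 0 t)) :=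
    (Integrable.fun_add (integrable_const _) (i2.const_mul _)).const_mul _
  have := integral_mono (h.hyp.Si.mono_set sub) i1 fun τ => by
    have := xpow_le (Xp_nn p g τ) p0 r1 hl
    unfold Sf
    exact mll (by linarith) (Ca_pos p).le
  refine this.trans ?_
  rw [icm, integral_add (integrable_const _) (i2.const_mul _), icm]
  have m : ∫ τ in Ioo 0 t, Xp p g τ ^ (r / p) ≤ M :=
    (setIntegral_mono_set h.mem.2 (eof fun t => Real.rpow_nonneg (Xp_nn p g t) _) (LE.le.eventuallyLE sub)).trans h.hM
  have C0 := Ca_pos p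
  have e : ∫ τ in Ioo 0 t, (1 + l) = (1 + l) * t := by simp [h0, mul_comm]
  rw [e]; gcongr
theorem PS.pick (h : PS p r T M J g gi) {P : ℝ → Prop} (hP : ∀ᵐ t ∂volume.restrict (Ioo 0 T), P t) {t : ℝ} (h0 : 0 < t) (ht : t ≤ T) :
    ∃ s ∈ Ioo 0 t, P s ∧ Xp p g s ^ (r / p) ≤ M / t := by
  by_contra! hc
  have sub : Ioo 0 t ⊆ Ioo 0 T := Ioo_subset_Ioo le_rfl ht
  have m : ∫ τ in Ioo 0 t, Xp p g τ ^ (r / p) ≤ M :=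
    (setIntegral_mono_set h.mem.2 (eof fun t => Real.rpow_nonneg (Xp_nn p g t) _) (LE.le.eventuallyLE sub)).trans h.hM
  have i2 : IntegrableOn (fun τ => Xp p g τ ^ (r / p) - M / t) (Ioo 0 t) := (h.mem.2.mono_set sub).sub (integrable_const _)
  have pos : 0 < ∫ τ in Ioo 0 t, (Xp p g τ ^ (r / p) - M / t) := by
    have ae : ∀ᵐ τ ∂volume.restrict (Ioo 0 t), 0 < Xp p g τ ^ (r / p) - M / t := by
      filter_upwards [ae_mono le_rfl ht hP, ard measurableSet_Ioo] with τ h1 h2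
      linarith [hc τ h2 h1]
    rw [integral_pos_iff_support_of_nonneg_ae (ae.mono fun τ hτ => hτ.le) i2]
    have : volume.restrict (Ioo 0 t) (Function.support fun τ => Xp p g τ ^ (r / p) - M / t)ᶜ = 0 :=
      (ae.mono fun τ hτ => hτ.ne' : ∀ᵐ τ ∂volume.restrict (Ioo 0 t), τ ∈ Function.support fun τ => Xp p g τ ^ (r / p) - M / t)
    by_contra hz
    have hz : volume.restrict (Ioo 0 t) (Function.support fun τ => Xp p g τ ^ (r / p) - M / t) = 0 := by simpa using hz
    have u := measure_union_le (μ := volume.restrict (Ioo 0 t)) (Function.support fun τ => Xp p g τ ^ (r / p) - M / t) (Function.support fun τ => Xp p g τ ^ (r / p) - M / t)ᶜ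
    rw [union_compl_self, this, hz] at u
    simp at u
    linarith
  have i3 : Integrable (fun τ => Xp p g τ ^ (r / p)) (volume.restrict (Ioo 0 t)) := h.mem.2.mono_set sub
  rw [integral_sub i3 (integrable_const _)] at pos
  have e : ∫ τ in Ioo 0 t, M / t = M := by simp [h0.le]; field_simp
  rw [e] at pos
  linarith
end PSs
theorem half_mass {f : FV} (f0 : ∀ v, 0 ≤ f v) (hf : Integrable f) (h1 : ∫ v, f v = 1) (hj : Integrable fun v => jj v * f v)
    (h4 : ∫ v, jj v * f v = 4) : 1 / 2 ≤ ∫ v, f v * cu v := by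
  have i0 : Integrable fun w => f w * cu w := by simpa using cu_int hf (ψ := fun _ => 1) continuous_const
  have := integral_mono (isub hf (hj.const_mul (1 / 8))) i0 fun v => by
    have := mll (cu_one v) (f0 v)
    simp only; linarith
  rw [integral_sub hf (hj.const_mul _), icm, h1, h4] at this
  linarith
theorem ell (p r T M : ℝ) (J : ℕ) (hp : 3 / 2 < p) (hr : 2 * p / (2 * p - 3) < r) (hT : 0 < T) : ∃ c : ℝ, 0 < c ∧
    ∀ g gi, PS p r T M J g gi → ∀ᵐ t ∂volume.restrict (Ioo 0 T), ∀ v (x : Fin 3 → ℝ),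
      c * (wt v * ∑ i, x i ^ 2) ≤ ∑ i, ∑ j, coeffA (g t) v i j * x i * x j := by
  have r1 := r_gt hp hr
  have C0 := Ca_pos p
  obtain ⟨κ1, k1, hk1⟩ := nonconc M
  obtain ⟨D1, d1, hD1⟩ := lin0 cu_cd cu_cs
  obtain ⟨D2, d2, hD2⟩ := quad_wc
  set η := min (1 / (4 * D1)) (κ1 / (2 * D2)) with hη
  have η0 : 0 < η := by positivity
  have ηa : D1 * η ≤ 1 / 4 := by
    calc _ ≤ D1 * (1 / (4 * D1)) := by gcongr; exact min_le_left _ _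
      _ = _ := by field_simp
  have ηb : D2 * η ≤ κ1 / 2 := by
    calc _ ≤ D2 * (κ1 / (2 * D2)) := by gcongr; exact min_le_right _ _
      _ = _ := by field_simp
  obtain ⟨l, hl1, hl⟩ : ∃ l : ℝ, 1 ≤ l ∧ Ca p * (l ^ (1 - r) * |M|) ≤ η / 2 := by
    have t : Tendsto (fun l : ℝ => Ca p * (l ^ (1 - r) * |M|)) atTop (𝓝 (Ca p * (0 * |M|))) := by
      have := tendsto_rpow_neg_atTop (y := r - 1) (by linarith)
      simp only [neg_sub] at this
      exact (this.mul_const _).const_mul _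
    have := (t.eventually (gt_mem_nhds (by simp; positivity : Ca p * (0 * |M|) < η / 2))).and (eventually_ge_atTop 1)
    obtain ⟨l, h1, h2⟩ := this.exists
    exact ⟨l, h2, h1.le⟩
  set t0 := min T (η / (2 * Ca p * (1 + l))) with ht0
  have t00 : 0 < t0 := by have : 0 < 1 + l := by linarith
                          positivity
  have t0T : t0 ≤ T := min_le_left _ _
  set L2 := (p - 1)⁻¹ * (|M| / t0) ^ (p / r) + (32 + 4 * ∫ v : V3, (jj v)⁻¹ ^ 2)
  obtain ⟨κ2, k2, hk2⟩ := nonconc L2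
  refine ⟨cell * min (κ1 / 2) (min κ2 4), by have := cell_pos; positivity, fun g gi h => ?_⟩
  have Sη : ∀ t, 0 ≤ t → t ≤ t0 → ∫ τ in Ioo 0 t, Sf p g τ ≤ η := fun t a b => by
    refine (h.Sint hl1 a (b.trans t0T)).trans ?_
    have l0 : 0 < l := by linarith
    have : Ca p * ((1 + l) * t) ≤ η / 2 := by
      calc _ ≤ Ca p * ((1 + l) * (η / (2 * Ca p * (1 + l)))) := by gcongr; exact b.trans (min_le_right _ _)
        _ = _ := by field_simp
    have : Ca p * (l ^ (1 - r) * M) ≤ Ca p * (l ^ (1 - r) * |M|) := by gcongr; exact le_abs_self M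
    rw [mul_add]; linarith
  obtain ⟨s, hs, ⟨sm, se, sp⟩, sX⟩ := h.pick (h.mass.and (h.energy.and h.mem.1)) t00 t0T
  have hsT : s ∈ Ioo 0 T := ⟨hs.1, hs.2.trans_le t0T⟩
  have gc : 1 / 4 ≤ ∫ v, gi v * cu v := by
    have a := half_mass (h.nn s) sm.1 sm.2 se.1 se.2
    have b := (abs_le.1 (hD1 _ _ _ _ h.hyp s hsT)).2
    have := mll (Sη s hs.1.le hs.2.le) d1.le
    linarith
  have q1 := hk1 gi h.gi0 h.gii h.ge h.geM gc
  filter_upwards [h.mass, h.energy, h.mem.1, h.hyp.toSol.nice, ard measurableSet_Ioo] with t tm te tp tn tt v x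
  have hm := half_mass (h.nn t) tm.1 tm.2 te.1 te.2
  refine elliptic tn (fun e c he => ?_) v x
  rcases le_total t t0 with h1 | h1
  · rcases le_or_gt |c| 8 with h2 | h2
    · refine (min_le_left _ _).trans ?_
      have b := (abs_le.1 (hD2 _ _ _ _ h.hyp h.gii t tt tm.1 e c he h2)).1
      have := mll (Sη t tt.1.le h1) d2.le
      linarith [q1 e c he]
    · refine (min_le_right _ _).trans ((min_le_right _ _).trans ?_)
      have i0 : Integrable fun w => g t w * cu w := by simpa using cu_int tm.1 (ψ := fun _ => 1) continuous_const
      have := integral_mono (i0.const_mul 16) (cu_int tm.1 (by fun_prop : Continuous fun w : V3 => (inner ℝ e w - c) ^ 2)) fun w => by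
        have a0 := mul_nonneg (h.nn t w) (cu_nn w)
        rcases le_or_gt ‖w‖ 4 with h3 | h3
        · have a := abs_real_inner_le_norm e w
          rw [he, one_mul] at a
          have : 4 ≤ |inner ℝ e w - c| := by
            have := abs_sub_abs_le_abs_sub c (inner ℝ e w)
            rw [abs_sub_comm] at this; linarith
          have : 16 ≤ (inner ℝ e w - c) ^ 2 := by rw [← sq_abs]; nlinarith
          simp only; rw [← mul_assoc]; nlinarith
        · simp [cu_zero h3]
      rw [icm] at this
      linarith
  · refine (min_le_right _ _).trans ((min_le_left _ _).trans ?_)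
    have p1 : 1 < p := by linarith
    obtain ⟨a1, a2, a3⟩ := ent p1 (h.nn t) tn.ll.continuous te.1 te.2.le tp
    obtain ⟨b1, b2, b3⟩ := ent p1 (h.nn s) (h.hyp.toSol.cont hsT) se.1 se.2.le sp
    have an := h.ant (a := s) (b := t) ⟨hsT.1, hsT.2.le⟩ ⟨tt.1, tt.2.le⟩ (hs.2.le.trans h1)
    refine hk2 (g t) (h.nn t) tm.1 a1 ?_ (by linarith) e c he
    have X : Xp p g s ≤ (|M| / t0) ^ (p / r) := by
      have r0 : 0 < r := by linarith
      have : Xp p g s = (Xp p g s ^ (r / p)) ^ (p / r) := by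
        rw [← Real.rpow_mul (Xp_nn _ _ _)]
        have : r / p * (p / r) = 1 := by field_simp
        rw [this, Real.rpow_one]
      rw [this]
      have := Xp_nn p g s
      refine Real.rpow_le_rpow (by positivity) (sX.trans ?_) (by positivity)
      gcongr; exact le_abs_self M
    have X' := mll X (inv_nonneg.2 (by linarith : 0 ≤ p - 1))
    have b2 : (∫ v, g s v * Real.log (g s v)) ≤ (p - 1)⁻¹ * Xp p g s := b2
    simp only at an
    linarith
def kk (p : ℝ) (n : ℕ) (x : ℝ) : ℝ := (max x 0 + 1 / (n + 1)) ^ (p / 2 - 1) * max (1 - max x 0 / (n + 1)) 0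
def HH (p : ℝ) (n : ℕ) (x : ℝ) : ℝ := ∫ s in (0 : ℝ)..x, kk p n s
def QQ (p : ℝ) (n : ℕ) (x : ℝ) : ℝ := ∫ s in (0 : ℝ)..x, kk p n s ^ 2
def bt (p : ℝ) (n : ℕ) (x : ℝ) : ℝ := ∫ s in (0 : ℝ)..x, QQ p n s
def cn (p : ℝ) (n : ℕ) : ℝ := QQ p n (n + 1)
def rB (p : ℝ) (n : ℕ) (x : ℝ) : ℝ := bt p n x - cn p n * x
theorem dI {f : ℝ → ℝ} (h : Continuous f) (x : ℝ) : HasDerivAt (fun x => ∫ s in (0 : ℝ)..x, f s) (f x) x :=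
  intervalIntegral.integral_hasDerivAt_right (h.intervalIntegrable _ _) (h.stronglyMeasurableAtFilter _ _) h.continuousAt
theorem cmpD {F G F' G' : ℝ → ℝ} (hF : ∀ x, HasDerivAt F (F' x) x) (hG : ∀ x, 0 < x → HasDerivAt G (G' x) x)
    (cG : ContinuousOn G (Ici 0)) (h0 : F 0 ≤ G 0) (hd : ∀ x, 0 < x → F' x ≤ G' x) {x : ℝ} (hx : 0 ≤ x) : F x ≤ G x := by
  have m : MonotoneOn (fun x => G x - F x) (Ici 0) := by
    refine monotoneOn_of_hasDerivWithinAt_nonneg (convex_Ici 0) (f' := fun x => G' x - F' x) (cG.sub fun x _ => (hF x).continuousAt.continuousWithinAt) (fun x hx => ?_) (fun x hx => ?_)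
    · rw [interior_Ici] at hx
      exact ((hG x hx).sub (hF x)).hasDerivWithinAt
    · rw [interior_Ici] at hx
      have := hd x hx
      linarith
  have := m (mem_Ici.2 le_rfl) (mem_Ici.2 hx) hx
  simp only at this
  linarith
section K
variable (p : ℝ) (n : ℕ)
theorem kb (x : ℝ) : 0 < max x 0 + 1 / ((n : ℝ) + 1) := by positivity
theorem kk_c : Continuous (kk p n) := by
  unfold kk
  refine Continuous.mul (Continuous.rpow_const (by fun_prop) fun x => Or.inl (kb n x).ne') (by fun_prop)
theorem kk_nn (x : ℝ) : 0 ≤ kk p n x := mul_nonneg (by have := kb n x; positivity) (le_max_right _ _)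
theorem HH_d (x : ℝ) : HasDerivAt (HH p n) (kk p n x) x := dI (kk_c p n) x
theorem QQ_d (x : ℝ) : HasDerivAt (QQ p n) (kk p n x ^ 2) x := dI ((kk_c p n).pow 2) x
theorem QQ_c : Continuous (QQ p n) := continuous_iff_continuousAt.2 fun x => (QQ_d p n x).continuousAt
theorem HH_c : Continuous (HH p n) := continuous_iff_continuousAt.2 fun x => (HH_d p n x).continuousAt
theorem bt_d (x : ℝ) : HasDerivAt (bt p n) (QQ p n x) x := dI (QQ_c p n) x
theorem bt_c : Continuous (bt p n) := continuous_iff_continuousAt.2 fun x => (bt_d p n x).continuousAt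
theorem HH0 : HH p n 0 = 0 := by simp [HH]
theorem QQ0 : QQ p n 0 = 0 := by simp [QQ]
theorem bt0 : bt p n 0 = 0 := by simp [bt]
theorem rB_ren : Ren (rB p n) (fun x => QQ p n x - cn p n) (fun x => kk p n x ^ 2) :=
  ⟨fun x => by
    have := (bt_d p n x).fun_sub ((hasDerivAt_id x).const_mul (cn p n))
    simp only [id, mul_one] at this
    exact this, fun x => (QQ_d p n x).sub_const _, (kk_c p n).pow 2⟩
theorem QQ_mono : Monotone (QQ p n) := monotone_of_deriv_nonneg (fun x => (QQ_d p n x).differentiableAt) fun x => by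
  rw [(QQ_d p n x).deriv]; positivity
theorem HH_mono : Monotone (HH p n) := monotone_of_deriv_nonneg (fun x => (HH_d p n x).differentiableAt) fun x => by
  rw [(HH_d p n x).deriv]; exact kk_nn p n x
theorem HH_nn {x : ℝ} (hx : 0 ≤ x) : 0 ≤ HH p n x := by rw [← HH0 p n]; exact HH_mono p n hx
theorem QQ_nn {x : ℝ} (hx : 0 ≤ x) : 0 ≤ QQ p n x := by rw [← QQ0 p n]; exact QQ_mono p n hx
theorem bt_nn {x : ℝ} (hx : 0 ≤ x) : 0 ≤ bt p n x := intervalIntegral.integral_nonneg hx fun u hu => QQ_nn p n hu.1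
theorem kk_big {x : ℝ} (hx : (n : ℝ) + 1 ≤ x) : kk p n x = 0 := by
  have n0 : (0 : ℝ) < n + 1 := by positivity
  rw [kk, max_eq_left (by linarith : 0 ≤ x), max_eq_right, mul_zero]
  rw [sub_nonpos, le_div_iff₀ n0]; linarith
theorem QQ_big {x : ℝ} (hx : (n : ℝ) + 1 ≤ x) : QQ p n x = cn p n := by
  have := intervalIntegral.integral_interval_sub_left (μ := volume) (((kk_c p n).pow 2).intervalIntegrable 0 x) (((kk_c p n).pow 2).intervalIntegrable 0 (n + 1))
  have h : ∫ s in ((n : ℝ) + 1)..x, kk p n s ^ 2 = 0 := by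
    rw [intervalIntegral.integral_congr (g := fun _ => (0 : ℝ))]
    · simp
    · intro s hs
      rw [uIcc_of_le hx] at hs
      simp [kk_big p n hs.1]
  simp only [Pi.pow_apply] at this
  rw [h] at this
  unfold cn QQ
  linarith
theorem cn_nn : 0 ≤ cn p n := QQ_nn p n (by positivity)
theorem QQ_le (x : ℝ) : QQ p n x ≤ cn p n := by
  rcases le_total ((n : ℝ) + 1) x with h | h
  · exact (QQ_big p n h).le
  · exact QQ_mono p n h
theorem rB_b {x : ℝ} (hx : 0 ≤ x) : |rB p n x| ≤ cn p n * x ∧ |rB p n x| ≤ cn p n * (n + 1) := by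
  have c := cn_nn p n
  have dB : ∀ x, HasDerivAt (rB p n) (QQ p n x - cn p n) x := (rB_ren p n).d1
  have r0 : rB p n 0 = 0 := by simp [rB, bt0]
  have a : Antitone (rB p n) := antitone_of_deriv_nonpos (fun x => (dB x).differentiableAt) fun x => by
    rw [(dB x).deriv]; linarith [QQ_le p n x]
  have h1 : ∀ {x}, 0 ≤ x → |rB p n x| ≤ cn p n * x := by
    intro x hx
    have := a hx
    have b := bt_nn p n hx
    rw [r0] at this
    rw [abs_of_nonpos this]
    unfold rB; linarith
  refine ⟨h1 hx, ?_⟩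
  rcases le_total x (n + 1) with h | h
  · exact (h1 hx).trans (by gcongr)
  · have e : rB p n x = rB p n (n + 1) := by
      have : ∫ s in ((n : ℝ) + 1)..x, (QQ p n s - cn p n) = rB p n x - rB p n (n + 1) :=
        intervalIntegral.integral_eq_sub_of_hasDerivAt (fun s _ => dB s) (((QQ_c p n).sub continuous_const).intervalIntegrable _ _)
      have h0 : ∫ s in ((n : ℝ) + 1)..x, (QQ p n s - cn p n) = 0 := by
        rw [intervalIntegral.integral_congr (g := fun _ => (0 : ℝ))]
        · simp
        · intro s hs
          rw [uIcc_of_le h] at hs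
          simp [QQ_big p n hs.1]
      linarith
    rw [e]; exact h1 (by positivity)
theorem kk_half (hp : 3 / 2 < p) {x s : ℝ} (hs : 0 ≤ s) (h1 : x / 2 ≤ s) (h2 : s ≤ x) : kk p n x ≤ 2 ^ p * kk p n s := by
  have n0 : (0 : ℝ) < 1 / (n + 1) := by positivity
  unfold kk
  rw [max_eq_left hs, max_eq_left (hs.trans h2)]
  have : (x + 1 / ((n : ℝ) + 1)) ^ (p / 2 - 1) ≤ 2 ^ p * (s + 1 / ((n : ℝ) + 1)) ^ (p / 2 - 1) := by
    have p2 : (1 : ℝ) ≤ 2 ^ p := Real.one_le_rpow (by norm_num) (by linarith)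
    rcases le_total (p / 2 - 1) 0 with h | h
    · calc _ ≤ (s + 1 / ((n : ℝ) + 1)) ^ (p / 2 - 1) := Real.rpow_le_rpow_of_nonpos (by positivity) (by linarith) h
        _ ≤ _ := le_mul_of_one_le_left (by positivity) p2
    · calc _ ≤ (2 * (s + 1 / ((n : ℝ) + 1))) ^ (p / 2 - 1) := Real.rpow_le_rpow (by linarith) (by linarith) h
        _ = 2 ^ (p / 2 - 1) * (s + 1 / ((n : ℝ) + 1)) ^ (p / 2 - 1) := Real.mul_rpow (by norm_num) (by positivity)
        _ ≤ _ := by gcongr; norm_num; linarith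
  rw [← mul_assoc]
  gcongr
theorem xk_le (hp : 3 / 2 < p) {x : ℝ} (hx : 0 ≤ x) : x * kk p n x ≤ 2 * 2 ^ p * HH p n x := by
  have e : ∫ s in (x / 2)..x, kk p n s = HH p n x - HH p n (x / 2) :=
    intervalIntegral.integral_eq_sub_of_hasDerivAt (fun s _ => HH_d p n s) ((kk_c p n).intervalIntegrable _ _)
  have : ∫ s in (x / 2)..x, (2 ^ p)⁻¹ * kk p n x ≤ ∫ s in (x / 2)..x, kk p n s := by
    refine intervalIntegral.integral_mono_on (by linarith) (by simp) ((kk_c p n).intervalIntegrable _ _) fun s hs => ?_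
    have := kk_half p n hp (x := x) (s := s) (by linarith [hs.1]) hs.1 hs.2
    rwa [inv_mul_le_iff₀ (by positivity)]
  rw [e, intervalIntegral.integral_const, smul_eq_mul] at this
  have h0 := HH_nn p n (x := x / 2) (by linarith)
  have p0 : (0 : ℝ) < 2 ^ p := by positivity
  have h2 : (x / 2) * ((2 ^ p)⁻¹ * kk p n x) ≤ HH p n x := by rw [sub_half] at this; linarith
  calc x * kk p n x = 2 * 2 ^ p * ((x / 2) * ((2 ^ p)⁻¹ * kk p n x)) := by field_simp
    _ ≤ _ := by gcongr
theorem ga_le (hp : 3 / 2 < p) {x : ℝ} (hx : 0 ≤ x) : x * QQ p n x - bt p n x ≤ 2 ^ p * HH p n x ^ 2 := by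
  refine cmpD (F := fun x => x * QQ p n x - bt p n x) (F' := fun x => x * kk p n x ^ 2) (G := fun x => 2 ^ p * HH p n x ^ 2)
    (G' := fun x => 2 ^ p * (2 * HH p n x * kk p n x)) (fun x => ?_) (fun x _ => ?_) ?_ ?_ (fun x hx => ?_) hx
  · have := ((hasDerivAt_id x).fun_mul (QQ_d p n x)).fun_sub (bt_d p n x)
    exact this.congr_deriv (by simp)
  · have := ((HH_d p n x).fun_pow 2).const_mul (2 ^ p)
    exact this.congr_deriv (by simp)
  · exact (continuous_const.mul ((HH_c p n).pow 2)).continuousOn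
  · simp [HH0, QQ0, bt0]
  · have := mlr (xk_le p n hp hx.le) (kk_nn p n x)
    nlinarith
theorem QQ_dbl (hp : 3 / 2 < p) {x : ℝ} (hx : 0 ≤ x) : QQ p n (2 * x) ≤ 2 * (2 ^ p) ^ 2 * QQ p n x := by
  refine cmpD (F := fun x => QQ p n (2 * x)) (F' := fun x => kk p n (2 * x) ^ 2 * 2) (G := fun x => 2 * (2 ^ p) ^ 2 * QQ p n x)
    (G' := fun x => 2 * (2 ^ p) ^ 2 * kk p n x ^ 2) (fun x => ?_) (fun x _ => (QQ_d p n x).const_mul _) ?_ ?_ (fun x hx => ?_) hx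
  · have := (QQ_d p n (2 * x)).comp x ((hasDerivAt_id x).const_mul 2)
    exact this.congr_deriv (by simp)
  · exact (continuous_const.mul (QQ_c p n)).continuousOn
  · simp [QQ0]
  · have h := kk_half p n hp (x := 2 * x) (s := x) hx.le (by linarith) (by linarith)
    have := pow_le_pow_left₀ (kk_nn p n _) h 2
    rw [mul_pow] at this
    linarith
theorem xQ_le (hp : 3 / 2 < p) {x : ℝ} (hx : 0 ≤ x) : x * QQ p n x ≤ 4 * (2 ^ p) ^ 2 * bt p n x := by
  have e : ∫ s in (x / 2)..x, QQ p n s = bt p n x - bt p n (x / 2) :=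
    intervalIntegral.integral_eq_sub_of_hasDerivAt (fun s _ => bt_d p n s) ((QQ_c p n).intervalIntegrable _ _)
  have h := QQ_dbl p n hp (x := x / 2) (by linarith)
  rw [show 2 * (x / 2) = x by ring] at h
  have : ∫ s in (x / 2)..x, QQ p n (x / 2) ≤ ∫ s in (x / 2)..x, QQ p n s :=
    intervalIntegral.integral_mono_on (by linarith) (by simp) ((QQ_c p n).intervalIntegrable _ _) fun s hs => QQ_mono p n hs.1
  rw [e, intervalIntegral.integral_const, smul_eq_mul] at this
  have h0 := bt_nn p n (x := x / 2) (by linarith)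
  have p0 : (0 : ℝ) < 2 ^ p := by positivity
  calc x * QQ p n x ≤ x * (2 * (2 ^ p) ^ 2 * QQ p n (x / 2)) := by gcongr
    _ = 4 * (2 ^ p) ^ 2 * ((x - x / 2) * QQ p n (x / 2)) := by ring
    _ ≤ _ := by gcongr; linarith
theorem HH_sq {x : ℝ} (hx : 0 ≤ x) : HH p n x ^ 2 ≤ x * QQ p n x := by
  rcases hx.eq_or_lt with rfl | h
  · simp [HH0]
  have : 0 ≤ ∫ s in (0 : ℝ)..x, (kk p n s ^ 2 + (-(2 * (HH p n x / x)) * kk p n s + (HH p n x / x) ^ 2)) :=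
    intervalIntegral.integral_nonneg hx fun s _ => by nlinarith [sq_nonneg (kk p n s - HH p n x / x)]
  have kc := kk_c p n
  rw [intervalIntegral.integral_add ((by fun_prop : Continuous fun s => kk p n s ^ 2).intervalIntegrable _ _)
      ((by fun_prop : Continuous fun s => -(2 * (HH p n x / x)) * kk p n s + (HH p n x / x) ^ 2).intervalIntegrable _ _),
    intervalIntegral.integral_add ((by fun_prop : Continuous fun s => -(2 * (HH p n x / x)) * kk p n s).intervalIntegrable _ _) (by simp), intervalIntegral.integral_const_mul,
    intervalIntegral.integral_const] at this
  change 0 ≤ QQ p n x + (-(2 * (HH p n x / x)) * HH p n x + (x - 0) • (HH p n x / x) ^ 2) at this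
  have e : QQ p n x + (-(2 * (HH p n x / x)) * HH p n x + (x - 0) • (HH p n x / x) ^ 2) = (x * QQ p n x - HH p n x ^ 2) / x := by
    simp only [smul_eq_mul]; field_simp; ring
  rw [e] at this
  have := mul_nonneg this h.le
  rw [div_mul_cancel₀ _ h.ne'] at this
  linarith
theorem HH_bt (hp : 3 / 2 < p) {x : ℝ} (hx : 0 ≤ x) : HH p n x ^ 2 ≤ 4 * (2 ^ p) ^ 2 * bt p n x :=
  (HH_sq p n hx).trans (xQ_le p n hp hx)
theorem bt_le (hp : 3 / 2 < p) {x : ℝ} (hx : 0 ≤ x) : bt p n x ≤ 2 ^ p / (p - 1) * (x + x ^ p) := by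
  have n0 : (0 : ℝ) < 1 / (n + 1) := by positivity
  have n1 : 1 / ((n : ℝ) + 1) ≤ 1 := by rw [div_le_one (by positivity)]; linarith [n.cast_nonneg (α := ℝ)]
  have p1 : 0 < p - 1 := by linarith
  have hQ : QQ p n x ≤ (x + 1 / (n + 1)) ^ (p - 1) / (p - 1) := by
    refine cmpD (F' := fun x => kk p n x ^ 2) (G := fun x => (x + 1 / ((n : ℝ) + 1)) ^ (p - 1) / (p - 1))
      (G' := fun x => (x + 1 / ((n : ℝ) + 1)) ^ (p - 2)) (fun x => QQ_d p n x) (fun x h => ?_) ?_ ?_ (fun x hx => ?_) hx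
    · have := (((hasDerivAt_id x).add_const (ei n)).rpow_const (p := p - 1) (Or.inl (by simp only [id]; positivity))).div_const (p - 1)
      refine this.congr_deriv ?_
      simp only [id]
      rw [show p - 1 - 1 = p - 2 by ring]; field_simp
    · refine ContinuousOn.div_const (ContinuousOn.rpow_const (by fun_prop) fun y hy => Or.inr p1.le) _
    · rw [QQ0]; positivity
    · have hm : max (1 - x / ((n : ℝ) + 1)) 0 ≤ 1 := max_le (by have : 0 ≤ x / ((n : ℝ) + 1) := by positivity
                                                                linarith) zero_le_one
      have : kk p n x ≤ (x + 1 / ((n : ℝ) + 1)) ^ (p / 2 - 1) := by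
        unfold kk; rw [max_eq_left hx.le]
        exact mul_le_of_le_one_right (by positivity) hm
      calc kk p n x ^ 2 ≤ ((x + 1 / ((n : ℝ) + 1)) ^ (p / 2 - 1)) ^ 2 := pow_le_pow_left₀ (kk_nn p n x) this 2
        _ = _ := by rw [← rrn, ← Real.rpow_mul (by positivity)]; congr 1; push_cast; ring
  have h1 : bt p n x ≤ x * QQ p n x := by
    have : ∫ s in (0 : ℝ)..x, QQ p n s ≤ ∫ s in (0 : ℝ)..x, QQ p n x :=
      intervalIntegral.integral_mono_on hx ((QQ_c p n).intervalIntegrable _ _) (by simp) fun s hs => QQ_mono p n hs.2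
    simpa [bt] using this
  have h2 : (x + 1 / ((n : ℝ) + 1)) ^ (p - 1) ≤ 2 ^ p * (1 + x ^ (p - 1)) := by
    calc (x + 1 / ((n : ℝ) + 1)) ^ (p - 1) ≤ (2 * max x 1) ^ (p - 1) :=
          Real.rpow_le_rpow (by positivity) (by linarith [le_max_left x 1, le_max_right x 1]) p1.le
      _ = 2 ^ (p - 1) * (max x 1) ^ (p - 1) := Real.mul_rpow (by norm_num) (by positivity)
      _ ≤ 2 ^ p * (1 + x ^ (p - 1)) := by
        gcongr
        · norm_num
        · linarith
        · have := Real.rpow_nonneg hx (p - 1)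
          rcases le_total x 1 with h | h
          · rw [max_eq_right h, Real.one_rpow]; linarith
          · rw [max_eq_left h]; linarith
  have e : x * x ^ (p - 1) = x ^ p := by
    nth_rw 1 [← Real.rpow_one x]
    rw [← Real.rpow_add' hx (by linarith)]; congr 1; ring
  calc bt p n x ≤ x * ((x + 1 / (n + 1)) ^ (p - 1) / (p - 1)) := h1.trans (by gcongr)
    _ ≤ x * (2 ^ p * (1 + x ^ (p - 1)) / (p - 1)) := by gcongr
    _ = 2 ^ p / (p - 1) * (x + x * x ^ (p - 1)) := by ring
    _ = _ := by rw [e]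
theorem xk_bt (hp : 3 / 2 < p) {x : ℝ} (hx : 0 ≤ x) : (x * kk p n x) ^ 2 ≤ 16 * (2 ^ p) ^ 4 * bt p n x := by
  have h1 := pow_le_pow_left₀ (mul_nonneg hx (kk_nn p n x)) (xk_le p n hp hx) 2
  have := mll (HH_bt p n hp hx) (by positivity : (0 : ℝ) ≤ (2 * 2 ^ p) ^ 2)
  calc _ ≤ _ := h1
    _ = (2 * 2 ^ p) ^ 2 * HH p n x ^ 2 := by ring
    _ ≤ _ := this
    _ = _ := by ring
end K
theorem sob1 : ∃ K : ℝ, 0 < K ∧ ∀ u : FV, CDI u → HasCompactSupport u →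
    ∫⁻ v, eor (u v ^ 6) ≤ eor (K * (∫ v, ∑ i, pd i u v ^ 2) ^ 3) := by
  set k : ℝ≥0 := eLpNormLESNormFDerivOfEqInnerConst (volume : Measure V3) 2
  refine ⟨(k ^ 6 + 1) * 9 ^ 3, by positivity, fun u hu hc => ?_⟩
  have h := eLpNorm_le_eLpNorm_fderiv_of_eq_inner (μ := (volume : Measure V3)) (hu.of_le (by simp)) hc (p := 2) (p' := 6) (by norm_num) (by simp) (by simp; norm_num)
  rw [eLpNorm_nnreal_eq_lintegral (by norm_num), eLpNorm_nnreal_eq_lintegral (by norm_num)] at h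
  have lu := ll_of_cd (by simp) hu
  have i1 : Integrable fun v => ∑ i, pd i u v ^ 2 := by
    simp_rw [sq]
    exact (LBM.sum fun i => (LBM.pd lu i).mul (LBM.pd lu i)).intg (by
      refine hc.mono' ?_
      intro x hx
      by_contra hn
      apply hx
      simp [pd, fderiv_of_notMem_tsupport (𝕜 := ℝ) hn])
  have h6 := ENNReal.rpow_le_rpow h (by norm_num : (0 : ℝ) ≤ 6)
  rw [ENNReal.mul_rpow_of_nonneg _ _ (by norm_num), ← ENNReal.rpow_mul, ← ENNReal.rpow_mul] at h6
  norm_num at h6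
  have e1 : ∀ v, eor (u v ^ 6) = ‖u v‖ₑ ^ 6 := fun v => by
    rw [← ofReal_norm, ← ENNReal.ofReal_pow (norm_nonneg _), rna, (by decide : Even 6).pow_abs]
  have e2 : ∫⁻ v, ‖fderiv ℝ u v‖ₑ ^ 2 ≤ eor (9 * ∫ v, ∑ i, pd i u v ^ 2) := by
    rw [← icm, oil (i1.const_mul 9) (eof fun v => by positivity)]
    refine lintegral_mono fun v => ?_
    rw [← ofReal_norm, ← ENNReal.ofReal_pow (norm_nonneg _)]
    refine eoo ?_
    have := opn_le (fderiv ℝ u v) (c := √(∑ i, pd i u v ^ 2)) fun i => by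
      refine Real.abs_le_sqrt ?_
      exact Finset.single_le_sum (f := fun i => pd i u v ^ 2) (fun _ _ => by positivity) (Finset.mem_univ i)
    have h2 := pow_le_pow_left₀ (norm_nonneg _) this 2
    rw [mul_pow, Real.sq_sqrt (Finset.sum_nonneg fun _ _ => by positivity)] at h2
    linarith
  simp_rw [e1]
  have s0 : 0 ≤ ∫ v, ∑ i, pd i u v ^ 2 := integral_nonneg fun v => Finset.sum_nonneg fun _ _ => by positivity
  calc ∫⁻ v, ‖u v‖ₑ ^ 6 ≤ _ := h6
    _ ≤ (k : ENNReal) ^ 6 * (eor (9 * ∫ v, ∑ i, pd i u v ^ 2)) ^ 3 := by gcongr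
    _ = eor (k ^ 6 * (9 * ∫ v, ∑ i, pd i u v ^ 2) ^ 3) := by
      rw [ENNReal.ofReal_mul (p := (k : ℝ) ^ 6) (by positivity), ENNReal.ofReal_pow (by positivity), ENNReal.ofReal_pow (by positivity), ENNReal.ofReal_coe_nnreal]
    _ ≤ _ := by
      refine eoo ?_
      rw [mul_pow, ← mul_assoc]
      gcongr; linarith
theorem sob : ∃ K : ℝ, 0 < K ∧ ∀ u : FV, LocallyLipschitz u → HasCompactSupport u →
    ∫⁻ v, eor (u v ^ 6) ≤ eor (K * (∫ v, ∑ i, pd i u v ^ 2) ^ 3) := by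
  obtain ⟨K, K0, hK⟩ := sob1
  refine ⟨K, K0, fun u hu hc => ?_⟩
  obtain ⟨C, hC⟩ := exists_lip hu hc
  obtain ⟨U, h1, h2, h3, h4, h5⟩ := moll (μ := (volume : Measure V3)) hC hc one_pos
  have cK : IsCompact (cthickening 1 (tsupport u)) := hc.isCompact.cthickening
  have cU : ∀ n, HasCompactSupport (U n) := fun n => cK.of_isClosed_subset (isClosed_tsupport _) (h2 n)
  have hl : Tendsto (fun n => ∫ v, ∑ i, pd i (U n) v ^ 2) atTop (𝓝 (∫ v, ∑ i, pd i u v ^ 2)) := by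
    refine tdc ((cthickening 1 (tsupport u)).indicator fun _ => 3 * (C : ℝ) ^ 2) (fun n => ?_) ?_ (fun n => ?_) ?_
    · have lu := ll_of_cd (by simp) (h1 n)
      simp_rw [sq]
      exact (LBM.sum fun i => (LBM.pd lu i).mul (LBM.pd lu i)).meas
    · exact (integrable_indicator_iff cK.isClosed.measurableSet).2 (integrableOn_const cK.measure_lt_top.ne)
    · refine eof fun v => ?_
      rw [rnn (Finset.sum_nonneg fun _ _ => by positivity)]
      by_cases hv : v ∈ cthickening 1 (tsupport u)
      · rw [indicator_of_mem hv]
        have : ∀ i, pd i (U n) v ^ 2 ≤ (C : ℝ) ^ 2 := fun i => by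
          rw [← sq_abs]
          exact pow_le_pow_left₀ (abs_nonneg _) ((abs_pd_le _ _ _).trans (h3 n v)) 2
        rw [su3]; linarith [this 0, this 1, this 2]
      · rw [indicator_of_notMem hv]
        have : fderiv ℝ (U n) v = 0 := fderiv_of_notMem_tsupport (𝕜 := ℝ) fun h => hv (h2 n h)
        simp [pd, this]
    · have : ∀ᵐ v, ∀ i, Tendsto (fun n => fderiv ℝ (U n) v (ee i)) atTop (𝓝 (fderiv ℝ u v (ee i))) := ae_all_iff.2 fun i => h5 _
      filter_upwards [this] with v hv
      exact tendsto_finsetSum _ fun i _ => (hv i).pow 2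
  calc ∫⁻ v, eor (u v ^ 6) = ∫⁻ v, liminf (fun n => eor (U n v ^ 6)) atTop := by
        refine lintegral_congr fun v => ?_
        exact ((ENNReal.continuous_ofReal.tendsto _).comp ((h4 v).pow 6)).liminf_eq.symm
    _ ≤ liminf (fun n => ∫⁻ v, eor (U n v ^ 6)) atTop := lintegral_liminf_le fun n => by
        have := (h1 n).continuous
        fun_prop
    _ ≤ liminf (fun n => eor (K * (∫ v, ∑ i, pd i (U n) v ^ 2) ^ 3)) atTop := liminf_le_liminf (eof fun n => hK _ (h1 n) (cU n))
    _ = _ := ((ENNReal.continuous_ofReal.tendsto _).comp ((hl.pow 3).const_mul K)).liminf_eq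
def sw (v : V3) : ℝ := jj v ^ (-(3 / 4) : ℝ)
theorem exps {p r : ℝ} (hp : 3 / 2 < p) (hr : 2 * p / (2 * p - 3) < r) : ∃ a1 a2 a4 : ℝ, 0 < a1 ∧ 0 < a2 ∧ 0 < a4 ∧ 3 * a4 < 1 ∧
    a1 + p * a2 = 1 ∧ a1 + a2 = 2 * a4 ∧ a2 / (1 - 3 * a4) ≤ r / p := by
  have r1 := r_gt hp hr
  have p0 : 0 < p := by linarith
  have r0 : 0 < r := by linarith
  have hη : 0 < 1 - 3 / (2 * p) - 1 / r := by
    have h1 : 1 / r < 1 / (2 * p / (2 * p - 3)) := one_div_lt_one_div_of_lt (div_pos (by linarith) (by linarith)) hr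
    have h2 : 1 / (2 * p / (2 * p - 3)) = 1 - 3 / (2 * p) := by
      have : 2 * p - 3 ≠ 0 := by linarith
      field_simp
    linarith
  set η := 1 - 3 / (2 * p) - 1 / r with hηd
  have hη1 : η < 1 := by
    have : 0 < 3 / (2 * p) := by positivity
    have : 0 < 1 / r := by positivity
    linarith
  have a1 : 0 < 1 - 2 / 3 * η := by linarith
  have k : (1 - 2 / 3 * η) / r ≤ 1 - 3 * ((2 / 3 * η + (1 - 2 / 3 * η) / p) / 2) := by
    have e1 : (1 - 2 / 3 * η) / r = 1 / r - 2 / 3 * η / r := by ring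
    have e2 : 3 * ((2 / 3 * η + (1 - 2 / 3 * η) / p) / 2) = η + 3 / (2 * p) - η / p := by field_simp; ring
    have : 0 ≤ 2 / 3 * η / r := by positivity
    have : 0 ≤ η / p := by positivity
    rw [e1, e2]; linarith
  have k0 : 0 < (1 - 2 / 3 * η) / r := by positivity
  refine ⟨2 / 3 * η, (1 - 2 / 3 * η) / p, (2 / 3 * η + (1 - 2 / 3 * η) / p) / 2, by positivity, by positivity, by positivity, by linarith, by field_simp; ring, by ring, ?_⟩
  calc (1 - 2 / 3 * η) / p / (1 - 3 * ((2 / 3 * η + (1 - 2 / 3 * η) / p) / 2)) ≤ (1 - 2 / 3 * η) / p / ((1 - 2 / 3 * η) / r) := by gcongr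
    _ = r / p := by rw [div_div_div_cancel_left' _ _ a1.ne']
theorem young {C lam e : ℝ} (hC : 0 < C) (h0 : 0 < lam) (h1 : lam < 1) (he : 0 < e) : ∃ D > 0, ∀ z y G : ℝ, 0 ≤ z → 0 ≤ y → 0 ≤ G →
    C * (z ^ (1 - lam) * y ^ (1 - lam) * G ^ lam) ≤ D * z * y + e * G := by
  set D := (C * e ^ (-lam)) ^ (1 / (1 - lam))
  have D0 : 0 < D := by positivity
  refine ⟨D, D0, fun z y G hz hy hG => ?_⟩
  have h := Real.geom_mean_le_arith_mean2_weighted (w₁ := 1 - lam) (w₂ := lam) (p₁ := D * z * y) (p₂ := e * G) (by linarith) h0.le (by positivity) (by positivity) (by ring)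
  rw [Real.mul_rpow (by positivity) hy, Real.mul_rpow (by positivity) hz, Real.mul_rpow he.le hG] at h
  have e1 : D ^ (1 - lam) = C * e ^ (-lam) := by
    rw [← Real.rpow_mul (by positivity), one_div, inv_mul_cancel₀ (by linarith), Real.rpow_one]
  have e2 : e ^ (-lam) * e ^ lam = 1 := by rw [← Real.rpow_add he]; simp
  rw [e1] at h
  have l1 : (1 - lam) * (D * z * y) ≤ D * z * y := by
    have : 0 ≤ D * z * y := by positivity
    nlinarith
  have l2 : lam * (e * G) ≤ e * G := by
    have : 0 ≤ e * G := by positivity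
    nlinarith
  calc C * (z ^ (1 - lam) * y ^ (1 - lam) * G ^ lam) = C * (e ^ (-lam) * e ^ lam) * (z ^ (1 - lam) * y ^ (1 - lam) * G ^ lam) := by rw [e2, mul_one]
    _ = C * e ^ (-lam) * z ^ (1 - lam) * y ^ (1 - lam) * (e ^ lam * G ^ lam) := by ring
    _ ≤ _ := h
    _ ≤ _ := by linarith
theorem hol_pt {p a1 a2 a4 : ℝ} {J : ℕ} (h34 : 3 * a4 < 1) (e1 : a1 + p * a2 = 1)
    (hJ : 9 / 2 * a4 ≤ J * a1) (v : V3) {f h z : ℝ} (hf : 0 ≤ f) (hh : 0 ≤ h) (hz : 0 ≤ z) (hz1 : z ≤ 1) :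
    z ^ 2 * h ^ 2 * f ≤ (jj v ^ J * f) ^ a1 * (f ^ p) ^ a2 * (h ^ 2) ^ (1 - 3 * a4) * ((z * sw v * h) ^ 6) ^ a4 := by
  have j1 := jj_one v
  have j0 := jj_pos v
  have s0 : 0 < sw v := by unfold sw; positivity
  have R0 : 0 ≤ (jj v ^ J * f) ^ a1 * (f ^ p) ^ a2 * (h ^ 2) ^ (1 - 3 * a4) * ((z * sw v * h) ^ 6) ^ a4 := by positivity
  rcases hf.eq_or_lt with e | f0
  · rw [← e] at R0 ⊢; simpa using R0
  rcases hh.eq_or_lt with e | h0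
  · rw [← e] at R0 ⊢; simpa using R0
  rcases hz.eq_or_lt with e | z0
  · rw [← e] at R0 ⊢; simpa using R0
  have q1 : (jj v ^ J * f) ^ a1 = jj v ^ (J * a1) * f ^ a1 := by
    rw [Real.mul_rpow (by positivity) hf, ← rrn, ← Real.rpow_mul j0.le]
  have q4 : ((z * sw v * h) ^ 6) ^ a4 = z ^ (6 * a4) * jj v ^ (-(9 / 2 * a4)) * h ^ (6 * a4) := by
    rw [← rrn, ← Real.rpow_mul (by positivity), Real.mul_rpow (by positivity) hh, Real.mul_rpow hz s0.le, sw, ← Real.rpow_mul j0.le]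
    push_cast
    congr 3; ring
  have q3 : (h ^ 2) ^ (1 - 3 * a4) = h ^ (2 - 6 * a4) := by
    rw [← rrn, ← Real.rpow_mul hh]; congr 1; push_cast; ring
  have q2 : (f ^ p) ^ a2 = f ^ (p * a2) := by rw [← Real.rpow_mul hf]
  rw [q1, q2, q3, q4]
  have r1 : f ^ a1 * f ^ (p * a2) = f := by rw [← Real.rpow_add f0, e1, Real.rpow_one]
  have r2 : h ^ (2 - 6 * a4) * h ^ (6 * a4) = h ^ 2 := by
    rw [← Real.rpow_add h0, show 2 - 6 * a4 + 6 * a4 = ((2 : ℕ) : ℝ) by push_cast; ring, rrn]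
  have r3 : 1 ≤ jj v ^ (J * a1) * jj v ^ (-(9 / 2 * a4)) := by
    rw [← Real.rpow_add j0]
    exact Real.one_le_rpow j1 (by linarith)
  have r4 : z ^ 2 ≤ z ^ (6 * a4) := by
    rw [← rrn]
    exact Real.rpow_le_rpow_of_exponent_ge z0 hz1 (by push_cast; linarith)
  calc z ^ 2 * h ^ 2 * f ≤ z ^ (6 * a4) * h ^ 2 * f * 1 := by rw [mul_one]; gcongr
    _ ≤ z ^ (6 * a4) * h ^ 2 * f * (jj v ^ (J * a1) * jj v ^ (-(9 / 2 * a4))) := by gcongr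
    _ = z ^ (6 * a4) * (h ^ (2 - 6 * a4) * h ^ (6 * a4)) * (f ^ a1 * f ^ (p * a2)) * (jj v ^ (J * a1) * jj v ^ (-(9 / 2 * a4))) := by rw [r1, r2]
    _ = _ := by ring
theorem hol {p r : ℝ} (hp : 3 / 2 < p) (hr : 2 * p / (2 * p - 3) < r) : ∃ J : ℕ, 0 < J ∧ ∀ M e : ℝ, 0 < M → 0 < e → ∃ C > 0,
    ∀ (f h z : FV), (∀ v, 0 ≤ f v) → (∀ v, 0 ≤ h v) → (∀ v, 0 ≤ z v) → (∀ v, z v ≤ 1) →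
    LocallyLipschitz (fun v => z v * sw v * h v) → HasCompactSupport (fun v => z v * sw v * h v) → 
    Integrable (fun v => jj v ^ J * f v) → (∫ v, jj v ^ J * f v) ≤ M →
    Integrable (fun v => |f v| ^ p) → Integrable (fun v => h v ^ 2) →
    ∫⁻ v, eor (z v ^ 2 * h v ^ 2 * f v) ≤ eor
      (C * (1 + (∫ v, |f v| ^ p) ^ (r / p)) * (∫ v, h v ^ 2) + e * ∫ v, ∑ i, pd i (fun v => z v * sw v * h v) v ^ 2) := by
  obtain ⟨a1, a2, a4, h1, h2, h4, h34, e1, e2, hr2⟩ := exps hp hr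
  obtain ⟨K, K0, hK⟩ := sob
  obtain ⟨J, hJ⟩ := exists_nat_ge (9 / 2 * a4 / a1)
  have hJ' : 9 / 2 * a4 ≤ (J + 1 : ℕ) * a1 := by
    rw [div_le_iff₀ h1] at hJ; push_cast; linarith
  refine ⟨J + 1, by omega, fun M e M0 e0 => ?_⟩
  obtain ⟨C, C0, hC⟩ := young (C := M ^ a1 * K ^ a4) (lam := 3 * a4) (e := e) (by positivity) (by positivity) h34 e0
  refine ⟨C, C0, fun f h z hf hh hz hz1 hu hc if1 hM if2 if3 => ?_⟩
  set X := ∫ v, |f v| ^ p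
  set Y := ∫ v, h v ^ 2
  set G := ∫ v, ∑ i, pd i (fun v => z v * sw v * h v) v ^ 2
  have X0 : 0 ≤ X := integral_nonneg fun v => by positivity
  have Y0 : 0 ≤ Y := integral_nonneg fun v => by positivity
  have G0 : 0 ≤ G := integral_nonneg fun v => Finset.sum_nonneg fun _ _ => by positivity
  have lp : 0 < 1 - 3 * a4 := by linarith
  let F : Fin 4 → V3 → ENNReal := ![fun v => eor (jj v ^ (J + 1) * f v), fun v => eor (|f v| ^ p), fun v => eor (h v ^ 2),
    fun v => eor ((z v * sw v * h v) ^ 6)]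
  have hF := ENNReal.lintegral_prod_norm_pow_le (μ := (volume : Measure V3)) Finset.univ (f := F) (p := ![a1, a2, 1 - 3 * a4, a4]) (fun i _ => by
      fin_cases i
      · exact if1.1.aemeasurable.ennreal_ofReal
      · exact if2.1.aemeasurable.ennreal_ofReal
      · exact if3.1.aemeasurable.ennreal_ofReal
      · exact (hu.continuous.pow 6).measurable.ennreal_ofReal.aemeasurable) (by simp [Fin.sum_univ_four]; linarith)
      (fun i _ => by fin_cases i <;> simp <;> linarith)
  simp only [Fin.prod_univ_four, F, Matrix.cons_val] at hF
  have b1 : ∫⁻ v, eor (jj v ^ (J + 1) * f v) ≤ eor M := by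
    rw [← oil if1 (eof fun v => mul_nonneg (pow_nonneg (jj_pos v).le _) (hf v))]
    exact eoo hM
  have b2 : ∫⁻ v, eor (|f v| ^ p) = eor X := by
    rw [← oil if2 (eof fun v => by positivity)]
  have b3 : ∫⁻ v, eor (h v ^ 2) = eor Y := by
    rw [← oil if3 (eof fun v => by positivity)]
  have b4 := hK _ hu hc
  rw [b2, b3] at hF
  calc _ ≤ _ := lintegral_mono fun v => ?_
    _ ≤ _ := hF
    _ ≤ eor M ^ a1 * eor X ^ a2 * eor Y ^ (1 - 3 * a4) * eor (K * G ^ 3) ^ a4 := by gcongr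
    _ = eor (M ^ a1 * X ^ a2 * Y ^ (1 - 3 * a4) * (K * G ^ 3) ^ a4) := by
      rw [eon M0.le h1.le, eon X0 h2.le, eon Y0 lp.le, eon (by positivity) h4.le,
        ← ENNReal.ofReal_mul (by positivity), ← ENNReal.ofReal_mul (by positivity), ← ENNReal.ofReal_mul (by positivity)]
    _ ≤ _ := by
      refine eoo ?_
      have x1 : X ^ (a2 / (1 - 3 * a4)) ≤ 1 + X ^ (r / p) := by
        have := Real.rpow_nonneg X0 (r / p)
        rcases le_total X 1 with hx | hx
        · linarith [Real.rpow_le_one X0 hx (by positivity : 0 ≤ a2 / (1 - 3 * a4))]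
        · linarith [Real.rpow_le_rpow_of_exponent_le hx hr2]
      have := hC (X ^ (a2 / (1 - 3 * a4))) Y G (by positivity) Y0 G0
      rw [← Real.rpow_mul X0, div_mul_cancel₀ _ lp.ne'] at this
      have g : (K * G ^ 3) ^ a4 = K ^ a4 * G ^ (3 * a4) := by
        rw [Real.mul_rpow K0.le (by positivity), ← rrn, ← Real.rpow_mul G0]; norm_num
      rw [g]
      calc _ = M ^ a1 * K ^ a4 * (X ^ a2 * Y ^ (1 - 3 * a4) * G ^ (3 * a4)) := by ring
        _ ≤ _ := this
        _ ≤ _ := by gcongr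
  rw [eon (mul_nonneg (pow_nonneg (jj_pos v).le _) (hf v)) h1.le, eon (by positivity) h2.le,
    eon (by positivity) lp.le, eon (by positivity) h4.le,
        ← ENNReal.ofReal_mul (by have := (jj_pos v).le; have := hf v; positivity), ← ENNReal.ofReal_mul (by have := (jj_pos v).le; have := hf v; positivity), ← ENNReal.ofReal_mul (by have := (jj_pos v).le; have := hf v; positivity), aon (hf v)]
  exact eoo (hol_pt h34 e1 hJ' v (hf v) (hh v) (hz v) (hz1 v))
theorem cv1 {f : FV} (hf : Nice f) (h1 : ∫ v, f v = 1) : Integrable (cv kd1 f) ∧ ∫ v, cv kd1 f v = ∫ z, kd1 z := by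
  have i1 : Integrable (fun q : V3 × V3 => kd1 (q.1 - q.2) * f q.2) (volume.prod volume) := by
    have := hf.int.convolution_integrand (ContinuousLinearMap.mul ℝ ℝ) kd1_int
    refine this.congr (eof fun q => ?_)
    simp [mul_comm]
  refine ⟨i1.integral_prod_left, ?_⟩
  unfold cv
  rw [integral_integral_swap i1]
  simp only [integral_mul_const]
  have : ∀ w : V3, ∫ v, kd1 (v - w) = ∫ z, kd1 z := fun w => integral_sub_right_eq_self kd1 w
  simp only [this]
  rw [icm, h1, mul_one]
theorem err1 {f F φ : FV} (hf : Nice f) (h1 : ∫ v, f v = 1) (hF : Continuous F) {a b η : ℝ} (hη : 0 ≤ η)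
    (ha : ∀ v, |F v| ≤ a * f v) (hb : ∀ v, |F v| ≤ b) (hφ : ∀ v, |φ v| ≤ η) (i : Fin 3) :
    |∫ v, φ v * (F v * bb f i v)| ≤ η * (b * (∫ z, kd1 z) + 2 * a) := by
  obtain ⟨i1, e1⟩ := cv1 hf h1
  have b0 : 0 ≤ b := (abs_nonneg _).trans (hb 0)
  have hk : ∀ v, cv kd f v ≤ cv kd1 f v + 2 := fun v => by
    have j1 := cv_sl hf kd_meas (C := 1) (fun z => by rw [aon (kd_nonneg z), one_mul]) v
    have j2 : Integrable fun w => kd1 (v - w) * f w := by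
      refine j1.mono' (((kd_meas.indicator msb).comp (measurable_const.sub measurable_id)).aestronglyMeasurable.mul hf.int.1) (eof fun w => ?_)
      have h0 := kd1_nonneg (v - w)
      have h1 : kd1 (v - w) ≤ kd (v - w) := indicator_le_self' (fun _ _ => kd_nonneg _) _
      rw [rnn (mul_nonneg h0 (hf.nn w))]
      exact mlr h1 (hf.nn w)
    calc cv kd f v ≤ ∫ w, (kd1 (v - w) * f w + 2 * f w) := by
          refine integral_mono j1 (j2.fun_add (hf.int.const_mul 2)) fun w => ?_
          have := mlr (kd_le (v - w)) (hf.nn w)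
          simp only; linarith
      _ = _ := by rw [integral_add j2 (hf.int.const_mul 2), icm, h1]; simp [cv]
  have hbb : ∀ v, |bb f i v| ≤ cv kd1 f v + 2 := fun v => by
    unfold bb
    rw [abs_neg, abs_mul, aop (by positivity)]
    have h2 := cv_abs hf (inv3_b1 i) v
    rw [one_mul] at h2
    have : (4 * π)⁻¹ ≤ 1 := inv_le_one_of_one_le₀ (by nlinarith [Real.pi_gt_three])
    exact (mul_le_of_le_one_left (abs_nonneg _) this).trans (h2.trans (hk v))
  have iF : Integrable fun v => |F v| := (hf.int.const_mul a).mono' hF.abs.aestronglyMeasurable (eof fun v => by simpa using ha v)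
  have k0 : ∀ v, 0 ≤ cv kd1 f v := fun v => integral_nonneg fun w => mul_nonneg (kd1_nonneg _) (hf.nn w)
  rw [← rna]
  refine (norm_integral_le_of_norm_le (((i1.const_mul b).fun_add (iF.const_mul 2)).const_mul η) (eof fun v => ?_)).trans ?_
  · rw [norm_mul, norm_mul, rna, rna, rna]
    refine mul_le_mul (hφ v) ?_ (by positivity) hη
    calc |F v| * |bb f i v| ≤ |F v| * (cv kd1 f v + 2) := by gcongr; exact hbb v
      _ = |F v| * cv kd1 f v + 2 * |F v| := by ring
      _ ≤ _ := by gcongr; exacts [k0 v, hb v]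
  · rw [icm, integral_add (i1.const_mul b) (iF.const_mul 2), icm, icm, e1]
    gcongr
    calc ∫ v, |F v| ≤ ∫ v, a * f v := integral_mono iF (hf.int.const_mul a) ha
      _ = a := by rw [icm, h1, mul_one]
theorem err2 {f F φ G : FV} (hf : Nice f) (h1 : ∫ v, f v = 1) {a η S : ℝ} (hη : 0 ≤ η)
    (ha : ∀ v, |F v| ≤ a * f v) (hG : ∀ v, |G v| ≤ S) (hφ : ∀ v, |φ v| ≤ η) :
    |∫ v, φ v * (F v * G v)| ≤ η * (a * S) := by
  have S0 : 0 ≤ S := (abs_nonneg _).trans (hG 0)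
  rw [← rna]
  refine (norm_integral_le_of_norm_le (((hf.int.const_mul a).mul_const S).const_mul η) (eof fun v => ?_)).trans ?_
  · rw [norm_mul, norm_mul, rna, rna, rna]
    refine mul_le_mul (hφ v) ?_ (by positivity) hη
    exact mul_le_mul (ha v) (hG v) (abs_nonneg _) ((abs_nonneg _).trans (ha v))
  · rw [icm, integral_mul_const, icm, h1, mul_one]
def ch (R : ℝ) (v : V3) : ℝ := ps 0 R v ^ 2
theorem ps01 (R : ℝ) (v : V3) : ps 0 R v ≤ 1 := by simpa using ps_le 0 R v
theorem ch_nn (R v) : 0 ≤ ch R v := sq_nonneg _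
theorem ch_le (R v) : ch R v ≤ 1 := pow_le_one₀ (ps_nn 0 R v) (ps01 R v)
theorem ch_cd (R : ℝ) : CDI (ch R) := (ps_cd 0 R).pow 2
theorem ch_cs {R : ℝ} (hR : 0 < R) : HasCompactSupport (ch R) :=
  HasCompactSupport.comp_left (g := fun x : ℝ => x ^ 2) (ps_cs 0 hR) (by simp)
theorem ch_d : ∃ D : ℝ, 0 < D ∧ ∀ R : ℝ, 1 ≤ R → ∀ i j v, |pd j (pd i (ch R)) v| ≤ D / √R ∧ |pd i (ch R) v| ≤ D / √R := by
  obtain ⟨D, D0, hD⟩ := ps0_d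
  refine ⟨4 * D + 2 * √D, by positivity, fun R hR i j v => ?_⟩
  have R0 : 0 < R := by linarith
  have sR : √R ≤ R := by rw [Real.sqrt_le_left (by linarith)]; nlinarith
  have s1 : 0 < √R := Real.sqrt_pos.2 R0
  have df : ∀ v, DifferentiableAt ℝ (ps 0 R) v := fun v => (ps_cd 0 R).differentiable (by simp) v
  have df1 : ∀ v, DifferentiableAt ℝ (pd i (ps 0 R)) v := fun v => (cd_pd (ps_cd 0 R) i).differentiable (by simp) v
  have e1 : pd i (ch R) = fun v => 2 * (ps 0 R v * pd i (ps 0 R) v) := funext fun v => by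
    have : ch R = fun v => ps 0 R v * ps 0 R v := funext fun v => by rw [ch, sq]
    rw [this, pd_mul (df v) (df v)]; ring
  have e2 : pd j (pd i (ch R)) v = 2 * (ps 0 R v * pd j (pd i (ps 0 R)) v + pd i (ps 0 R) v * pd j (ps 0 R) v) := by
    rw [e1, pd_cmul, pd_mul (df v) (df1 v)]
  have z0 := ps_nn 0 R v
  have z1 := ps01 R v
  have d1 : ∀ i, |pd i (ps 0 R) v| ≤ √D / √R := fun i => by
    rw [← Real.sqrt_div' _ R0.le]
    exact Real.le_sqrt_of_sq_le (hD R hR i j v).2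
  have dR : D / R ≤ D / √R := by gcongr
  have q : (√D / √R) * (√D / √R) = D / R := by rw [div_mul_div_comm, Real.mul_self_sqrt D0.le, Real.mul_self_sqrt R0.le]
  have sD : 0 ≤ √D / √R := by positivity
  have D1 : 0 ≤ D / √R := by positivity
  constructor
  · rw [e2, abs_mul, abs_two]
    have t1 : |ps 0 R v * pd j (pd i (ps 0 R)) v| ≤ D / R := by
      rw [abs_mul, aon z0]
      exact (mul_le_of_le_one_left (abs_nonneg _) z1).trans (hD R hR i j v).1
    have t2 : |pd i (ps 0 R) v * pd j (ps 0 R) v| ≤ D / R := by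
      rw [abs_mul, ← q]; exact mul_le_mul (d1 i) (d1 j) (abs_nonneg _) sD
    have := abs_add_le (ps 0 R v * pd j (pd i (ps 0 R)) v) (pd i (ps 0 R) v * pd j (ps 0 R) v)
    rw [add_div, mul_div_assoc, mul_div_assoc]
    linarith
  · rw [e1]
    simp only
    rw [abs_mul, abs_two, abs_mul, aon z0]
    have := (mul_le_of_le_one_left (abs_nonneg (pd i (ps 0 R) v)) z1).trans (d1 i)
    rw [add_div, mul_div_assoc, mul_div_assoc]
    linarith
theorem sw_pos (v) : 0 < sw v := by have := jj_pos v; unfold sw; positivity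
theorem sw_le (v) : sw v ≤ 1 := Real.rpow_le_one_of_one_le_of_nonpos (jj_one v) (by norm_num)
theorem sw_cd : CDI sw := by
  unfold sw
  exact jj_cd.rpow_const_of_ne fun v => (jj_pos v).ne'
theorem sw_sq (v) : sw v ^ 2 = wt v := by
  have j := jap_pos v
  rw [sw, wt, ← jap_sq, ← rrn, ← rrn, ← Real.rpow_mul j.le, ← Real.rpow_mul j.le, inv_pow, ← rrn, ← Real.rpow_neg j.le]
  norm_num
theorem sw_d (i v) : |pd i sw v| ≤ 3 / 2 := by
  have j := jj_pos v
  have h := (jj_hd v).rpow_const (p := (-(3 / 4) : ℝ)) (Or.inl j.ne')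
  have e : pd i sw v = (-(3 / 4) * jj v ^ (-(3 / 4) - 1 : ℝ)) * (2 * v i) := by
    unfold pd
    rw [show sw = fun v => jj v ^ (-(3 / 4) : ℝ) from rfl, h.fderiv]
    simp [EuclideanSpace.inner_single_right]
  have k : jj v ^ (-(3 / 4) - 1 : ℝ) * jj v ≤ 1 := by
    rw [← Real.rpow_add_one j.ne']
    exact Real.rpow_le_one_of_one_le_of_nonpos (jj_one v) (by norm_num)
  have v1 : |v i| ≤ jj v := by
    have := abs_coord_le v i
    unfold jj; nlinarith [sq_nonneg (‖v‖ - 1)]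
  have q : 0 ≤ jj v ^ (-(3 / 4) - 1 : ℝ) := by positivity
  rw [e, abs_mul, abs_mul, abs_mul, aon q, abs_two, abs_neg, aop (by norm_num : (0 : ℝ) < 3 / 4)]
  nlinarith [mll v1 q]
def Dn (p : ℝ) (n : ℕ) (R : ℝ) (f : FV) : ℝ := ∫ v, ch R v * (wt v * (kk p n (f v) ^ 2 * ∑ i, pd i f v ^ 2))
def Yn (p : ℝ) (n : ℕ) (f : FV) : ℝ := ∫ v, bt p n (f v)
theorem bt_int {p : ℝ} (hp : 3 / 2 < p) (n : ℕ) {f : FV} (hf : Nice f) (hi : Integrable fun v => |f v| ^ p) :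
    Integrable fun v => bt p n (f v) := by
  refine ((hf.int.fun_add hi).const_mul (2 ^ p / (p - 1))).mono' ((bt_c p n).comp hf.ll.continuous).aestronglyMeasurable (eof fun v => ?_)
  rw [rnn (bt_nn p n (hf.nn v)), aon (hf.nn v)]
  exact bt_le p n hp (hf.nn v)
theorem HH_int {p : ℝ} (hp : 3 / 2 < p) (n : ℕ) {f : FV} (hf : Nice f) (hi : Integrable fun v => |f v| ^ p) :
    Integrable (fun v => HH p n (f v) ^ 2) ∧ ∫ v, HH p n (f v) ^ 2 ≤ 4 * (2 ^ p) ^ 2 * Yn p n f := by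
  have ib := (bt_int hp n hf hi).const_mul (4 * (2 ^ p) ^ 2)
  have i : Integrable (fun v => HH p n (f v) ^ 2) := by
    refine ib.mono' (((HH_c p n).comp hf.ll.continuous).pow 2).aestronglyMeasurable (eof fun v => ?_)
    rw [rnn (by positivity)]
    exact HH_bt p n hp (hf.nn v)
  refine ⟨i, (integral_mono i ib fun v => HH_bt p n hp (hf.nn v)).trans_eq ?_⟩
  rw [icm, Yn]
theorem sum2_lbm {f : FV} (h : LocallyLipschitz f) : LBM fun v => ∑ i, pd i f v ^ 2 := by
  simp_rw [sq]
  exact LBM.sum fun i => (LBM.pd h i).mul (LBM.pd h i)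
theorem wt_c : Continuous wt := by
  have : wt = fun v => sw v ^ 2 := funext fun v => (sw_sq v).symm
  rw [this]; exact sw_cd.continuous.pow 2
theorem Dn_int (p n) {R : ℝ} (hR : 0 < R) {f : FV} (hf : LocallyLipschitz f) :
    Integrable fun v => ch R v * (wt v * (kk p n (f v) ^ 2 * ∑ i, pd i f v ^ 2)) :=
  ((LBM.of_cont (ch_cd R).continuous).mul ((LBM.of_cont wt_c).mul ((LBM.of_cont (((kk_c p n).comp hf.continuous).pow 2)).mul (sum2_lbm hf)))).intg
    (ch_cs hR).mul_right
theorem grad : ∃ D > 0, ∀ (p : ℝ) (n : ℕ) (f : FV) (R : ℝ), LocallyLipschitz f → 1 ≤ R → Integrable (fun v => HH p n (f v) ^ 2) →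
    LocallyLipschitz (fun v => ps 0 R v * sw v * HH p n (f v)) ∧ HasCompactSupport (fun v => ps 0 R v * sw v * HH p n (f v)) ∧
    ∫ v, ∑ i, pd i (fun v => ps 0 R v * sw v * HH p n (f v)) v ^ 2 ≤ 2 * Dn p n R f + D * ∫ v, HH p n (f v) ^ 2 := by
  obtain ⟨D, D0, hD⟩ := ps0_d
  refine ⟨6 * (2 * D + 5), by positivity, fun p n f R hf hR hi => ?_⟩
  have R0 : 0 < R := by linarith
  have cP : CDI fun v => ps 0 R v * sw v := (ps_cd 0 R).mul sw_cd
  have kP : HasCompactSupport fun v => ps 0 R v * sw v := (ps_cs 0 R0).mul_right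
  have lH : LocallyLipschitz fun v => HH p n (f v) := by
    have : ContDiff ℝ 1 (HH p n) := contDiff_one_iff_deriv.2 ⟨fun x => (HH_d p n x).differentiableAt, by
      rw [show deriv (HH p n) = kk p n from funext fun x => (HH_d p n x).deriv]; exact kk_c p n⟩
    exact this.locallyLipschitz.comp hf
  have lu : LocallyLipschitz (fun v => ps 0 R v * sw v * HH p n (f v)) := (ll_of_cd (by simp) cP).mulR lH
  have ku : HasCompactSupport (fun v => ps 0 R v * sw v * HH p n (f v)) := kP.mul_right
  refine ⟨lu, ku, ?_⟩
  have dP : ∀ i v, pd i (fun v => ps 0 R v * sw v) v ^ 2 ≤ 2 * D + 5 := fun i v => by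
    rw [pd_mul ((ps_cd 0 R).differentiable (by simp) v) (sw_cd.differentiable (by simp) v)]
    have h1 := sw_d i v
    have h2 := (hD R hR i i v).2
    have h3 : D / R ≤ D := div_le_self D0.le hR
    have z0 := ps_nn 0 R v
    have z1 := ps01 R v
    have s0 := sw_pos v
    have s1 := sw_le v
    have a1 : (ps 0 R v * pd i sw v) ^ 2 ≤ (3 / 2) ^ 2 := by
      rw [← sq_abs, abs_mul, aon z0]
      exact pow_le_pow_left₀ (by positivity) ((mul_le_of_le_one_left (abs_nonneg _) z1).trans h1) 2
    have a2 : (sw v * pd i (ps 0 R) v) ^ 2 ≤ D := by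
      rw [← sq_abs, abs_mul, aop s0]
      exact (pow_le_pow_left₀ (by positivity) (mul_le_of_le_one_left (abs_nonneg _) s1) 2).trans (h2.trans h3)
    nlinarith [sq_nonneg (ps 0 R v * pd i sw v - sw v * pd i (ps 0 R) v)]
  have iD := Dn_int p n R0 hf
  have iu : Integrable fun v => ∑ i, pd i (fun v => ps 0 R v * sw v * HH p n (f v)) v ^ 2 :=
    (sum2_lbm lu).intg (by
      refine ku.mono' ?_
      intro x hx
      by_contra hn
      apply hx
      simp [pd, fderiv_of_notMem_tsupport (𝕜 := ℝ) hn])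
  calc _ ≤ ∫ v, (2 * (ch R v * (wt v * (kk p n (f v) ^ 2 * ∑ i, pd i f v ^ 2))) + 6 * (2 * D + 5) * HH p n (f v) ^ 2) := by
        refine integral_mono_ae iu ((iD.const_mul 2).fun_add (hi.const_mul _)) ?_
        filter_upwards [ll_ae_diff hf] with v hv
        have e : ∀ i, pd i (fun v => ps 0 R v * sw v * HH p n (f v)) v ^ 2 ≤ 2 * (ch R v * (wt v * (kk p n (f v) ^ 2 * pd i f v ^ 2))) + 2 * (2 * D + 5) * HH p n (f v) ^ 2 := fun i => by
          have dH : DifferentiableAt ℝ (fun v => HH p n (f v)) v := (HH_d p n (f v)).differentiableAt.comp v hv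
          rw [pd_mul (f := fun v => ps 0 R v * sw v) (cP.differentiable (by simp) v) dH, pd_comp hv (HH_d p n (f v))]
          have h1 := mll (dP i v) (sq_nonneg (HH p n (f v)))
          set P := pd i (fun v => ps 0 R v * sw v) v
          rw [← sw_sq, ch]
          nlinarith [sq_nonneg (ps 0 R v * sw v * (kk p n (f v) * pd i f v) - HH p n (f v) * P)]
        have := Finset.sum_le_sum fun i (_ : i ∈ Finset.univ) => e i
        simp only [su3] at this ⊢
        linarith
    _ = _ := by
        rw [integral_add (iD.const_mul 2) (hi.const_mul _), icm, icm, Dn]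
theorem fixt {p r : ℝ} (hp : 3 / 2 < p) (hr : 2 * p / (2 * p - 3) < r) : ∃ J : ℕ, 0 < J ∧ ∀ M c : ℝ, 0 < M → 0 < c → ∃ C > 0,
    ∀ n : ℕ, ∃ E > 0, ∀ (f : FV) (S R : ℝ), Nice f → (∫ v, f v) = 1 → Integrable (fun v => jj v ^ J * f v) → (∫ v, jj v ^ J * f v) ≤ M →
    Integrable (fun v => |f v| ^ p) → (∀ v, cv (fun z => ‖z‖⁻¹) f v ≤ S) →
    (∀ v (x : Fin 3 → ℝ), c * (wt v * ∑ i, x i ^ 2) ≤ ∑ i, ∑ j, coeffA f v i j * x i * x j) → 1 ≤ R →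
    - Qf (ch R) (fun x => QQ p n x - cn p n) f + c / 2 * Dn p n R f ≤ C * (1 + (∫ v, |f v| ^ p) ^ (r / p)) * Yn p n f + E * (1 + S) / √R := by
  obtain ⟨J, J0, hJ⟩ := hol hp hr
  obtain ⟨D, D0, hD⟩ := grad
  obtain ⟨D2, D20, hD2⟩ := ch_d
  refine ⟨J, J0, fun M c M0 hc => ?_⟩
  have c00 := c0_pos
  have p0 : (0 : ℝ) < 2 ^ p := by positivity
  set e := c / (4 * c0 * 2 ^ p) with he
  have e0 : 0 < e := by positivity
  obtain ⟨C, C0, hC⟩ := hJ M e M0 e0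
  refine ⟨c0 * 2 ^ p * (C + e * D) * (4 * (2 ^ p) ^ 2), by positivity, fun n => ?_⟩
  have k1 : 0 ≤ ∫ z, kd1 z := integral_nonneg kd1_nonneg
  have cn0 := cn_nn p n
  refine ⟨6 * (D2 * (cn p n * (n + 1) * (∫ z, kd1 z) + 2 * cn p n)) + 9 * (D2 * cn p n) + 1, by positivity, fun f S R hf f1 ij iM ip hS hel hR => ?_⟩
  have R0 : 0 < R := by linarith
  have sR : 0 < √R := Real.sqrt_pos.2 R0
  have S0 : 0 ≤ S := (abs_nonneg _).trans (A_bd hf hS 0 0 0)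
  obtain ⟨iH, hH⟩ := HH_int hp n hf ip
  obtain ⟨lu, ku, hG⟩ := hD p n f R hf.ll hR iH
  have cf := hf.ll.continuous
  have key := hC f (fun v => HH p n (f v)) (ps 0 R) hf.nn (fun v => HH_nn p n (hf.nn v)) (ps_nn 0 R) (ps01 R) lu ku ij iM ip iH
  set X := ∫ v, |f v| ^ p
  have X0 : 0 ≤ X := integral_nonneg fun v => by positivity
  have κ0 : 0 ≤ X ^ (r / p) := by positivity
  set YH := ∫ v, HH p n (f v) ^ 2
  have YH0 : 0 ≤ YH := integral_nonneg fun v => by positivity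
  have G0 : 0 ≤ ∫ v, ∑ i, pd i (fun v => ps 0 R v * sw v * HH p n (f v)) v ^ 2 := integral_nonneg fun v => Finset.sum_nonneg fun _ _ => by positivity
  have cu : Continuous fun v => ps 0 R v ^ 2 * HH p n (f v) ^ 2 * f v := (((ps_cd 0 R).continuous.pow 2).mul (((HH_c p n).comp cf).pow 2)).mul cf
  have iI : Integrable fun v => ps 0 R v ^ 2 * HH p n (f v) ^ 2 * f v := cu.integrable_of_hasCompactSupport ((ch_cs R0).mul_right.mul_right)
  rw [← oil iI (eof fun v => mul_nonneg (by positivity) (hf.nn v)),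
    ENNReal.ofReal_le_ofReal_iff (by positivity)] at key
  have cγ : Continuous fun v => ch R v * (f v * (QQ p n (f v) - cn p n) - rB p n (f v)) * f v := by
    have := (QQ_c p n).comp cf
    have := (rB_ren p n).cd0.continuous.comp cf
    have := (ch_cd R).continuous
    simp only [Function.comp_def] at *
    fun_prop
  have react : ∫ v, ch R v * (f v * (QQ p n (f v) - cn p n) - rB p n (f v)) * f v ≤ 2 ^ p * ∫ v, ps 0 R v ^ 2 * HH p n (f v) ^ 2 * f v := by
    rw [← icm]
    refine integral_mono (cγ.integrable_of_hasCompactSupport ((ch_cs R0).mul_right.mul_right)) (iI.const_mul _) fun v => ?_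
    have h := ga_le p n hp (hf.nn v)
    have e : f v * (QQ p n (f v) - cn p n) - rB p n (f v) = f v * QQ p n (f v) - bt p n (f v) := by unfold rB; ring
    simp only [e, ch]
    calc _ ≤ ps 0 R v ^ 2 * (2 ^ p * HH p n (f v) ^ 2) * f v := by
          have := hf.nn v
          gcongr
      _ = _ := by ring
  have diff : c * Dn p n R f ≤ ∫ v, ch R v * (kk p n (f v) ^ 2 * ∑ i, ∑ j, coeffA f v i j * pd i f v * pd j f v) := by
    unfold Dn
    rw [← icm]
    refine integral_mono ((Dn_int p n R0 hf.ll).const_mul c) ?_ fun v => ?_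
    · exact ((LBM.of_cont (ch_cd R).continuous).mul ((LBM.of_cont (((kk_c p n).comp cf).pow 2)).mul (LBM.sum fun i => LBM.sum fun j =>
        ((A_lbm hf i j).mul (LBM.pd hf.ll i)).mul (LBM.pd hf.ll j)))).intg (ch_cs R0).mul_right
    · have := mll (hel v fun i => pd i f v) (mul_nonneg (ch_nn R v) (sq_nonneg (kk p n (f v))))
      simp only
      linarith
  have cB : Continuous fun v => rB p n (f v) := (rB_ren p n).cd0.continuous.comp cf
  have η0 : 0 ≤ D2 / √R := by positivity
  have er1 : ∀ i, |∫ v, pd i (ch R) v * (rB p n (f v) * bb f i v)| ≤ D2 / √R * (cn p n * (n + 1) * (∫ z, kd1 z) + 2 * cn p n) := fun i =>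
    err1 hf f1 cB η0 (fun v => (rB_b p n (hf.nn v)).1) (fun v => (rB_b p n (hf.nn v)).2) (fun v => (hD2 R hR i i v).2) i
  have er2 : ∀ i j, |∫ v, pd j (pd i (ch R)) v * (rB p n (f v) * coeffA f v i j)| ≤ D2 / √R * (cn p n * S) := fun i j =>
    err2 hf f1 η0 (fun v => (rB_b p n (hf.nn v)).1) (fun v => A_bd hf hS v i j) (fun v => (hD2 R hR i j v).1)
  have s1 : ∑ i, ∫ v, pd i (ch R) v * (rB p n (f v) * bb f i v) ≤ 3 * (D2 / √R * (cn p n * (n + 1) * (∫ z, kd1 z) + 2 * cn p n)) := by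
    refine (Finset.sum_le_sum fun i _ => (le_abs_self _).trans (er1 i)).trans ?_
    simp
  have s2 : ∑ i, ∑ j, ∫ v, pd j (pd i (ch R)) v * (rB p n (f v) * coeffA f v i j) ≤ 9 * (D2 / √R * (cn p n * S)) := by
    refine (Finset.sum_le_sum fun i _ => Finset.sum_le_sum fun j _ => (le_abs_self _).trans (er2 i j)).trans ?_
    simp only [Finset.sum_const, Finset.card_univ, Fintype.card_fin, nsmul_eq_mul, Nat.cast_ofNat]
    linarith
  unfold Qf
  rw [spatial hf (ch_cd R) (ch_cs R0) (rB_ren p n)]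
  set I := ∫ v, ps 0 R v ^ 2 * HH p n (f v) ^ 2 * f v
  have Y0 : 0 ≤ Yn p n f := integral_nonneg fun v => bt_nn p n (hf.nn v)
  have r1 : c0 * (2 ^ p * I) ≤ c / 2 * Dn p n R f + c0 * 2 ^ p * (C + e * D) * (4 * (2 ^ p) ^ 2) * (1 + X ^ (r / p)) * Yn p n f := by
    calc c0 * (2 ^ p * I) ≤ c0 * (2 ^ p * (C * (1 + X ^ (r / p)) * YH + e * (2 * Dn p n R f + D * YH))) := by
          gcongr
          exact key.trans (by gcongr)
      _ = c / 2 * Dn p n R f + c0 * 2 ^ p * (C * (1 + X ^ (r / p)) + e * D * 1) * YH := by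
          rw [he]; field_simp; ring
      _ ≤ c / 2 * Dn p n R f + c0 * 2 ^ p * (C * (1 + X ^ (r / p)) + e * D * (1 + X ^ (r / p))) * (4 * (2 ^ p) ^ 2 * Yn p n f) := by
          gcongr
          linarith
      _ = _ := by ring
  have r2 := mll react c00.le
  have r3 : 2 * (3 * (D2 / √R * (cn p n * (n + 1) * (∫ z, kd1 z) + 2 * cn p n))) + 9 * (D2 / √R * (cn p n * S)) ≤
      (6 * (D2 * (cn p n * (n + 1) * (∫ z, kd1 z) + 2 * cn p n)) + 9 * (D2 * cn p n) + 1) * (1 + S) / √R := by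
    rw [le_div_iff₀ sR]
    have : (2 * (3 * (D2 / √R * (cn p n * (n + 1) * (∫ z, kd1 z) + 2 * cn p n))) + 9 * (D2 / √R * (cn p n * S))) * √R =
      6 * (D2 * (cn p n * (n + 1) * (∫ z, kd1 z) + 2 * cn p n)) + 9 * (D2 * cn p n) * S := by field_simp; ring
    rw [this]
    have t1 : 0 ≤ 6 * (D2 * (cn p n * (n + 1) * (∫ z, kd1 z) + 2 * cn p n)) := by positivity
    have t2 : 0 ≤ 9 * (D2 * cn p n) := by positivity
    nlinarith [mul_nonneg t1 S0]
  linarith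
theorem gron {s t y0 : ℝ} {k y : ℝ → ℝ} (hst : s ≤ t) (k0 : ∀ τ, 0 ≤ k τ) (yy0 : ∀ τ, 0 ≤ y τ) (h0 : 0 ≤ y0)
    (ki : IntegrableOn k (Ioc s t)) (kyi : IntegrableOn (fun τ => k τ * y τ) (Ioc s t))
    (H : ∀ᵐ τ ∂volume.restrict (Ioc s t), y τ ≤ y0 + ∫ σ in s..τ, k σ * y σ) (N : ℕ) (hN : ∫ τ in s..t, k τ ≤ N / 2) :
    y0 + ∫ τ in s..t, k τ * y τ ≤ 2 ^ N * y0 := by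
  have ii : ∀ {f : ℝ → ℝ}, IntegrableOn f (Ioc s t) → ∀ a b, s ≤ a → a ≤ b → b ≤ t → IntervalIntegrable f volume a b := fun hf a b h1 h2 h3 =>
    (intervalIntegrable_iff_integrableOn_Ioc_of_le h2).2 (hf.mono_set (Ioc_subset_Ioc h1 h3))
  have key : ∀ j : ℕ, ∀ b ∈ Icc s t, ∫ τ in s..b, k τ ≤ j / 2 → y0 + ∫ τ in s..b, k τ * y τ ≤ 2 ^ j * y0 := by
    have step : ∀ a b, s ≤ a → a ≤ b → b ≤ t → (∫ τ in a..b, k τ) ≤ 1 / 2 →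
        y0 + ∫ τ in s..b, k τ * y τ ≤ 2 * (y0 + ∫ τ in s..a, k τ * y τ) := fun a b h1 h2 h3 h4 => by
      have nn : ∀ c d, c ≤ d → 0 ≤ ∫ τ in c..d, k τ * y τ := fun c d h => intervalIntegral.integral_nonneg h fun u _ => mul_nonneg (k0 u) (yy0 u)
      set Fb := y0 + ∫ τ in s..b, k τ * y τ with hF
      have Fb0 : 0 ≤ Fb := add_nonneg h0 (nn _ _ (h1.trans h2))
      have e := intervalIntegral.integral_add_adjacent_intervals (ii kyi s a le_rfl h1 (h2.trans h3)) (ii kyi a b h1 h2 h3)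
      have : ∫ τ in a..b, k τ * y τ ≤ ∫ τ in a..b, k τ * Fb := by
        refine intervalIntegral.integral_mono_ae_restrict h2 (ii kyi a b h1 h2 h3) ((ii ki a b h1 h2 h3).mul_const _) ?_
        rw [← restrict_Ioc_eq_restrict_Icc]
        filter_upwards [arr (Ioc_subset_Ioc h1 h3) H, ard measurableSet_Ioc] with τ hτ hm
        have e2 := intervalIntegral.integral_add_adjacent_intervals (ii kyi s τ le_rfl (h1.trans hm.1.le) (hm.2.trans h3)) (ii kyi τ b (h1.trans hm.1.le) hm.2 h3)
        have := nn τ b hm.2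
        exact mll (by linarith) (k0 τ)
      rw [intervalIntegral.integral_mul_const] at this
      nlinarith
    intro j
    induction j with
    | zero =>
      intro b hb hk
      have := step s b le_rfl hb.1 hb.2 (by push_cast at hk; linarith)
      have e : ∫ τ in s..b, k τ * y τ = 0 := by
        have z : ∫ τ in s..b, k τ = 0 := le_antisymm (by simpa using hk) (intervalIntegral.integral_nonneg hb.1 fun u _ => k0 u)
        rw [intervalIntegral.integral_eq_zero_iff_of_le_of_nonneg_ae hb.1 (eof k0) (ii ki s b le_rfl hb.1 hb.2)] at z
        rw [intervalIntegral.integral_of_le hb.1]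
        refine integral_eq_zero_of_ae ?_
        filter_upwards [z] with u hu
        simp only [Pi.zero_apply] at hu ⊢
        rw [hu, zero_mul]
      rw [e]; simp
    | succ j ih =>
      intro b hb hk
      by_cases hj : ∫ τ in s..b, k τ ≤ j / 2
      · refine (ih b hb hj).trans ?_
        exact mlr (pow_le_pow_right₀ (by norm_num) (by omega)) h0
      · push Not at hj
        have cont : ContinuousOn (fun b => ∫ τ in s..b, k τ) (Icc s b) :=
          intervalIntegral.continuousOn_primitive_interval (by rw [uIcc_of_le hb.1]; exact integrableOn_Icc_iff_integrableOn_Ioc (by simp) |>.2 (ki.mono_set (Ioc_subset_Ioc le_rfl hb.2)))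
            |>.mono (by rw [uIcc_of_le hb.1])
        obtain ⟨a, ha, e⟩ := intermediate_value_Icc hb.1 cont (show (j : ℝ) / 2 ∈ _ from ⟨by simp; positivity, hj.le⟩)
        have e' : ∫ τ in s..a, k τ = j / 2 := e
        have ad := intervalIntegral.integral_add_adjacent_intervals (ii ki s a le_rfl ha.1 (ha.2.trans hb.2)) (ii ki a b ha.1 ha.2 hb.2)
        push_cast at hk
        have := step a b ha.1 ha.2 hb.2 (by linarith)
        have := ih a ⟨ha.1, ha.2.trans hb.2⟩ e'.le
        rw [pow_succ]; linarith
  exact key N t ⟨hst, le_rfl⟩ hN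
theorem Sol.ymeas {T : ℝ} {g : ℝ → FV} (h : Sol T g) (p : ℝ) (n : ℕ) {s t : ℝ} (hs : 0 < s) (hst : s ≤ t) (ht : t < T) :
    AEStronglyMeasurable (fun τ => Yn p n (g τ)) (volume.restrict (Ioc s t)) ∧
    ∀ R, AEStronglyMeasurable (fun τ => Dn p n R (g τ)) (volume.restrict (Ioc s t)) := by
  have hG := (h.solG (a := s / 2) (b := (t + T) / 2) (by linarith) (by linarith) (by linarith)).ll.continuous
  have e : ∀ τ ∈ Ioc s t, g (clp (s / 2) ((t + T) / 2) τ) = g τ := fun τ hτ => by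
    rw [clp_eq ⟨by linarith [hτ.1], by linarith [hτ.2]⟩]
  constructor
  · refine AEStronglyMeasurable.congr (f := fun τ => Yn p n (g (clp (s / 2) ((t + T) / 2) τ))) (StronglyMeasurable.aestronglyMeasurable ?_) ?_
    · exact StronglyMeasurable.integral_prod_right (f := fun τ v => bt p n (g (clp (s / 2) ((t + T) / 2) τ) v)) ((bt_c p n).comp hG).stronglyMeasurable
    · filter_upwards [ard measurableSet_Ioc] with τ hτ
      rw [e τ hτ]
  · intro R
    refine AEStronglyMeasurable.congr (f := fun τ => Dn p n R (g (clp (s / 2) ((t + T) / 2) τ))) (StronglyMeasurable.aestronglyMeasurable ?_) ?_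
    · refine StronglyMeasurable.integral_prod_right (f := fun τ v => ch R v * (wt v * (kk p n (g (clp (s / 2) ((t + T) / 2) τ) v) ^ 2 * ∑ i, pd i (g (clp (s / 2) ((t + T) / 2) τ)) v ^ 2))) (Measurable.stronglyMeasurable ?_)
      refine ((ch_cd R).continuous.measurable.comp measurable_snd).mul ((wt_c.measurable.comp measurable_snd).mul ((((kk_c p n).comp hG).pow 2).measurable.mul ?_))
      exact Finset.measurable_sum _ fun i _ => (pdj_meas (G := fun τ => g (clp (s / 2) ((t + T) / 2) τ)) hG i).pow_const 2
    · filter_upwards [ard measurableSet_Ioc] with τ hτ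
      rw [e τ hτ]
theorem ch_lim (v : V3) {k : ℕ → ℕ} (hk : Tendsto k atTop atTop) : ∀ᶠ n : ℕ in atTop, ch (k n + 1) v = 1 := by
  filter_upwards [hk.eventually (zt_lim (y := jj v))] with n hn
  simp [ch, ps, hn]
theorem rB_lim {p : ℝ} (hp : 3 / 2 < p) (n : ℕ) {f : FV} (hf : Nice f) (hi : Integrable fun v => |f v| ^ p) :
    Tendsto (fun k : ℕ => ∫ v, ch (k + 1) v * rB p n (f v)) atTop (𝓝 (Yn p n f - cn p n * ∫ v, f v)) := by
  have e : Yn p n f - cn p n * ∫ v, f v = ∫ v, rB p n (f v) := by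
    unfold rB; rw [integral_sub (bt_int hp n hf hi) (hf.int.const_mul _), icm, Yn]
  rw [e]
  have rc : Continuous fun v => rB p n (f v) := ((bt_c p n).comp hf.ll.continuous).sub (continuous_const.mul hf.ll.continuous)
  refine tdc (fun v => cn p n * f v) (fun k => ((ch_cd _).continuous.mul rc).aestronglyMeasurable) (hf.int.const_mul _) (fun k => eof fun v => ?_) (eof fun v => ?_)
  · rw [norm_mul, rnn (ch_nn _ _)]
    exact (mul_le_of_le_one_left (norm_nonneg _) (ch_le _ _)).trans (rB_b p n (hf.nn v)).1
  · refine tendsto_const_nhds.congr' ?_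
    filter_upwards [ch_lim v tendsto_id] with k hk
    rw [id] at hk; rw [hk, one_mul]
def Gd (p : ℝ) (f : FV) : Prop := Nice f ∧ (∫ v, f v) = 1 ∧ Integrable fun v => |f v| ^ p
def kp (C p r : ℝ) (g : ℝ → FV) (τ : ℝ) : ℝ := C * (1 + Xp p g τ ^ (r / p))
section EE
variable {p r T M : ℝ} {J : ℕ} {g : ℝ → FV} {gi : FV}
theorem PS.gd (h : PS p r T M J g gi) : ∀ᵐ t ∂volume.restrict (Ioo 0 T), Gd p (g t) := by
  filter_upwards [h.hyp.toSol.nice, h.mass, h.mem.1] with t a b c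
  exact ⟨a, b.2, c⟩
theorem Yn_nn (n : ℕ) {f : FV} (hf : ∀ v, 0 ≤ f v) : 0 ≤ Yn p n f := integral_nonneg fun v => bt_nn p n (hf v)
theorem Dn_nn (n : ℕ) (R : ℝ) (f : FV) : 0 ≤ Dn p n R f := integral_nonneg fun v =>
  mul_nonneg (ch_nn _ _) (mul_nonneg (wt_pos v).le (mul_nonneg (sq_nonneg _) (Finset.sum_nonneg fun _ _ => sq_nonneg _)))
theorem PS.e1 (h : PS p r T M J g gi) (n : ℕ) {C c E : ℝ} (C0 : 0 < C) (c0 : 0 < c)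
    (hQ : ∀ᵐ τ ∂volume.restrict (Ioo 0 T), ∀ R, 1 ≤ R → - Qf (ch R) (fun x => QQ p n x - cn p n) (g τ) + c / 2 * Dn p n R (g τ) ≤
      C * (1 + (∫ v, |g τ v| ^ p) ^ (r / p)) * Yn p n (g τ) + E * (1 + Sf p g τ) / √R) {s t : ℝ} (hs : 0 < s) (hst : s ≤ t) (ht : t < T) :
    IntegrableOn (fun τ => kp C p r g τ * Yn p n (g τ)) (Ioc s t) ∧ ∀ R, 1 ≤ R → IntegrableOn (fun τ => Dn p n R (g τ)) (Ioc s t) ∧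
    c / 2 * ∫ τ in s..t, Dn p n R (g τ) ≤ (∫ v, ch R v * rB p n (g s v)) - (∫ v, ch R v * rB p n (g t v)) +
      (∫ τ in s..t, kp C p r g τ * Yn p n (g τ)) + (E * ∫ τ in s..t, (1 + Sf p g τ)) / √R := by
  have sub : Ioc s t ⊆ Ioo 0 T := fun x hx => ⟨hs.trans hx.1, hx.2.trans_lt ht⟩
  obtain ⟨my, md⟩ := h.hyp.toSol.ymeas p n hs hst ht
  have iS : IntegrableOn (fun τ => 1 + Sf p g τ) (Ioc s t) := (integrable_const (1:ℝ)).add (h.hyp.Si.mono_set sub)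
  have ik : IntegrableOn (kp C p r g) (Ioc s t) := ((integrable_const (1:ℝ)).add (h.mem.2.mono_set sub)).const_mul C
  have iy : IntegrableOn (fun τ => kp C p r g τ * Yn p n (g τ)) (Ioc s t) := by
    refine Integrable.mul_bdd (c := 2 * cn p n) ik my ?_
    filter_upwards [arr sub h.gd] with τ ⟨a, b, d⟩
    rw [rnn (Yn_nn n a.nn), ← mul_one (2 * cn p n), ← b, ← icm]
    refine integral_mono (bt_int h.hp n a d) (a.int.const_mul _) fun v => ?_
    have := (rB_b p n (a.nn v)).1
    have := le_abs_self (rB p n (g τ v))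
    unfold rB at *
    simp only; linarith
  refine ⟨iy, fun R hR => ?_⟩
  obtain ⟨q1, q2⟩ := h.hyp.toSol.evol (ch_cd R) (ch_cs (by linarith)) (rB_ren p n) hs hst ht
  have q1 := q1.mono_set Ioc_subset_Icc_self
  have iR : IntegrableOn (fun τ => Qf (ch R) (fun x => QQ p n x - cn p n) (g τ) + (kp C p r g τ * Yn p n (g τ) + E * (1 + Sf p g τ) / √R)) (Ioc s t) :=
    q1.add (iy.add ((iS.const_mul E).div_const _))
  have le : ∀ᵐ τ ∂volume.restrict (Ioc s t), c / 2 * Dn p n R (g τ) ≤ Qf (ch R) (fun x => QQ p n x - cn p n) (g τ) + (kp C p r g τ * Yn p n (g τ) + E * (1 + Sf p g τ) / √R) := by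
    filter_upwards [arr sub hQ] with τ hτ
    have := hτ R hR
    simp only [kp, Xp]; linarith
  have iD' : IntegrableOn (fun τ => c / 2 * Dn p n R (g τ)) (Ioc s t) := by
    refine Integrable.mono' iR ((md R).const_mul _) ?_
    filter_upwards [le] with τ hτ
    rwa [rnn (mul_nonneg (by linarith) (Dn_nn n R _))]
  have iD : IntegrableOn (fun τ => Dn p n R (g τ)) (Ioc s t) := by
    have := iD'.const_mul (2 / c)
    refine this.congr (eof fun τ => ?_)
    field_simp
  refine ⟨iD, ?_⟩
  have m := integral_mono_ae iD' iR le
  rw [icm, integral_add q1 (iy.fun_add ((iS.const_mul E).div_const _)), integral_add iy ((iS.const_mul E).div_const _), integral_div, icm] at m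
  simp only [intervalIntegral.integral_of_le hst] at q2 ⊢
  linarith
theorem PS.e2 (h : PS p r T M J g gi) (n : ℕ) {C c E : ℝ} (C0 : 0 < C) (c0 : 0 < c)
    (hQ : ∀ᵐ τ ∂volume.restrict (Ioo 0 T), ∀ R, 1 ≤ R → - Qf (ch R) (fun x => QQ p n x - cn p n) (g τ) + c / 2 * Dn p n R (g τ) ≤
      C * (1 + (∫ v, |g τ v| ^ p) ^ (r / p)) * Yn p n (g τ) + E * (1 + Sf p g τ) / √R) {s t : ℝ} (hs : 0 < s) (hst : s ≤ t) (ht : t < T)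
    (gs : Gd p (g s)) (gt : Gd p (g t)) {N : ℕ} (hN : C * (T + M) ≤ N / 2) :
    Yn p n (g t) ≤ 2 ^ N * Yn p n (g s) ∧ ∀ᶠ k : ℕ in atTop, IntegrableOn (fun τ => Dn p n (k + 1) (g τ)) (Ioc s t) ∧
      c / 2 * ∫ τ in s..t, Dn p n (k + 1) (g τ) ≤ 2 ^ N * Yn p n (g s) + 1 := by
  have lim : ∀ t, s ≤ t → t < T → Gd p (g t) → Tendsto (fun k : ℕ => (∫ v, ch (k + 1) v * rB p n (g s v)) - (∫ v, ch (k + 1) v * rB p n (g t v)) +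
      (∫ τ in s..t, kp C p r g τ * Yn p n (g τ)) + (E * ∫ τ in s..t, (1 + Sf p g τ)) / √(k + 1)) atTop
      (𝓝 (Yn p n (g s) - Yn p n (g t) + (∫ τ in s..t, kp C p r g τ * Yn p n (g τ)))) := fun t hst ht gt => by
    have l1 := rB_lim h.hp n gs.1 gs.2.2
    have l2 := rB_lim h.hp n gt.1 gt.2.2
    rw [gs.2.1] at l1
    rw [gt.2.1] at l2
    have l3 : Tendsto (fun k : ℕ => (E * ∫ τ in s..t, (1 + Sf p g τ)) / √(k + 1)) atTop (𝓝 0) :=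
      tendsto_const_nhds.div_atTop (tendsto_sqrt_atTop.comp (tendsto_atTop_add_const_right _ _ tendsto_natCast_atTop_atTop))
    convert ((l1.sub l2).add_const _).add l3 using 2
    ring
  have up : ∀ t, s ≤ t → t < T → Gd p (g t) → Yn p n (g t) ≤ Yn p n (g s) + ∫ τ in s..t, kp C p r g τ * Yn p n (g τ) := fun t hst ht gt => by
    have := ge_of_tendsto' (lim t hst ht gt) (b := 0) fun k => by
      have := ((h.e1 n C0 c0 hQ hs hst ht).2 (k + 1) (by linarith [k.cast_nonneg (α := ℝ)])).2
      refine le_trans ?_ this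
      exact mul_nonneg (by linarith) (intervalIntegral.integral_nonneg hst fun u _ => Dn_nn n _ _)
    linarith
  have sub : Ioc s t ⊆ Ioo 0 T := fun x hx => ⟨hs.trans hx.1, hx.2.trans_lt ht⟩
  have ikT : IntegrableOn (kp C p r g) (Ioo 0 T) := ((integrable_const (1:ℝ)).add h.mem.2).const_mul C
  have k0 : ∀ τ, 0 ≤ kp C p r g τ := fun τ => by have := Xp_nn p g τ; unfold kp; positivity
  have G := gron hst k0 (fun τ => Yn_nn n (h.nn τ)) (Yn_nn n gs.1.nn) (ikT.mono_set sub) (h.e1 n C0 c0 hQ hs hst ht).1 (y := fun τ => Yn p n (g τ)) (by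
      filter_upwards [arr sub h.gd, ard measurableSet_Ioc] with τ a b
      exact up τ b.1.le (b.2.trans_lt ht) a) N (by
      rw [intervalIntegral.integral_of_le hst]
      refine le_trans (setIntegral_mono_set ikT (eof k0) (LE.le.eventuallyLE sub)) (le_trans ?_ hN)
      unfold kp
      have h1 : IntegrableOn (fun τ => Xp p g τ ^ (r / p)) (Ioo 0 T) := h.mem.2
      rw [icm, integral_add (integrable_const _) h1]
      have : ∫ τ in Ioo 0 T, Xp p g τ ^ (r / p) ≤ M := h.hM
      have e : ∫ τ in Ioo 0 T, (1:ℝ) = T := by simp; linarith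
      rw [e]; gcongr)
  beta_reduce at G
  have Yt := Yn_nn (p := p) n gt.1.nn
  refine ⟨(up t hst ht gt).trans G, ?_⟩
  filter_upwards [(lim t hst ht gt).eventually_le_const (u := 2 ^ N * Yn p n (g s) + 1) (by linarith)] with k hk
  have := (h.e1 n C0 c0 hQ hs hst ht).2 (k + 1) (by linarith [k.cast_nonneg (α := ℝ)])
  exact ⟨this.1, this.2.trans hk⟩
end EE
theorem kk_lim (p : ℝ) {x : ℝ} (hx : 0 < x) : Tendsto (fun n => kk p n x) atTop (𝓝 (x ^ (p / 2 - 1))) := by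
  have a : Tendsto (fun n : ℕ => x + 1 / ((n : ℝ) + 1)) atTop (𝓝 (x + 0)) := tendsto_one_div_add_atTop_nhds_zero_nat.const_add x
  have b : Tendsto (fun n : ℕ => max (1 - x / ((n : ℝ) + 1)) 0) atTop (𝓝 (max (1 - x * 0) 0)) := by
    refine Tendsto.max (Tendsto.const_sub 1 ?_) tendsto_const_nhds
    simpa [div_eq_mul_inv] using (tendsto_one_div_add_atTop_nhds_zero_nat (𝕜 := ℝ)).const_mul x
  have := (a.rpow_const (p := p / 2 - 1) (Or.inl (by simpa using hx.ne'))).mul b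
  simpa [kk, max_eq_left hx.le] using this
theorem xkk_lim {p : ℝ} (hp : 3 / 2 < p) {x : ℝ} (hx : 0 ≤ x) : Tendsto (fun n => (x * kk p n x) ^ 2) atTop (𝓝 (x ^ p)) := by
  rcases hx.eq_or_lt with rfl | h
  · simp [Real.zero_rpow (by linarith : p ≠ 0)]
  · have := ((kk_lim p h).const_mul x).pow 2
    convert this using 2
    rw [Real.rpow_sub_one h.ne', mul_div_cancel₀ _ h.ne', ← rrn, ← Real.rpow_mul hx]
    congr 1; push_cast; ring
theorem fat1 {p : ℝ} (hp : 3 / 2 < p) {f : FV} (hf : Nice f) (hi : Integrable fun v => |f v| ^ p) {Y : ℝ} (hY : ∀ n, Yn p n f ≤ Y) :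
    ∫⁻ v, eor (f v ^ p) ≤ eor (16 * (2 ^ p) ^ 4 * Y) := by
  have e : ∀ v, eor (f v ^ p) = liminf (fun n => eor ((f v * kk p n (f v)) ^ 2)) atTop := fun v =>
    ((ENNReal.continuous_ofReal.tendsto _).comp (xkk_lim hp (hf.nn v))).liminf_eq.symm
  simp_rw [e]
  refine (lintegral_liminf_le fun n => ENNReal.continuous_ofReal.measurable.comp ((hf.ll.continuous.mul ((kk_c p n).comp hf.ll.continuous)).pow 2).measurable).trans ?_
  refine liminf_le_of_le (by isBoundedDefault) fun b hb => ?_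
  obtain ⟨n, hn⟩ := hb.exists
  refine hn.trans ?_
  have ib := (bt_int hp n hf hi).const_mul (16 * (2 ^ p) ^ 4)
  refine (lintegral_mono fun v => eoo (xk_bt p n hp (hf.nn v))).trans ?_
  rw [← oil ib (eof fun v => mul_nonneg (by positivity) (bt_nn p n (hf.nn v))), icm]
  refine eoo ?_
  have := hY n
  unfold Yn at this
  gcongr
theorem pdpow {p : ℝ} {f : FV} (hf : ∀ v, 0 ≤ f v) (hp : 3 / 2 < p) {v : V3} (hd : DifferentiableAt ℝ f v) (i : Fin 3) :
    (f v = 0 → pd i (fun w => f w ^ (p / 2)) v = 0) ∧ (f v ≠ 0 → pd i (fun w => f w ^ (p / 2)) v = p / 2 * (f v ^ (p / 2 - 1) * pd i f v)) := by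
  constructor
  · intro h
    have : IsLocalMin (fun w => f w ^ (p / 2)) v := eof fun w => by
      simp only [h]; rw [Real.zero_rpow (by linarith)]; exact Real.rpow_nonneg (hf w) _
    simp [pd, this.fderiv_eq_zero]
  · intro h
    have := (hd.hasFDerivAt.rpow_const (p := p / 2) (Or.inl h)).fderiv
    simp only [pd, this]
    simp; ring
theorem fat2 {p : ℝ} (hp : 3 / 2 < p) {f : FV} (hf : Nice f) {k : ℕ → ℕ} (hk : Tendsto k atTop atTop) {v : V3} (hd : DifferentiableAt ℝ f v) :
    eor (jap v ^ (-(3 : ℝ)) * ∑ i : Fin 3, (pd i (fun w => f w ^ (p / 2)) v) ^ 2) ≤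
    liminf (fun n => eor ((p / 2) ^ 2 * (ch (k n + 1) v * (wt v * (kk p n (f v) ^ 2 * ∑ i, pd i f v ^ 2))))) atTop := by
  have w : jap v ^ (-(3 : ℝ)) = wt v := by
    rw [Real.rpow_neg (jap_pos v).le, wt, inv_pow]; norm_cast
  by_cases h : f v = 0
  · simp [fun i => (pdpow hf.nn hp hd i).1 h]
  · simp_rw [fun i => (pdpow hf.nn hp hd i).2 h]
    refine le_of_eq (Tendsto.liminf_eq ?_).symm
    refine (ENNReal.continuous_ofReal.tendsto _).comp ?_
    have c1 : Tendsto (fun n => ch (k n + 1) v) atTop (𝓝 1) := tendsto_const_nhds.congr' (by filter_upwards [ch_lim v hk] with n hn; rw [hn])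
    have := (c1.mul ((((kk_lim p ((hf.nn v).lt_of_ne' h)).pow 2).mul_const (∑ i, pd i f v ^ 2)).const_mul (wt v))).const_mul ((p / 2) ^ 2)
    convert this using 2
    rw [w, one_mul]
    simp only [mul_pow, ← Finset.mul_sum]; ring
theorem fat3 {p T : ℝ} (hp : 3 / 2 < p) {g : ℝ → FV} (h : Sol T g) {k : ℕ → ℕ} (hk : Tendsto k atTop atTop) {s t B : ℝ} (hs : 0 < s) (hst : s ≤ t) (ht : t < T)
    (hD : ∀ n, IntegrableOn (fun τ => Dn p n (k n + 1) (g τ)) (Ioc s t) ∧ ∫ τ in s..t, Dn p n (k n + 1) (g τ) ≤ B) :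
    ∫⁻ τ in Ioc s t, ∫⁻ v : V3, eor (jap v ^ (-(3 : ℝ)) * ∑ i : Fin 3, (pd i (fun w => g τ w ^ (p / 2)) v) ^ 2) ≤
      eor ((p / 2) ^ 2 * B) := by
  have sub : Ioc s t ⊆ Ioo 0 T := fun x hx => ⟨hs.trans hx.1, hx.2.trans_lt ht⟩
  have A : ∀ᵐ τ ∂volume.restrict (Ioc s t), ∫⁻ v : V3, eor (jap v ^ (-(3 : ℝ)) * ∑ i : Fin 3, (pd i (fun w => g τ w ^ (p / 2)) v) ^ 2) ≤
      liminf (fun n => eor ((p / 2) ^ 2 * Dn p n (k n + 1) (g τ))) atTop := by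
    filter_upwards [arr sub h.nice] with τ hn
    refine (lintegral_mono_ae ((ll_ae_diff hn.ll).mono fun v hv => fat2 hp hn hk hv)).trans ?_
    have ii := fun n => (Dn_int p n (R := (k n : ℝ) + 1) (by positivity) hn.ll).const_mul ((p / 2) ^ 2)
    refine (lintegral_liminf_le' fun n => (ii n).aemeasurable.ennreal_ofReal).trans_eq ?_
    congr 1; ext n
    rw [← oil (ii n) (eof fun v => mul_nonneg (sq_nonneg _) (mul_nonneg (ch_nn _ _)
      (mul_nonneg (wt_pos v).le (mul_nonneg (sq_nonneg _) (Finset.sum_nonneg fun _ _ => sq_nonneg _))))), icm, Dn]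
  refine (lintegral_mono_ae A).trans ?_
  refine (lintegral_liminf_le' fun n => ((hD n).1.const_mul _).aemeasurable.ennreal_ofReal).trans ?_
  refine liminf_le_of_le (by isBoundedDefault) fun b hb => ?_
  obtain ⟨n, hn⟩ := hb.exists
  refine hn.trans ?_
  rw [← oil ((hD n).1.const_mul _) (eof fun τ => mul_nonneg (sq_nonneg _) (Dn_nn n _ _)), icm,
    ← intervalIntegral.integral_of_le hst]
  exact eoo (mll (hD n).2 (sq_nonneg _))
theorem ex_good {T a b : ℝ} {P : ℝ → Prop} (h : ∀ᵐ t ∂volume.restrict (Ioo 0 T), P t) (ha : 0 ≤ a) (hab : a < b) (hb : b ≤ T) : ∃ x ∈ Ioo a b, P x := by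
  have : NeBot (ae (volume.restrict (Ioo a b))) := by
    rw [ae_neBot, Ne, Measure.restrict_eq_zero]; simp [hab]
  obtain ⟨x, h1, h2⟩ := ((ae_mono ha hb h).and (ard measurableSet_Ioo)).exists
  exact ⟨x, h2, h1⟩
theorem fat4 {p T : ℝ} {g : ℝ → FV} (h : Sol T g) (p0 : 0 < p) {P : ℝ → Prop} (hP : ∀ᵐ t ∂volume.restrict (Ioo 0 T), P t) {t τ : ℝ} (ht : 0 < t) (hτ : τ ∈ Ioo t T) {B : ENNReal}
    (hB : ∀ σ ∈ Ioo t T, P σ → ∫⁻ v, eor (g σ v ^ p) ≤ B) : ∫⁻ v, eor (g τ v ^ p) ≤ B := by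
  have ex : ∀ n : ℕ, ∃ σ ∈ Ioo τ (τ + (T - τ) * (1 / (n + 1))), P σ := fun n => by
    have n0 : (0 : ℝ) < 1 / (n + 1) := by positivity
    have n1 : 1 / ((n : ℝ) + 1) ≤ 1 := by rw [div_le_one (by positivity)]; linarith [n.cast_nonneg (α := ℝ)]
    have := sub_pos.2 hτ.2
    exact ex_good hP (ht.trans hτ.1).le (by nlinarith) (by nlinarith)
  choose σ hσ hPσ using ex
  have mem : ∀ n, σ n ∈ Ioo t T := fun n => by
    have n1 : 1 / ((n : ℝ) + 1) ≤ 1 := by rw [div_le_one (by positivity)]; linarith [n.cast_nonneg (α := ℝ)]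
    have := sub_pos.2 hτ.2
    exact ⟨hτ.1.trans (hσ n).1, (hσ n).2.trans_le (by nlinarith)⟩
  have lim : Tendsto σ atTop (𝓝 τ) := by
    refine tendsto_of_tendsto_of_tendsto_of_le_of_le tendsto_const_nhds ?_ (fun n => (hσ n).1.le) fun n => (hσ n).2.le
    simpa using ((tendsto_one_div_add_atTop_nhds_zero_nat (𝕜 := ℝ)).const_mul (T - τ)).const_add τ
  have hG := (h.solG (a := t / 2) (b := (τ + T) / 2) (by linarith) (by linarith [hτ.1, hτ.2]) (by linarith [hτ.2])).ll.continuous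
  have pt : ∀ v, Tendsto (fun n => g (σ n) v) atTop (𝓝 (g τ v)) := fun v => by
    have c : Continuous fun s => g (clp (t / 2) ((τ + T) / 2) s) v := hG.comp (continuous_id.prodMk continuous_const)
    have := (c.tendsto τ).comp lim
    rw [clp_eq ⟨by linarith [hτ.1], by linarith [hτ.2]⟩] at this
    refine this.congr' ?_
    filter_upwards [lim.eventually_lt_const (show τ < (τ + T) / 2 by linarith [hτ.2])] with n hn
    simp only [Function.comp]
    rw [clp_eq ⟨by linarith [(mem n).1], hn⟩]
  have e : ∀ v, eor (g τ v ^ p) = liminf (fun n => eor (g (σ n) v ^ p)) atTop := fun v =>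
    ((ENNReal.continuous_ofReal.tendsto _).comp ((pt v).rpow_const (Or.inr p0.le))).liminf_eq.symm
  simp_rw [e]
  refine (lintegral_liminf_le fun n => ENNReal.continuous_ofReal.measurable.comp ((h.cont ⟨ht.trans (mem n).1, (mem n).2⟩).rpow_const fun _ => Or.inr p0.le).measurable).trans ?_
  refine liminf_le_of_le (by isBoundedDefault) fun b hb => ?_
  obtain ⟨n, hn⟩ := hb.exists
  exact hn.trans (hB _ (mem n) (hPσ n))
theorem gi_w {J : ℕ} {m : ℝ} (hm : 2 * (J : ℝ) < m) {gi : FV} (g0 : ∀ v, 0 ≤ gi v) (hi : Integrable fun v => gi v * jap v ^ m) (j : ℕ) (hj : j ≤ J) :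
    Integrable (fun v => jj v ^ j * gi v) ∧ ∫ v, jj v ^ j * gi v ≤ ∫ v, gi v * jap v ^ m := by
  have jc : Continuous jap := by unfold jap; fun_prop
  have e : ∀ v, jj v ^ j = jap v ^ (2 * (j : ℝ)) := fun v => by
    rw [← jap_sq, ← pow_mul, ← rrn]; push_cast; rfl
  have le : ∀ v, jj v ^ j ≤ jap v ^ m := fun v => by
    rw [e]; refine Real.rpow_le_rpow_of_exponent_le (jap_one v) ?_
    have : (j : ℝ) ≤ J := by exact_mod_cast hj
    linarith
  have pos : ∀ v, 0 < jap v ^ m := fun v => Real.rpow_pos_of_pos (jap_pos v) _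
  have i : Integrable (fun v => jj v ^ j * gi v) := by
    have := Integrable.mul_bdd (c := 1) (g := fun v => jj v ^ j / jap v ^ m) hi ?_ ?_
    · refine this.congr (eof fun v => ?_)
      have := pos v
      field_simp
    · exact ((jj_cd.continuous.pow j).div (jc.rpow_const fun v => Or.inl (jap_pos v).ne') fun v => (pos v).ne').aestronglyMeasurable
    · refine eof fun v => ?_
      rw [rnn (div_nonneg (pow_nonneg (jj_pos v).le _) (pos v).le)]
      exact (div_le_one (pos v)).2 (le v)
  refine ⟨i, integral_mono i hi fun v => ?_⟩
  simp only
  rw [mul_comm]; exact mll (le v) (g0 v)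
theorem fin_est {p r : ℝ} (hp : 3 / 2 < p) (hr : 2 * p / (2 * p - 3) < r) : ∃ J : ℕ, 0 < J ∧ ∀ T M, 0 < T → 0 < M → ∃ C > 0, ∀ g gi, PS p r T M J g gi →
    ∀ t ∈ Ioo (0 : ℝ) T, (⨆ τ ∈ Set.Ioo t T, ∫⁻ v : V3, eor (g τ v ^ p)) +
      (∫⁻ τ in Set.Ioo t T, ∫⁻ v : V3, eor (jap v ^ (-(3 : ℝ)) * ∑ i : Fin 3, (pd i (fun w => g τ w ^ (p / 2)) v) ^ 2)) ≤
            eor (C * t ^ (-(p / r))) := by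
  obtain ⟨J, J0, hJ⟩ := fixt hp hr
  refine ⟨J, J0, fun T M hT hM => ?_⟩
  obtain ⟨c, c0, hc⟩ := ell p r T M J hp hr hT
  obtain ⟨Cm, Cm0, hCm⟩ := moments J M (Ca p * ((1 + 1) * T + 1 ^ (1 - r) * M))
  obtain ⟨C, C0, hC⟩ := hJ Cm c Cm0 c0
  obtain ⟨N, hN⟩ := exists_nat_ge (2 * (C * (T + M)))
  have p0 : 0 < p := by linarith
  have p1 : 0 < p - 1 := by linarith
  have r1 := r_gt hp hr
  have r0 : 0 < r := by linarith
  set K0 := 2 ^ p / (p - 1) * (T ^ (p / r) + M ^ (p / r)) with hK0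
  have K00 : 0 < K0 := by positivity
  refine ⟨16 * (2 ^ p) ^ 4 * (2 ^ N * K0) + (p / 2) ^ 2 * (2 / c * (2 ^ N * K0 + T ^ (p / r))), by positivity, fun g gi h t ht => ?_⟩
  have mom := hCm T g gi (Sf p g) h.hyp (h.Sint le_rfl hT.le le_rfl) h.gi0 h.gij h.gijM
  have hQ : ∀ n, ∃ E, ∀ᵐ τ ∂volume.restrict (Ioo 0 T), ∀ R, 1 ≤ R → - Qf (ch R) (fun x => QQ p n x - cn p n) (g τ) + c / 2 * Dn p n R (g τ) ≤
      C * (1 + (∫ v, |g τ v| ^ p) ^ (r / p)) * Yn p n (g τ) + E * (1 + Sf p g τ) / √R := fun n => by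
    obtain ⟨E, _, hE⟩ := hC n
    refine ⟨E, ?_⟩
    filter_upwards [h.gd, mom, h.hyp.hS, hc g gi h] with τ a1 a2 a3 a4 R hR
    exact hE (g τ) _ R a1.1 a1.2.1 a2.1 a2.2 a1.2.2 a3 a4 hR
  choose E hE using hQ
  obtain ⟨s, hs, gs, xs⟩ := h.pick h.gd ht.1 ht.2.le
  have sT : s < T := hs.2.trans ht.2
  have tp : 0 < t ^ (-(p / r)) := Real.rpow_pos_of_pos ht.1 _
  have one : 1 ≤ T ^ (p / r) * t ^ (-(p / r)) := by
    rw [Real.rpow_neg ht.1.le, ← div_eq_mul_inv, one_le_div (Real.rpow_pos_of_pos ht.1 _)]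
    exact Real.rpow_le_rpow ht.1.le ht.2.le (by positivity)
  have X0 := Xp_nn p g s
  have xs' : Xp p g s ≤ M ^ (p / r) * t ^ (-(p / r)) := by
    have := Real.rpow_le_rpow (by positivity) xs (show 0 ≤ p / r by positivity)
    rw [← Real.rpow_mul X0, div_mul_div_cancel₀ p0.ne', div_self r0.ne', Real.rpow_one, Real.div_rpow hM.le ht.1.le] at this
    rwa [Real.rpow_neg ht.1.le, ← div_eq_mul_inv]
  have Y0 : ∀ n, Yn p n (g s) ≤ K0 * t ^ (-(p / r)) := fun n => by
    have : Yn p n (g s) ≤ 2 ^ p / (p - 1) * (1 + Xp p g s) := by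
      have e : 1 + Xp p g s = ∫ v, (g s v + |g s v| ^ p) := by rw [integral_add gs.1.int gs.2.2, gs.2.1, Xp]
      rw [e, ← icm]
      refine integral_mono (bt_int hp n gs.1 gs.2.2) ((gs.1.int.fun_add gs.2.2).const_mul _) fun v => ?_
      simp only; rw [aon (h.nn s v)]; exact bt_le p n hp (h.nn s v)
    refine this.trans ?_
    rw [hK0, mul_assoc, add_mul]
    gcongr
  have e2 := fun n t1 (h1 : s ≤ t1) (h2 : t1 < T) g1 => h.e2 n C0 c0 (hE n) hs.1 h1 h2 gs g1 (N := N) (by linarith)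
  have A : (⨆ τ ∈ Set.Ioo t T, ∫⁻ v : V3, eor (g τ v ^ p)) ≤ eor (16 * (2 ^ p) ^ 4 * (2 ^ N * (K0 * t ^ (-(p / r))))) := by
    refine iSup₂_le fun τ hτ => fat4 h.hyp.toSol p0 h.gd ht.1 hτ fun σ hσ gσ => ?_
    refine fat1 hp gσ.1 gσ.2.2 fun n => ((e2 n σ (hs.2.le.trans hσ.1.le) hσ.2 gσ).1).trans ?_
    have := Y0 n
    gcongr
  have B : (∫⁻ τ in Set.Ioo t T, ∫⁻ v : V3, eor (jap v ^ (-(3 : ℝ)) * ∑ i : Fin 3, (pd i (fun w => g τ w ^ (p / 2)) v) ^ 2)) ≤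
      eor ((p / 2) ^ 2 * (2 / c * (2 ^ N * (K0 * t ^ (-(p / r))) + 1))) := by
    have B1 : ∀ b ∈ Ico t T, (∫⁻ τ in Set.Ioc t b, ∫⁻ v : V3, eor (jap v ^ (-(3 : ℝ)) * ∑ i : Fin 3, (pd i (fun w => g τ w ^ (p / 2)) v) ^ 2)) ≤
      eor ((p / 2) ^ 2 * (2 / c * (2 ^ N * (K0 * t ^ (-(p / r))) + 1))) := fun b hb => by
      obtain ⟨t1, h1, g1⟩ := ex_good h.gd (ht.1.le.trans hb.1) hb.2 le_rfl
      have st1 : s ≤ t1 := hs.2.le.trans (hb.1.trans h1.1.le)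
      have ex := fun n => (((e2 n t1 st1 h1.2 g1).2).and (eventually_ge_atTop n)).exists
      choose k hk using ex
      refine (lintegral_mono_set (Ioc_subset_Ioc hs.2.le h1.1.le)).trans
        (fat3 hp h.hyp.toSol (tendsto_atTop_mono (fun n => (hk n).2) tendsto_id) hs.1 st1 h1.2 fun n => ⟨(hk n).1.1, ?_⟩)
      have l : c / 2 * ∫ τ in s..t1, Dn p n (k n + 1) (g τ) ≤ 2 ^ N * (K0 * t ^ (-(p / r))) + 1 := (hk n).1.2.trans (by have := Y0 n; gcongr)
      calc _ = 2 / c * (c / 2 * ∫ τ in s..t1, Dn p n (k n + 1) (g τ)) := by field_simp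
        _ ≤ _ := by gcongr
    have d := sub_pos.2 ht.2
    have u : Ioo t T = ⋃ n : ℕ, Ioc t (T - (T - t) * (1 / (n + 1))) := by
      ext x
      simp only [mem_iUnion, mem_Ioo, mem_Ioc]
      constructor
      · intro hx
        obtain ⟨n, hn⟩ := exists_nat_one_div_lt (show 0 < (T - x) / (T - t) from div_pos (by linarith) d)
        refine ⟨n, hx.1, ?_⟩
        rw [lt_div_iff₀ d] at hn; linarith
      · rintro ⟨n, h1, h2⟩
        have n0 : (0 : ℝ) < (T - t) * (1 / (n + 1)) := by positivity
        exact ⟨h1, by linarith⟩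
    rw [u, setLIntegral_iUnion_of_directed _ (Monotone.directed_le fun a b hab => Ioc_subset_Ioc le_rfl ?_)]
    · refine iSup_le fun n => B1 _ ?_
      have n0 : (0 : ℝ) < (T - t) * (1 / (n + 1)) := by positivity
      have n1 : 1 / ((n : ℝ) + 1) ≤ 1 := by rw [div_le_one (by positivity)]; linarith [n.cast_nonneg (α := ℝ)]
      exact ⟨by nlinarith, by linarith⟩
    · have : (1 : ℝ) / (b + 1) ≤ 1 / (a + 1) := Nat.one_div_le_one_div hab
      have := mll this d.le
      linarith
  refine (add_le_add A B).trans ?_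
  rw [← ENNReal.ofReal_add (by positivity) (by positivity)]
  refine eoo ?_
  have : (p / 2) ^ 2 * (2 / c * (2 ^ N * (K0 * t ^ (-(p / r))) + 1)) ≤ (p / 2) ^ 2 * (2 / c * (2 ^ N * (K0 * t ^ (-(p / r))) + T ^ (p / r) * t ^ (-(p / r)))) := by gcongr
  linarith
end
open MeasureTheory Real Filter Set

noncomputable section

/-- a priori L^p estimate `eq:E_bound` for Prodi–Serrin weak solutions. -/
theorem prodi_serrin_apriori (p r : ℝ) (hp : 3 / 2 < p)
    (hr : 2 * p / (2 * p - 3) < r) :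
    ∃ mstar : ℝ, 0 < mstar ∧
      ∀ m : ℝ, mstar < m →
      ∀ T M : ℝ, 0 < T → 0 < M →
      ∃ C : ℝ, 0 < C ∧
        ∀ (g : ℝ → V3 → ℝ) (g_in : V3 → ℝ),
          (∀ t v, 0 ≤ g t v) →
          MemLrLp r p T g →
          (∫ t in Set.Ioo (0 : ℝ) T, (∫ v : V3, |g t v| ^ p) ^ (r / p)) ≤ M →
          LocLipschitz T g →
          IsWeakLandauSolution T g →
          (∀ᵐ t ∂(volume.restrict (Set.Ioo 0 T)), IsNormalized (g t)) →
          AntitoneOn (fun t => ∫ v : V3, g t v * Real.log (g t v)) (Set.Ioc 0 T) →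
          (∀ v, 0 ≤ g_in v) →
          Integrable (fun v : V3 => g_in v * jap v ^ m) →
          (∫ v : V3, g_in v * jap v ^ m) ≤ M →
          Integrable (fun v : V3 => g_in v * |Real.log (g_in v)|) →
          (∫ v : V3, g_in v * |Real.log (g_in v)|) ≤ M →
          (∀ φ : V3 → ℝ, ContDiff ℝ (⊤ : ℕ∞) φ → HasCompactSupport φ →
            Filter.Tendsto (fun t => ∫ v : V3, g t v * φ v)
              (nhdsWithin 0 (Set.Ioi 0)) (nhds (∫ v : V3, g_in v * φ v))) →
          ∀ t ∈ Set.Ioo (0 : ℝ) T,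
            (⨆ τ ∈ Set.Ioo t T,
                ∫⁻ v : V3, ENNReal.ofReal (g τ v ^ p)) +
              (∫⁻ τ in Set.Ioo t T, ∫⁻ v : V3, ENNReal.ofReal
                (jap v ^ (-(3 : ℝ)) * ∑ i : Fin 3,
                  (pd i (fun w => g τ w ^ (p / 2)) v) ^ 2)) ≤
            ENNReal.ofReal (C * t ^ (-(p / r))) := by
  obtain ⟨J, J0, hJ⟩ := fin_est hp hr
  refine ⟨2 * J, by positivity, fun m hm T M hT hM => ?_⟩
  obtain ⟨C, C0, hC⟩ := hJ T M hT hM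
  refine ⟨C, C0, fun g g_in a1 a2 a3 a4 a5 a6 a7 a8 a9 a10 a11 a12 a13 => hC g g_in ⟨hp, hr, a1, a2, a3, a4, a5, a6, a7, a8, ?_, ?_, ?_, a11, a12, a13⟩⟩
  · simpa using (gi_w hm a8 a9 0 (Nat.zero_le _)).1
  · exact (gi_w hm a8 a9 J le_rfl).1
  · exact (gi_w hm a8 a9 J le_rfl).2.trans a10
end
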